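/- Let ε ∈ {1,−1}, α ∈ ℝ, and c_{ij} ∈ ℝ (i+j = 5), and let f : ℝ² → ℝ be a smooth function whose 5-jet at the origin is j⁵f(0) = y² + εx⁴ + αx³y + ε(3/8)α²x²y² + Σ_{i+j=5} c_{ij} x^i y^j (the class Π^p_{v,2}, where the Monge form has an A₃-singularity and the parabolic curve has a cusp at the origin). Assume C₁ := −5ε c₅₀ α³ + 12 c₄₁ α² − 24ε c₃₂ α + 32 c₂₃ ≠ 0. Let δ = f_xy² − f_xx·f_yy. Then δ(0) = 0, ∇δ(0) = (0,0), the 2-jet of δ at the origin equals −(3ε/2)(4x + εαy)² (a nonzero quadratic form of rank 1), and there exists η ∈ {1,−1} such that the asymptotic BDE of f is topologically equivalent at 0 to the cusp-type BDE dy² + (ηx² + y³)dx² = 0, i.e. the BDE with coefficients (a,b,c) = (1, 0, ηx² + y³). -/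

import Mathlib

open Asymptotics Filter Set

noncomputable section

/-- Partial derivative in the first variable (∂/∂x). -/
def pdx (f : ℝ × ℝ → ℝ) (p : ℝ × ℝ) : ℝ := deriv (fun s => f (s, p.2)) p.1

/-- Partial derivative in the second variable (∂/∂y). -/
def pdy (f : ℝ × ℝ → ℝ) (p : ℝ × ℝ) : ℝ := deriv (fun s => f (p.1, s)) p.2

/-- f_xx -/
def fxx (f : ℝ × ℝ → ℝ) : ℝ × ℝ → ℝ := pdx (pdx f)
/-- f_xy -/
def fxy (f : ℝ × ℝ → ℝ) : ℝ × ℝ → ℝ := pdy (pdx f)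
/-- f_yy -/
def fyy (f : ℝ × ℝ → ℝ) : ℝ × ℝ → ℝ := pdy (pdy f)

/-- The discriminant δ = f_xy² − f_xx·f_yy of the asymptotic BDE of `f`. -/
def bdeDiscr (f : ℝ × ℝ → ℝ) : ℝ × ℝ → ℝ := fun p => (fxy f p) ^ 2 - fxx f p * fyy f p

/-- The BDE `a dy² + 2b dxdy + c dx² = 0`, regarded as the family of quadratic
forms `ω_p(v) = a(p)v₂² + 2b(p)v₁v₂ + c(p)v₁²`. -/
def BDE (a b c : ℝ × ℝ → ℝ) : (ℝ × ℝ) → (ℝ × ℝ) → ℝ :=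
  fun p v => a p * v.2 ^ 2 + 2 * b p * v.1 * v.2 + c p * v.1 ^ 2

/-- The asymptotic BDE `f_yy dy² + 2 f_xy dxdy + f_xx dx² = 0` of the surface `z = f(x,y)`. -/
def asymBDE (f : ℝ × ℝ → ℝ) : (ℝ × ℝ) → (ℝ × ℝ) → ℝ := BDE (fyy f) (fxy f) (fxx f)

/-- `j^k f(0) = P` : the degree-k Taylor polynomial of `f` at the origin is `P`,
i.e. `f − P = o(‖(x,y)‖^k)` as `(x,y) → 0`. -/
def HasJetAt0 (f P : ℝ × ℝ → ℝ) (k : ℕ) : Prop :=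
  (fun p => f p - P p) =o[nhds (0 : ℝ × ℝ)] fun p => ‖p‖ ^ k

/-- `γ` is an integral curve of the BDE `ω` on the open interval `I`:
`γ` is C¹ on `I` with nowhere-vanishing derivative annihilating `ω`. -/
def IsIntegralCurveOnBDE (ω : (ℝ × ℝ) → (ℝ × ℝ) → ℝ) (γ : ℝ → ℝ × ℝ) (I : Set ℝ) : Prop :=
  (∃ a b : ℝ, I = Set.Ioo a b) ∧
  ∃ dγ : ℝ → ℝ × ℝ, ContinuousOn dγ I ∧
    ∀ t ∈ I, HasDerivAt γ (dγ t) t ∧ dγ t ≠ 0 ∧ ω (γ t) (dγ t) = 0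

/-- Topological equivalence of two BDEs at the origin: a local homeomorphism
fixing `0` sending integral curves of one to integral curves of the other. -/
def TopEquivAt0 (ω Ω : (ℝ × ℝ) → (ℝ × ℝ) → ℝ) : Prop :=
  ∃ (U V : Set (ℝ × ℝ)) (h hinv : ℝ × ℝ → ℝ × ℝ),
    IsOpen U ∧ IsOpen V ∧ (0 : ℝ × ℝ) ∈ U ∧ (0 : ℝ × ℝ) ∈ V ∧ h 0 = 0 ∧
    ContinuousOn h U ∧ ContinuousOn hinv V ∧
    Set.BijOn h U V ∧ Set.InvOn hinv h U V ∧
    (∀ γ I, IsIntegralCurveOnBDE ω γ I → Set.MapsTo γ I U →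
      ∃ σ J, IsIntegralCurveOnBDE Ω σ J ∧ h '' (γ '' I) = σ '' J) ∧
    (∀ σ J, IsIntegralCurveOnBDE Ω σ J → Set.MapsTo σ J V →
      ∃ γ I, IsIntegralCurveOnBDE ω γ I ∧ hinv '' (σ '' J) = γ '' I)

/-- Smooth equivalence of two BDEs at the origin: a local C^∞ diffeomorphism `h`
fixing `0` pulling one family of quadratic forms back to a nonvanishing multiple
of the other. -/
def SmoothEquivAt0 (ω Ω : (ℝ × ℝ) → (ℝ × ℝ) → ℝ) : Prop :=
  ∃ (U V : Set (ℝ × ℝ)) (h hinv : ℝ × ℝ → ℝ × ℝ) (ρ : ℝ × ℝ → ℝ),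
    IsOpen U ∧ IsOpen V ∧ (0 : ℝ × ℝ) ∈ U ∧ (0 : ℝ × ℝ) ∈ V ∧ h 0 = 0 ∧
    ContDiffOn ℝ (⊤ : ℕ∞) h U ∧ ContDiffOn ℝ (⊤ : ℕ∞) hinv V ∧
    Set.BijOn h U V ∧ Set.InvOn hinv h U V ∧
    ContDiffOn ℝ (⊤ : ℕ∞) ρ U ∧ (∀ p ∈ U, ρ p ≠ 0) ∧
    (∀ p ∈ U, ∀ v : ℝ × ℝ, Ω (h p) (fderiv ℝ h p v) = ρ p * ω p v)

/-- Fiber topological equivalence at `0` of two 2-parameter families of BDEs: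
a homeomorphism `φ` of parameter spaces (onto its image), fixing `0`, such that
corresponding members of the families are topologically equivalent at `0`. -/
def FiberTopEquivAt0 (ω Ω : (ℝ × ℝ) → (ℝ × ℝ) → (ℝ × ℝ) → ℝ) : Prop :=
  ∃ (W : Set (ℝ × ℝ)) (φ ψ : ℝ × ℝ → ℝ × ℝ),
    W ∈ nhds (0 : ℝ × ℝ) ∧ φ 0 = 0 ∧
    ContinuousOn φ W ∧ ContinuousOn ψ (φ '' W) ∧
    Set.InvOn ψ φ W (φ '' W) ∧
    ∀ q ∈ W, TopEquivAt0 (ω q) (Ω (φ q))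

/-- A globally well-behaved scalar ODE `y' = G s y`. -/
structure OdeOk (G : ℝ → ℝ → ℝ) (K L : NNReal) : Prop where
  cont : Continuous (fun p : ℝ × ℝ => G p.1 p.2)
  lip : ∀ s, LipschitzWith K (G s)
  bd : ∀ s y, |G s y| ≤ L

namespace OdeOk
variable {G : ℝ → ℝ → ℝ} {K L : NNReal}

theorem exists_sol (h : OdeOk G K L) (s0 y0 : ℝ) :
    ∃ y : ℝ → ℝ, y s0 = y0 ∧ ∀ s, HasDerivAt y (G s (y s)) s := by
  have key : ∀ N : ℕ, ∃ y : ℝ → ℝ, y s0 = y0 ∧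
      ∀ s ∈ Ioo (s0 - (N + 1)) (s0 + (N + 1)), HasDerivAt y (G s (y s)) s := by
    intro N
    have hm : s0 ∈ Icc (s0 - ((N : ℝ) + 1)) (s0 + (N + 1)) := by
      constructor <;> have := N.cast_nonneg (α := ℝ) <;> linarith
    have hP : IsPicardLindelof G (⟨s0, hm⟩ : Icc (s0 - ((N : ℝ) + 1)) (s0 + (N + 1))) y0
        (L * (N + 1)) 0 L K :=
      { lipschitzOnWith := fun t _ => (h.lip t).lipschitzOnWith
        continuousOn := fun x _ =>
          (h.cont.comp (continuous_id.prodMk continuous_const)).continuousOn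
        norm_le := fun t _ x _ => h.bd t x
        mul_max_le := by
          simp }
    obtain ⟨y, hy, hd⟩ := hP.exists_eq_forall_mem_Icc_hasDerivWithinAt₀
    exact ⟨y, hy, fun s hs => (hd s (Ioo_subset_Icc_self hs)).hasDerivAt (Icc_mem_nhds hs.1 hs.2)⟩
  choose Y hY0 hYd using key
  have agree : ∀ M N : ℕ, M ≤ N → EqOn (Y M) (Y N) (Ioo (s0 - (M + 1)) (s0 + (M + 1))) := by
    intro M N hMN
    have hc : (M : ℝ) ≤ N := by exact_mod_cast hMN
    have h0 := M.cast_nonneg (α := ℝ)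
    refine ODE_solution_unique_of_mem_Ioo (v := G) (s := fun _ => univ) (K := K) (t₀ := s0)
      (fun t _ => (h.lip t).lipschitzOnWith) ⟨by linarith, by linarith⟩
      (fun t ht => ⟨hYd M t ht, trivial⟩)
      (fun t ht => ⟨hYd N t ⟨by linarith [ht.1], by linarith [ht.2]⟩, trivial⟩) ?_
    rw [hY0, hY0]
  refine ⟨fun s => Y ⌈|s - s0|⌉₊ s, ?_, ?_⟩
  · simp [hY0]
  · intro s
    set N := ⌈|s - s0|⌉₊ + 1 with hN
    have hle := Nat.le_ceil |s - s0|
    have hNc : (N : ℝ) = (⌈|s - s0|⌉₊ : ℝ) + 1 := by rw [hN]; push_cast; ring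
    have hab := abs_le.1 (le_refl |s - s0|)
    have hs : s ∈ Ioo (s0 - (N : ℝ)) (s0 + N) := ⟨by linarith, by linarith⟩
    have ev : (fun s => Y ⌈|s - s0|⌉₊ s) =ᶠ[nhds s] Y N := by
      filter_upwards [Ioo_mem_nhds hs.1 hs.2] with t ht
      have h1 : |t - s0| < N := abs_lt.2 ⟨by linarith [ht.1], by linarith [ht.2]⟩
      refine agree _ N (Nat.ceil_le.2 h1.le) ?_
      have h2 := Nat.le_ceil |t - s0|
      have h3 := abs_le.1 (le_refl |t - s0|)
      exact ⟨by linarith, by linarith⟩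
    have h4 := hYd N s ⟨by linarith [hs.1], by linarith [hs.2]⟩
    have h5 : Y ⌈|s - s0|⌉₊ s = Y N s := ev.eq_of_nhds
    have := h4.congr_of_eventuallyEq ev
    simpa only [h5] using this

/-- The solution through `(s0, y0)`. -/
def sol (h : OdeOk G K L) (s0 y0 : ℝ) : ℝ → ℝ := (h.exists_sol s0 y0).choose

variable (h : OdeOk G K L)
include h

theorem sol_init (s0 y0 : ℝ) : h.sol s0 y0 s0 = y0 := (h.exists_sol s0 y0).choose_spec.1
theorem sol_deriv (s0 y0 s : ℝ) : HasDerivAt (h.sol s0 y0) (G s (h.sol s0 y0 s)) s :=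
  (h.exists_sol s0 y0).choose_spec.2 s
theorem sol_cont (s0 y0 : ℝ) : Continuous (h.sol s0 y0) :=
  continuous_iff_continuousAt.2 fun s => (h.sol_deriv s0 y0 s).continuousAt

theorem sol_unique {y : ℝ → ℝ} (hy : ∀ s, HasDerivAt y (G s (y s)) s) (s0 : ℝ) :
    h.sol s0 (y s0) = y :=
  ODE_solution_unique_univ (v := G) (s := fun _ => univ) (K := K) (t₀ := s0)
    (fun t => (h.lip t).lipschitzOnWith) (fun t => ⟨h.sol_deriv _ _ t, trivial⟩)
    (fun t => ⟨hy t, trivial⟩) (h.sol_init _ _)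

theorem sol_sol (s0 y0 s1 : ℝ) : h.sol s1 (h.sol s0 y0 s1) = h.sol s0 y0 :=
  h.sol_unique (h.sol_deriv s0 y0) s1

/-- The flow stays Lipschitz on bounded times. -/
theorem sol_dist (y1 y2 : ℝ → ℝ) (h1 : ∀ s, HasDerivAt y1 (G s (y1 s)) s)
    (h2 : ∀ s, HasDerivAt y2 (G s (y2 s)) s) (a b : ℝ) :
    |y1 b - y2 b| ≤ |y1 a - y2 a| * Real.exp (K * |b - a|) := by
  have c : ∀ y : ℝ → ℝ, (∀ s, HasDerivAt y (G s (y s)) s) → Continuous y := fun y hy =>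
    continuous_iff_continuousAt.2 fun s => (hy s).continuousAt
  rcases le_total a b with hab | hab
  · have := dist_le_of_trajectories_ODE (v := G) (K := K) (f := y1) (g := y2) (a := a) (b := b)
      (δ := |y1 a - y2 a|) h.lip (c _ h1).continuousOn (fun t _ => (h1 t).hasDerivWithinAt)
      (c _ h2).continuousOn (fun t _ => (h2 t).hasDerivWithinAt) (by rw [Real.dist_eq]) b
      ⟨hab, le_refl _⟩
    rwa [Real.dist_eq, ← abs_of_nonneg (sub_nonneg.2 hab)] at this
  · have hr : ∀ y : ℝ → ℝ, (∀ s, HasDerivAt y (G s (y s)) s) →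
        ∀ s, HasDerivAt (fun s => y (-s)) (-G (-s) (y (-s))) s := by
      intro y hy s
      have := HasDerivAt.comp s (hy (-s)) (hasDerivAt_neg s)
      rw [mul_neg_one] at this
      exact this
    have hl : ∀ t, LipschitzWith K (fun y => -G (-t) y) := fun t => by
      have := (h.lip (-t)).neg
      exact this
    have := dist_le_of_trajectories_ODE (v := fun s y => -G (-s) y) (K := K)
      (f := fun s => y1 (-s)) (g := fun s => y2 (-s)) (a := -a) (b := -b)
      (δ := |y1 a - y2 a|) hl ((c _ h1).comp continuous_neg).continuousOn
      (fun t _ => (hr _ h1 t).hasDerivWithinAt)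
      ((c _ h2).comp continuous_neg).continuousOn (fun t _ => (hr _ h2 t).hasDerivWithinAt)
      (by simp [Real.dist_eq]) (-b)
      ⟨by linarith, le_refl _⟩
    rw [Real.dist_eq] at this
    simp only [neg_neg] at this
    rwa [abs_sub_comm b a, abs_of_nonneg (sub_nonneg.2 hab), show a - b = -b - -a by ring]

/-- `s ↦ sol` is `L`-Lipschitz. -/
theorem sol_lip (s0 y0 a b : ℝ) : |h.sol s0 y0 b - h.sol s0 y0 a| ≤ L * |b - a| := by
  have := Convex.norm_image_sub_le_of_norm_hasDerivWithin_le (f := h.sol s0 y0) (s := univ)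
    (C := L) (x := a) (y := b)
    (fun t _ => (h.sol_deriv s0 y0 t).hasDerivWithinAt) (fun t _ => h.bd _ _) convex_univ
    trivial trivial
  simpa using this

/-- Joint continuity of the flow. -/
theorem sol_cont_joint : Continuous (fun q : ℝ × ℝ × ℝ => h.sol q.1 q.2.1 q.2.2) := by
  rw [continuous_iff_continuousAt]
  rintro ⟨s0, y0, s1⟩
  have key : ∀ q : ℝ × ℝ × ℝ, |h.sol q.1 q.2.1 q.2.2 - h.sol s0 y0 s1| ≤
      (|q.2.1 - y0| + L * |q.1 - s0|) * Real.exp (K * |s1 - q.1|) + L * |q.2.2 - s1| := by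
    rintro ⟨a, y, b⟩
    simp only
    have e1 := h.sol_dist (h.sol a y) (h.sol s0 y0) (h.sol_deriv _ _) (h.sol_deriv _ _) a s1
    have e2 := h.sol_lip a y s1 b
    have e3 := h.sol_lip s0 y0 s0 a
    rw [h.sol_init] at e1 e3
    have e4 : |y - h.sol s0 y0 a| ≤ |y - y0| + L * |a - s0| := by
      calc |y - h.sol s0 y0 a| = |(y - y0) - (h.sol s0 y0 a - y0)| := by congr 1; ring
        _ ≤ _ := (abs_sub _ _).trans (by linarith)
    have e5 := mul_le_mul_of_nonneg_right e4 (Real.exp_pos (K * |s1 - a|)).le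
    calc |h.sol a y b - h.sol s0 y0 s1| =
        |(h.sol a y b - h.sol a y s1) + (h.sol a y s1 - h.sol s0 y0 s1)| := by congr 1; ring
      _ ≤ _ := (abs_add_le _ _).trans (by linarith)
  rw [ContinuousAt, tendsto_iff_dist_tendsto_zero]
  have hc : Continuous (fun q : ℝ × ℝ × ℝ =>
    (|q.2.1 - y0| + L * |q.1 - s0|) * Real.exp (K * |s1 - q.1|) + L * |q.2.2 - s1|) := by fun_prop
  have := hc.tendsto (s0, y0, s1)
  simp only [sub_self, abs_zero, mul_zero, add_zero, zero_mul] at this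
  exact squeeze_zero (fun _ => dist_nonneg) (fun q => by rw [Real.dist_eq]; exact key q) this

/-- Label: value at `0` of the solution through `(s,y)`. -/
def lab (s y : ℝ) : ℝ := h.sol s y 0

theorem lab_cont : Continuous (fun p : ℝ × ℝ => h.lab p.1 p.2) :=
  h.sol_cont_joint.comp (by fun_prop : Continuous (fun p : ℝ × ℝ => (p.1, p.2, (0:ℝ))))

theorem sol_zero_lab (s y : ℝ) : h.sol 0 (h.lab s y) = h.sol s y := h.sol_sol s y 0
theorem lab_sol (u s : ℝ) : h.lab s (h.sol 0 u s) = u := by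
  rw [lab, h.sol_sol, h.sol_init]
theorem sol_lab (s y : ℝ) : h.sol 0 (h.lab s y) s = y := by
  rw [h.sol_zero_lab, h.sol_init]
theorem lab_zero (y : ℝ) : h.lab 0 y = y := h.sol_init 0 y

theorem sol_strictMono {s0 y1 y2 : ℝ} (hy : y1 < y2) (s : ℝ) : h.sol s0 y1 s < h.sol s0 y2 s := by
  by_contra hc
  push Not at hc
  have hcont : Continuous (fun t => h.sol s0 y2 t - h.sol s0 y1 t) :=
    (h.sol_cont _ _).sub (h.sol_cont _ _)
  have h0 : 0 < h.sol s0 y2 s0 - h.sol s0 y1 s0 := by simp only [h.sol_init]; linarith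
  have h1 : h.sol s0 y2 s - h.sol s0 y1 s ≤ 0 := by linarith
  obtain ⟨t, ht⟩ := mem_range_of_exists_le_of_exists_ge hcont ⟨s, h1⟩ ⟨s0, h0.le⟩
  have ht' : h.sol s0 y2 t = h.sol s0 y1 t := by simpa [sub_eq_zero] using ht
  have e : h.sol s0 y2 = h.sol s0 y1 := by
    rw [← h.sol_sol s0 y2 t, ht', h.sol_sol]
  rw [e] at h0
  simp at h0

/-- A reparametrised solution has constant label. -/
theorem lab_const {I : Set ℝ} (hI : I.OrdConnected) {s y ds dy : ℝ → ℝ}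
    (hs : ∀ t ∈ I, HasDerivAt s (ds t) t) (hy : ∀ t ∈ I, HasDerivAt y (dy t) t)
    (hds : ContinuousOn ds I)
    (heq : ∀ t ∈ I, dy t = G (s t) (y t) * ds t) {a b : ℝ} (ha : a ∈ I) (hb : b ∈ I) :
    h.lab (s a) (y a) = h.lab (s b) (y b) := by
  wlog hab : a ≤ b generalizing a b
  · exact (this hb ha (le_of_not_ge hab)).symm
  have hsub : Icc a b ⊆ I := hI.out ha hb
  obtain ⟨C, hC⟩ := isCompact_Icc.exists_bound_of_continuousOn (hds.mono hsub)
  set Y := h.sol (s a) (y a) with hY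
  have hYs : ∀ t ∈ I, HasDerivAt (fun t => Y (s t)) (G (s t) (Y (s t)) * ds t) t := fun t ht =>
    (h.sol_deriv _ _ (s t)).comp t (hs t ht)
  have hC0 : 0 ≤ C := (norm_nonneg _).trans (hC a ⟨le_refl _, hab⟩)
  have hg := norm_le_gronwallBound_of_norm_deriv_right_le (f := fun t => Y (s t) - y t)
    (f' := fun t => G (s t) (Y (s t)) * ds t - dy t) (δ := 0) (K := K * C) (ε := 0)
    (a := a) (b := b)
    (fun t ht => ((hYs t (hsub ht)).sub (hy t (hsub ht))).continuousAt.continuousWithinAt)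
    (fun t ht => ((hYs t (hsub (Ico_subset_Icc_self ht))).sub
      (hy t (hsub (Ico_subset_Icc_self ht)))).hasDerivWithinAt)
    (by simp [hY, h.sol_init])
    (fun t ht => by
      have ht' := Ico_subset_Icc_self ht
      rw [heq t (hsub ht'), ← sub_mul, norm_mul, add_zero]
      have l1 := (h.lip (s t)).dist_le_mul (Y (s t)) (y t)
      rw [dist_eq_norm, dist_eq_norm] at l1
      calc _ ≤ (K * ‖Y (s t) - y t‖) * C :=
            mul_le_mul l1 (hC t ht') (norm_nonneg _) (by positivity)
        _ = _ := by ring)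
    b ⟨hab, le_refl _⟩
  rw [gronwallBound_ε0_δ0] at hg
  have : Y (s b) = y b := by
    have := norm_le_zero_iff.1 hg
    linarith
  rw [lab, lab, ← this, hY, h.sol_sol]

end OdeOk

/-- Two transversal families on the half plane `0 ≤ s`. -/
structure HP (Gp Gm : ℝ → ℝ → ℝ) (K L : NNReal) : Prop where
  p : OdeOk Gp K L
  m : OdeOk Gm K L
  le : ∀ s y, 0 ≤ s → Gm s y ≤ Gp s y
  lt : ∀ s y, 0 < s → s ≠ 2 → Gm s y < Gp s y
  far : ∃ S, 0 ≤ S ∧ ∀ s, S ≤ s → ∀ y1 y2, Gm s y2 + 1 ≤ Gp s y1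

namespace HP
variable {Gp Gm : ℝ → ℝ → ℝ} {K L : NNReal} (h : HP Gp Gm K L)
include h

theorem cross_le {yp ym : ℝ → ℝ} (hp : ∀ s, HasDerivAt yp (Gp s (yp s)) s)
    (hm : ∀ s, HasDerivAt ym (Gm s (ym s)) s) {s1 s2 : ℝ} (h0 : 0 ≤ s1) (h12 : s1 ≤ s2)
    (hle : ym s1 ≤ yp s1) : ym s2 ≤ yp s2 := by
  have key : ∀ ε > 0, ym s2 - yp s2 ≤ ε * Real.exp ((K + 1) * s2) := by
    intro ε hε
    have hB : ∀ x, HasDerivAt (fun s => ε * Real.exp ((K + 1) * s))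
        (ε * (Real.exp ((K + 1) * x) * ((K + 1) * 1))) x := fun x =>
      (((hasDerivAt_id x).const_mul ((K : ℝ) + 1)).exp).const_mul ε
    refine image_le_of_deriv_right_lt_deriv_boundary' (f := fun s => ym s - yp s)
      (f' := fun s => Gm s (ym s) - Gp s (yp s)) (a := s1) (b := s2)
      (B := fun s => ε * Real.exp ((K + 1) * s))
      (fun t _ => ((hm t).sub (hp t)).continuousAt.continuousWithinAt)
      (fun t _ => ((hm t).sub (hp t)).hasDerivWithinAt) ?_
      (fun t _ => (hB t).continuousAt.continuousWithinAt)
      (fun t _ => (hB t).hasDerivWithinAt) ?_ ⟨h12, le_refl _⟩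
    · have : 0 < ε * Real.exp ((K + 1) * s1) := by positivity
      linarith
    · intro x hx he
      have hpos : 0 < ε * Real.exp ((K + 1) * x) := by positivity
      have l1 := (h.p.lip x).dist_le_mul (ym x) (yp x)
      rw [Real.dist_eq, Real.dist_eq] at l1
      have he : ym x - yp x = ε * Real.exp ((K + 1) * x) := he
      rw [abs_of_pos (a := ym x - yp x) (by linarith), he] at l1
      have l2 := (abs_le.1 l1).2
      have l3 := h.le x (ym x) (h0.trans hx.1)
      nlinarith
  by_contra hc
  push Not at hc
  have he := Real.exp_pos (((K : ℝ) + 1) * s2)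
  have := key ((ym s2 - yp s2) / (2 * Real.exp ((K + 1) * s2))) (div_pos (by linarith) (by positivity))
  have e2 : (ym s2 - yp s2) / (2 * Real.exp ((K + 1) * s2)) * Real.exp ((K + 1) * s2)
    = (ym s2 - yp s2) / 2 := by field_simp
  linarith

theorem cross {yp ym : ℝ → ℝ} (hp : ∀ s, HasDerivAt yp (Gp s (yp s)) s)
    (hm : ∀ s, HasDerivAt ym (Gm s (ym s)) s) {s1 s2 : ℝ} (h0 : 0 ≤ s1) (h12 : s1 < s2)
    (hle : ym s1 ≤ yp s1) : ym s2 < yp s2 := by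
  have hge : ∀ s ∈ Icc s1 s2, ym s ≤ yp s := fun s hs => h.cross_le hp hm h0 hs.1 hle
  rcases (hge s2 ⟨h12.le, le_refl _⟩).lt_or_eq with hlt | heq
  · exact hlt
  exfalso
  have hd : ∀ s, HasDerivAt (fun s => (yp s - ym s) * Real.exp (K * s))
      ((Gp s (yp s) - Gm s (ym s)) * Real.exp (K * s) +
        (yp s - ym s) * (Real.exp (K * s) * (K * 1))) s := fun s =>
    ((hp s).sub (hm s)).mul (((hasDerivAt_id s).const_mul (K : ℝ)).exp)
  have hmono : MonotoneOn (fun s => (yp s - ym s) * Real.exp (K * s)) (Icc s1 s2) := by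
    refine monotoneOn_of_deriv_nonneg (convex_Icc _ _)
      (fun s _ => (hd s).continuousAt.continuousWithinAt)
      (fun s _ => (hd s).differentiableAt.differentiableWithinAt) ?_
    intro s hs
    rw [interior_Icc] at hs
    rw [(hd s).deriv]
    have l1 := (h.p.lip s).dist_le_mul (yp s) (ym s)
    have l0 := hge s ⟨hs.1.le, hs.2.le⟩
    rw [Real.dist_eq, Real.dist_eq, abs_of_nonneg (sub_nonneg.2 l0)] at l1
    have l2 := (abs_le.1 l1).1
    have l3 := h.le s (ym s) (h0.trans hs.1.le)
    have := Real.exp_pos (K * s)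
    have : 0 ≤ (Gp s (yp s) - Gm s (ym s) + K * (yp s - ym s)) * Real.exp (K * s) :=
      mul_nonneg (by linarith) this.le
    linarith
  have hz : ∀ s ∈ Icc s1 s2, yp s = ym s := by
    intro s hs
    have a1 := hmono hs ⟨h12.le, le_refl _⟩ hs.2
    simp only [heq, sub_self, zero_mul] at a1
    have := Real.exp_pos (K * s)
    have := hge s hs
    nlinarith
  obtain ⟨s, hs, hs2⟩ : ∃ s ∈ Ioo s1 s2, s ≠ 2 := by
    by_cases hc : (s1 + s2) / 2 = 2
    · exact ⟨(s1 + 2) / 2, ⟨by linarith, by linarith⟩, by intro hh; linarith⟩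
    · exact ⟨(s1 + s2) / 2, ⟨by linarith, by linarith⟩, hc⟩
  have e1 : (fun s => yp s - ym s) =ᶠ[nhds s] fun _ => 0 := by
    filter_upwards [Ioo_mem_nhds hs.1 hs.2] with t ht
    rw [hz t ⟨ht.1.le, ht.2.le⟩, sub_self]
  have e2 := ((hp s).sub (hm s)).unique ((hasDerivAt_const s (0:ℝ)).congr_of_eventuallyEq e1)
  have e3 := h.lt s (ym s) (by linarith [hs.1]) hs2
  rw [hz s ⟨hs.1.le, hs.2.le⟩] at e2
  linarith

theorem sol_cross {u v s1 s2 : ℝ} (h0 : 0 ≤ s1) (h12 : s1 < s2)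
    (hle : h.m.sol 0 v s1 ≤ h.p.sol 0 u s1) : h.m.sol 0 v s2 < h.p.sol 0 u s2 :=
  h.cross (h.p.sol_deriv 0 u) (h.m.sol_deriv 0 v) h0 h12 hle

theorem exists_root {u v : ℝ} (huv : u ≤ v) : ∃ s, 0 ≤ s ∧ h.p.sol 0 u s = h.m.sol 0 v s := by
  obtain ⟨S, hS0, hS⟩ := h.far
  set e : ℝ → ℝ := fun s => h.p.sol 0 u s - h.m.sol 0 v s with he
  have hd : ∀ s, HasDerivAt e (Gp s (h.p.sol 0 u s) - Gm s (h.m.sol 0 v s)) s := fun s =>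
    (h.p.sol_deriv 0 u s).sub (h.m.sol_deriv 0 v s)
  have hc : Continuous e := continuous_iff_continuousAt.2 fun s => (hd s).continuousAt
  set S2 := S + |e S| with hS2
  have hSS : S ≤ S2 := by have := abs_nonneg (e S); linarith
  have hbig : 0 ≤ e S2 := by
    have := (convex_Ici S).mul_sub_le_image_sub_of_le_deriv (f := e) (C := 1) hc.continuousOn
      (fun s _ => (hd s).differentiableAt.differentiableWithinAt)
      (fun s hs => by
        rw [interior_Ici] at hs
        rw [(hd s).deriv]
        linarith [hS s (le_of_lt hs) (h.p.sol 0 u s) (h.m.sol 0 v s)]) S self_mem_Ici S2 hSS hSS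
    have := neg_abs_le (e S)
    linarith
  have h0 : e 0 ≤ 0 := by simp only [he, OdeOk.sol_init]; linarith
  obtain ⟨s, hs, hs'⟩ := intermediate_value_Icc (hS0.trans hSS) hc.continuousOn ⟨h0, hbig⟩
  exact ⟨s, hs.1, by simp only [he] at hs'; linarith⟩

open Classical in
/-- Crossing parameter of the leaves labelled `u`, `v`. -/
def root (u v : ℝ) : ℝ := if huv : u ≤ v then (h.exists_root huv).choose else 0

theorem root_nonneg (u v : ℝ) : 0 ≤ h.root u v := by
  unfold root
  split_ifs with huv
  · exact (h.exists_root huv).choose_spec.1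
  · exact le_refl _

theorem root_eq {u v : ℝ} (huv : u ≤ v) : h.p.sol 0 u (h.root u v) = h.m.sol 0 v (h.root u v) := by
  rw [root, dif_pos huv]
  exact (h.exists_root huv).choose_spec.2

theorem root_lt {u v s : ℝ} (huv : u ≤ v) (hs : 0 ≤ s) (hlt : h.m.sol 0 v s < h.p.sol 0 u s) :
    h.root u v < s := by
  by_contra hc
  push Not at hc
  rcases hc.eq_or_lt with e | e
  · have := h.root_eq huv
    rw [← e] at this
    linarith
  · have := h.sol_cross hs e hlt.le
    linarith [h.root_eq huv]

theorem lt_root {u v s : ℝ} (huv : u ≤ v) (hlt : h.p.sol 0 u s < h.m.sol 0 v s) :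
    s < h.root u v := by
  by_contra hc
  push Not at hc
  rcases hc.eq_or_lt with e | e
  · have := h.root_eq huv
    rw [e] at this
    linarith
  · have := h.sol_cross (h.root_nonneg u v) e (h.root_eq huv).ge
    linarith

theorem root_unique {u v s : ℝ} (huv : u ≤ v) (hs : 0 ≤ s)
    (he : h.p.sol 0 u s = h.m.sol 0 v s) : h.root u v = s := by
  rcases lt_trichotomy (h.root u v) s with e | e | e
  · have := h.sol_cross (h.root_nonneg u v) e (h.root_eq huv).ge
    linarith
  · exact e
  · have := h.sol_cross hs e he.ge
    linarith [h.root_eq huv]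

theorem root_cont : ContinuousOn (fun q : ℝ × ℝ => h.root q.1 q.2) {q | q.1 ≤ q.2} := by
  rintro ⟨u, v⟩ huv
  have cp : ∀ s, Continuous (fun q : ℝ × ℝ => h.p.sol 0 q.1 s) := fun s =>
    h.p.sol_cont_joint.comp (by fun_prop : Continuous (fun q : ℝ × ℝ => ((0:ℝ), q.1, s)))
  have cm : ∀ s, Continuous (fun q : ℝ × ℝ => h.m.sol 0 q.2 s) := fun s =>
    h.m.sol_cont_joint.comp (by fun_prop : Continuous (fun q : ℝ × ℝ => ((0:ℝ), q.2, s)))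
  refine tendsto_order.2 ⟨fun a ha => ?_, fun b hb => ?_⟩
  · simp only at ha
    rcases lt_or_ge a 0 with ha0 | ha0
    · exact Eventually.of_forall fun q => ha0.trans_le (h.root_nonneg _ _)
    have hlt : h.p.sol 0 u a < h.m.sol 0 v a := by
      by_contra hc
      push Not at hc
      have := h.sol_cross ha0 ha hc
      linarith [h.root_eq (show u ≤ v from huv)]
    have ev : ∀ᶠ q in nhds ((u, v) : ℝ × ℝ), h.p.sol 0 q.1 a < h.m.sol 0 q.2 a :=
      (cp a).continuousAt.eventually_lt (cm a).continuousAt hlt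
    filter_upwards [self_mem_nhdsWithin, nhdsWithin_le_nhds ev] with q hq hq2
    exact h.lt_root hq hq2
  · simp only at hb
    have hlt := h.sol_cross (h.root_nonneg u v) hb (h.root_eq (show u ≤ v from huv)).ge
    have ev : ∀ᶠ q in nhds ((u, v) : ℝ × ℝ), h.m.sol 0 q.2 b < h.p.sol 0 q.1 b :=
      (cm b).continuousAt.eventually_lt (cp b).continuousAt hlt
    filter_upwards [self_mem_nhdsWithin, nhdsWithin_le_nhds ev] with q hq hq2
    exact h.root_lt hq ((h.root_nonneg u v).trans hb.le) hq2

/-- Labels of a point. -/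
def labs (q : ℝ × ℝ) : ℝ × ℝ := (h.p.lab q.1 q.2, h.m.lab q.1 q.2)
/-- Point with given labels. -/
def inv (q : ℝ × ℝ) : ℝ × ℝ := (h.root q.1 q.2, h.p.sol 0 q.1 (h.root q.1 q.2))

theorem labs_cont : Continuous h.labs := h.p.lab_cont.prodMk h.m.lab_cont

theorem labs_le {q : ℝ × ℝ} (hq : 0 ≤ q.1) : (h.labs q).1 ≤ (h.labs q).2 := by
  by_contra hc
  push Not at hc
  simp only [labs] at hc
  have e1 := h.p.sol_lab q.1 q.2
  have e2 := h.m.sol_lab q.1 q.2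
  rcases hq.eq_or_lt with e | e
  · rw [← e] at e1 e2
    rw [h.p.sol_init] at e1
    rw [h.m.sol_init] at e2
    rw [← e] at hc
    linarith
  · have := h.sol_cross (u := h.p.lab q.1 q.2) (v := h.m.lab q.1 q.2) le_rfl e
      (by rw [h.p.sol_init, h.m.sol_init]; exact hc.le)
    linarith

theorem inv_labs {q : ℝ × ℝ} (hq : 0 ≤ q.1) : h.inv (h.labs q) = q := by
  have hr : h.root (h.labs q).1 (h.labs q).2 = q.1 := by
    refine h.root_unique (h.labs_le hq) hq ?_
    simp only [labs]
    rw [h.p.sol_lab, h.m.sol_lab]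
  ext
  · exact hr
  · simp only [inv]
    rw [hr]
    exact h.p.sol_lab q.1 q.2

theorem labs_inv {q : ℝ × ℝ} (hq : q.1 ≤ q.2) : h.labs (h.inv q) = q := by
  ext
  · exact h.p.lab_sol q.1 _
  · simp only [labs, inv]
    rw [h.root_eq hq]
    exact h.m.lab_sol q.2 _

theorem inv_nonneg (q : ℝ × ℝ) : 0 ≤ (h.inv q).1 := h.root_nonneg _ _

theorem inv_cont : ContinuousOn h.inv {q | q.1 ≤ q.2} := by
  refine h.root_cont.prodMk ?_
  exact h.p.sol_cont_joint.comp_continuousOn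
    ((continuousOn_const (c := (0:ℝ))).prodMk (continuousOn_fst.prodMk h.root_cont))

theorem inv_diag (u : ℝ) : h.inv (u, u) = (0, u) := by
  have : h.labs (0, u) = (u, u) := by simp [labs, OdeOk.lab_zero]
  rw [← this, h.inv_labs le_rfl]

/-- Return map between the labels `s = 0`, through `s = 2`. -/
def T (u : ℝ) : ℝ := h.m.lab 2 (h.p.sol 0 u 2)

theorem T_gt (u : ℝ) : u < h.T u := by
  have h1 := h.sol_cross (u := u) (v := u) le_rfl (zero_lt_two' ℝ) (by simp [OdeOk.sol_init])
  have := h.m.sol_strictMono h1 (s0 := 2) 0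
  rwa [h.m.sol_sol, h.m.sol_init] at this

theorem T_mono : StrictMono h.T := fun _ _ hab =>
  h.m.sol_strictMono (h.p.sol_strictMono hab 2) 0

theorem T_cont : Continuous h.T :=
  h.m.lab_cont.comp (continuous_const.prodMk
    (h.p.sol_cont_joint.comp (by fun_prop : Continuous (fun u : ℝ => ((0:ℝ), u, (2:ℝ))))))

theorem T_surj : Function.Surjective h.T := fun v => by
  refine ⟨h.p.lab 2 (h.m.sol 0 v 2), ?_⟩
  rw [T, h.p.sol_lab, h.m.lab_sol]

theorem le_two_iff {q : ℝ × ℝ} (hq : 0 ≤ q.1) :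
    q.1 ≤ 2 ↔ (h.labs q).2 ≤ h.T (h.labs q).1 := by
  have e1 := h.p.sol_lab q.1 q.2
  have e2 := h.m.sol_lab q.1 q.2
  have key : (h.labs q).2 ≤ h.T (h.labs q).1 ↔
      h.m.sol 0 (h.m.lab q.1 q.2) 2 ≤ h.p.sol 0 (h.p.lab q.1 q.2) 2 := by
    have : StrictMono (fun y => h.m.sol 2 y 0) := fun _ _ hab => h.m.sol_strictMono hab 0
    have := this.le_iff_le (a := h.m.sol 0 (h.m.lab q.1 q.2) 2)
      (b := h.p.sol 0 (h.p.lab q.1 q.2) 2)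
    simp only [OdeOk.sol_sol, OdeOk.sol_init] at this
    exact this
  rw [key]
  constructor
  · intro hle
    rcases hle.eq_or_lt with e | e
    · rw [← e, e1, e2]
    · exact (h.sol_cross hq e (by rw [e1, e2])).le
  · intro hle
    by_contra hc
    push Not at hc
    have := h.sol_cross zero_le_two hc hle
    linarith

theorem two_iff {q : ℝ × ℝ} (hq : 0 ≤ q.1) :
    q.1 = 2 ↔ (h.labs q).2 = h.T (h.labs q).1 := by
  constructor
  · intro e
    simp only [labs, T]
    rw [← e, h.p.sol_lab]
  · intro e
    have e' : (h.labs q).2 = h.m.lab 2 (h.p.sol 0 (h.labs q).1 2) := e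
    have h1 : h.inv (h.labs q) = q := h.inv_labs hq
    have h2 : h.root (h.labs q).1 (h.labs q).2 = 2 := by
      refine h.root_unique (h.labs_le hq) zero_le_two ?_
      rw [e', h.m.sol_lab]
    rw [← h1]
    exact h2

end HP

/-- Transfer map between two half planes along a relabelling `g`. -/
def HP.K {Gp Gm Gp' Gm' : ℝ → ℝ → ℝ} {k l k' l' : NNReal} (h : HP Gp Gm k l) (h' : HP Gp' Gm' k' l')
    (g : ℝ → ℝ) (q : ℝ × ℝ) : ℝ × ℝ := h'.inv (g (h.labs q).1, g (h.labs q).2)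

namespace HP
variable {Gp Gm Gp' Gm' : ℝ → ℝ → ℝ} {k l k' l' : NNReal} (h : HP Gp Gm k l) (h' : HP Gp' Gm' k' l')
  {g : ℝ → ℝ}

theorem K_nonneg (q : ℝ × ℝ) : 0 ≤ (h.K h' g q).1 := h'.inv_nonneg _

theorem K_labs (hg : Monotone g) {q : ℝ × ℝ} (hq : 0 ≤ q.1) :
    h'.labs (h.K h' g q) = (g (h.labs q).1, g (h.labs q).2) :=
  h'.labs_inv (hg (h.labs_le hq))

theorem K_K {g' : ℝ → ℝ} (hg : Monotone g) (hgg : ∀ u, g' (g u) = u) {q : ℝ × ℝ} (hq : 0 ≤ q.1) :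
    h'.K h g' (h.K h' g q) = q := by
  rw [K, h.K_labs h' hg hq]
  simp only [hgg]
  exact h.inv_labs hq

theorem K_cont (hg : Monotone g) (hgc : Continuous g) :
    ContinuousOn (h.K h' g) {q | 0 ≤ q.1} := by
  refine h'.inv_cont.comp (t := {q : ℝ × ℝ | q.1 ≤ q.2})
    (f := fun q => (g (h.labs q).1, g (h.labs q).2)) ?_ (fun q hq => hg (h.labs_le hq))
  have := h.labs_cont
  exact Continuous.continuousOn
    ((hgc.comp (continuous_fst.comp this)).prodMk (hgc.comp (continuous_snd.comp this)))

theorem K_zero (y : ℝ) : h.K h' g (0, y) = (0, g y) := by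
  have : h.labs (0, y) = (y, y) := by simp [labs, OdeOk.lab_zero]
  rw [K, this]
  exact h'.inv_diag _

theorem K_le_two (hg : StrictMono g) (hT : ∀ u, g (h.T u) = h'.T (g u)) {q : ℝ × ℝ} (hq : 0 ≤ q.1) :
    (h.K h' g q).1 ≤ 2 ↔ q.1 ≤ 2 := by
  rw [h'.le_two_iff (h.K_nonneg h' q), h.le_two_iff hq, h.K_labs h' hg.monotone hq]
  simp only [← hT, hg.le_iff_le]

theorem K_eq_two (hg : StrictMono g) (hT : ∀ u, g (h.T u) = h'.T (g u)) {q : ℝ × ℝ} (hq : 0 ≤ q.1) :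
    (h.K h' g q).1 = 2 ↔ q.1 = 2 := by
  rw [h'.two_iff (h.K_nonneg h' q), h.two_iff hq, h.K_labs h' hg.monotone hq]
  simp only [← hT, hg.injective.eq_iff]

theorem K_eq_zero (hg : StrictMono g) {q : ℝ × ℝ} (hq : 0 ≤ q.1) :
    (h.K h' g q).1 = 0 ↔ q.1 = 0 := by
  have key : ∀ {Gp Gm : ℝ → ℝ → ℝ} {k l : NNReal} (h : HP Gp Gm k l) {q : ℝ × ℝ}, 0 ≤ q.1 →
      (q.1 = 0 ↔ (h.labs q).1 = (h.labs q).2) := by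
    intro _ _ _ _ h q hq
    constructor
    · intro e
      simp [labs, e, OdeOk.lab_zero]
    · intro e
      have := h.inv_labs hq
      rw [← this, show h.labs q = ((h.labs q).1, (h.labs q).1) from Prod.ext rfl e.symm,
        h.inv_diag]
  rw [key h' (h.K_nonneg h' q), key h hq, h.K_labs h' hg.monotone hq]
  simp only [hg.injective.eq_iff]

end HP

namespace Abel
variable (T : ℝ ≃o ℝ) (hT : ∀ u, u < T u)
include hT

theorem zpow_mono : StrictMono (fun n : ℤ => (T ^ n) 0) := by
  refine strictMono_int_of_lt_succ fun n => ?_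
  have : (T ^ (n + 1)) 0 = T ((T ^ n) 0) := by
    rw [add_comm, zpow_add, zpow_one]; rfl
  simp only [this]
  exact hT _

theorem ex_gt (a : ℝ) : ∃ n : ℤ, a < (T ^ n) 0 := by
  by_contra hc
  push Not at hc
  set S := range (fun n : ℤ => (T ^ n) 0)
  have hb : BddAbove S := ⟨a, by rintro _ ⟨n, rfl⟩; exact hc n⟩
  have h1 : T.symm (sSup S) < sSup S := by
    have := hT (T.symm (sSup S)); rwa [T.apply_symm_apply] at this
  obtain ⟨_, ⟨n, rfl⟩, hn⟩ := exists_lt_of_lt_csSup (range_nonempty _) h1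
  have h2 : sSup S < T ((T ^ n) 0) := by
    have := T.strictMono hn; rwa [T.apply_symm_apply] at this
  have h3 : T ((T ^ n) 0) ≤ sSup S := le_csSup hb ⟨n + 1, by
    simp only []; rw [add_comm, zpow_add, zpow_one]; rfl⟩
  linarith

theorem ex_le (a : ℝ) : ∃ n : ℤ, (T ^ n) 0 ≤ a := by
  by_contra hc
  push Not at hc
  set S := range (fun n : ℤ => (T ^ n) 0)
  have hb : BddBelow S := ⟨a, by rintro _ ⟨n, rfl⟩; exact (hc n).le⟩
  obtain ⟨_, ⟨n, rfl⟩, hn⟩ := exists_lt_of_csInf_lt (range_nonempty _) (hT (sInf S))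
  have h2 : T.symm ((T ^ n) 0) < sInf S := by
    have := T.symm.strictMono hn; rwa [T.symm_apply_apply] at this
  have h3 : sInf S ≤ T.symm ((T ^ n) 0) := csInf_le hb ⟨-1 + n, by
    simp only []; rw [zpow_add, zpow_neg_one]; rfl⟩
  linarith

theorem ex_n (a : ℝ) : ∃ n : ℤ, (T ^ n) 0 ≤ a ∧ a < (T ^ (n + 1)) 0 := by
  obtain ⟨m, hm⟩ := ex_gt T hT a
  obtain ⟨n, hn, hn2⟩ := Int.exists_greatest_of_bdd (P := fun n => (T ^ n) 0 ≤ a)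
    ⟨m, fun z hz => by
      by_contra hc
      push Not at hc
      have := zpow_mono T hT hc
      simp only [] at this
      linarith⟩ (ex_le T hT a)
  refine ⟨n, hn, ?_⟩
  by_contra hc
  push Not at hc
  have := hn2 _ hc
  omega

theorem n_unique {a : ℝ} {n m : ℤ} (h1 : (T ^ n) 0 ≤ a ∧ a < (T ^ (n + 1)) 0)
    (h2 : (T ^ m) 0 ≤ a ∧ a < (T ^ (m + 1)) 0) : n = m := by
  have a1 := (zpow_mono T hT).lt_iff_lt.1 (show (T ^ n) 0 < (T ^ (m + 1)) 0 by linarith)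
  have a2 := (zpow_mono T hT).lt_iff_lt.1 (show (T ^ m) 0 < (T ^ (n + 1)) 0 by linarith)
  omega

def nn (a : ℝ) : ℤ := (ex_n T hT a).choose
theorem nn_spec (a : ℝ) : (T ^ nn T hT a) 0 ≤ a ∧ a < (T ^ (nn T hT a + 1)) 0 :=
  (ex_n T hT a).choose_spec

/-- Abel function. -/
def psi (a : ℝ) : ℝ := nn T hT a + (T ^ (- nn T hT a)) a / T 0

theorem frac_mem {a : ℝ} {n : ℤ} (h : (T ^ n) 0 ≤ a ∧ a < (T ^ (n + 1)) 0) :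
    0 ≤ (T ^ (-n)) a / T 0 ∧ (T ^ (-n)) a / T 0 < 1 := by
  have h0 := hT 0
  have a1 := (T ^ (-n)).monotone h.1
  have a2 := (T ^ (-n)).strictMono h.2
  rw [← RelIso.mul_apply, ← zpow_add, neg_add_cancel, zpow_zero] at a1
  rw [← RelIso.mul_apply, ← zpow_add, neg_add_cancel_left, zpow_one] at a2
  exact ⟨div_nonneg a1 h0.le, (div_lt_one h0).2 a2⟩

theorem psi_mono : StrictMono (psi T hT) := by
  intro a b hab
  have sa := nn_spec T hT a
  have sb := nn_spec T hT b
  have fa := frac_mem T hT sa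
  have fb := frac_mem T hT sb
  have h1 := (zpow_mono T hT).lt_iff_lt.1 (show (T ^ nn T hT a) 0 < (T ^ (nn T hT b + 1)) 0 by linarith)
  rcases (Int.lt_add_one_iff.1 h1).eq_or_lt with e | e
  · unfold psi
    rw [e]
    have : (T ^ (- nn T hT b)) a / T 0 < (T ^ (- nn T hT b)) b / T 0 :=
      div_lt_div_of_pos_right ((T ^ (- nn T hT b)).strictMono hab) (hT 0)
    linarith
  · have : (nn T hT a : ℝ) + 1 ≤ nn T hT b := by exact_mod_cast e
    unfold psi
    linarith

theorem psi_surj : Function.Surjective (psi T hT) := by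
  intro r
  set n := ⌊r⌋
  set a := (T ^ n) (Int.fract r * T 0) with ha
  have h0 := hT 0
  have hn : (T ^ n) 0 ≤ a ∧ a < (T ^ (n + 1)) 0 := by
    refine ⟨(T ^ n).monotone (mul_nonneg (Int.fract_nonneg r) h0.le), ?_⟩
    rw [zpow_add, zpow_one]
    refine (T ^ n).strictMono ?_
    have := Int.fract_lt_one r
    show Int.fract r * T 0 < T 0
    nlinarith
  refine ⟨a, ?_⟩
  have e := n_unique T hT (nn_spec T hT a) hn
  unfold psi
  rw [e, ha, ← RelIso.mul_apply, ← zpow_add, neg_add_cancel, zpow_zero]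
  show (n : ℝ) + Int.fract r * T 0 / T 0 = r
  rw [mul_div_cancel_right₀ _ h0.ne']
  exact Int.floor_add_fract r

theorem psi_T (a : ℝ) : psi T hT (T a) = psi T hT a + 1 := by
  have sa := nn_spec T hT a
  have e : nn T hT (T a) = nn T hT a + 1 := by
    refine n_unique T hT (nn_spec T hT (T a)) ⟨?_, ?_⟩
    · have := T.monotone sa.1
      rw [add_comm, zpow_add, zpow_one]; exact this
    · have := T.strictMono sa.2
      rw [add_comm, zpow_add, zpow_one]; exact this
  unfold psi
  rw [e, neg_add, zpow_add, zpow_neg_one]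
  have : (T ^ (-nn T hT a) * T⁻¹) (T a) = (T ^ (-nn T hT a)) a := by
    rw [RelIso.mul_apply]
    congr 1
    exact T.symm_apply_apply a
  rw [this]
  push_cast
  ring

end Abel

/-- A conjugacy between the return maps. -/
theorem HP.exists_conj {Gp Gm Gp' Gm' : ℝ → ℝ → ℝ} {k l k' l' : NNReal} (h : HP Gp Gm k l)
    (h' : HP Gp' Gm' k' l') : ∃ g : ℝ ≃o ℝ, ∀ u, g (h.T u) = h'.T (g u) := by
  set T := h.T_mono.orderIsoOfSurjective _ h.T_surj with hTd
  set T' := h'.T_mono.orderIsoOfSurjective _ h'.T_surj with hTd'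
  have hT : ∀ u, u < T u := h.T_gt
  have hT' : ∀ u, u < T' u := h'.T_gt
  set P := (Abel.psi_mono T hT).orderIsoOfSurjective _ (Abel.psi_surj T hT) with hP
  set P' := (Abel.psi_mono T' hT').orderIsoOfSurjective _ (Abel.psi_surj T' hT') with hP'
  refine ⟨P.trans P'.symm, fun u => ?_⟩
  show P'.symm (P (T u)) = T' (P'.symm (P u))
  rw [OrderIso.symm_apply_eq]
  have e1 : P (T u) = P u + 1 := Abel.psi_T T hT u
  have e2 : P' (T' (P'.symm (P u))) = P' (P'.symm (P u)) + 1 := Abel.psi_T T' hT' _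
  rw [e1, e2, P'.apply_symm_apply]

theorem TopEquivAt0.symm {ω Ω : (ℝ × ℝ) → (ℝ × ℝ) → ℝ} (h : TopEquivAt0 ω Ω) : TopEquivAt0 Ω ω := by
  obtain ⟨U, V, h, k, hU, hV, h0, h0', hh, ch, ck, hb, hi, c1, c2⟩ := h
  refine ⟨V, U, k, h, hV, hU, h0', h0, ?_, ck, ch, ?_, hi.symm, c2, c1⟩
  · have := hi.1 h0
    rwa [hh] at this
  · exact hb.symm hi.symm

theorem TopEquivAt0.trans {ω₁ ω₂ ω₃ : (ℝ × ℝ) → (ℝ × ℝ) → ℝ} (h : TopEquivAt0 ω₁ ω₂)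
    (h' : TopEquivAt0 ω₂ ω₃) : TopEquivAt0 ω₁ ω₃ := by
  obtain ⟨U, V, h, k, hU, hV, h0, h0', hh, ch, ck, hb, hi, c1, c2⟩ := h
  obtain ⟨U', V', h', k', hU', hV', h0₁, h0₁', hh', ch', ck', hb', hi', c1', c2'⟩ := h'
  have hk : k 0 = 0 := by have := hi.1 h0; rwa [hh] at this
  have hk' : k' 0 = 0 := by have := hi'.1 h0₁; rwa [hh'] at this
  have hkm : MapsTo k V U := (hb.symm hi.symm).mapsTo
  have hkm' : MapsTo k' V' U' := (hb'.symm hi'.symm).mapsTo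
  refine ⟨U ∩ h ⁻¹' U', V' ∩ k' ⁻¹' V, h' ∘ h, k ∘ k', ch.isOpen_inter_preimage hU hU',
    ck'.isOpen_inter_preimage hV' hV, ⟨h0, by simpa [hh] using h0₁⟩, ⟨h0₁', by simpa [hk'] using h0'⟩,
    by simp [hh, hh'], ?_, ?_, ?_, ?_, ?_, ?_⟩
  · exact ch'.comp (ch.mono inter_subset_left) fun x hx => hx.2
  · exact ck.comp (ck'.mono inter_subset_left) fun x hx => hx.2
  · have inv : InvOn (k ∘ k') (h' ∘ h) (U ∩ h ⁻¹' U') (V' ∩ k' ⁻¹' V) := by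
      refine ⟨fun x hx => ?_, fun x hx => ?_⟩
      · simp only [Function.comp]; rw [hi'.1 hx.2, hi.1 hx.1]
      · simp only [Function.comp]; rw [hi.2 hx.2, hi'.2 hx.1]
    refine inv.bijOn ?_ ?_
    · intro x hx
      refine ⟨hb'.mapsTo hx.2, ?_⟩
      show k' (h' (h x)) ∈ V
      rw [hi'.1 hx.2]
      exact hb.mapsTo hx.1
    · intro x hx
      refine ⟨hkm hx.2, ?_⟩
      show h (k (k' x)) ∈ U'
      rw [hi.2 hx.2]
      exact hkm' hx.1
  · refine ⟨fun x hx => ?_, fun x hx => ?_⟩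
    · simp only [Function.comp]; rw [hi'.1 hx.2, hi.1 hx.1]
    · simp only [Function.comp]; rw [hi.2 hx.2, hi'.2 hx.1]
  · intro γ I hγ hm
    obtain ⟨σ, J, hσ, e⟩ := c1 γ I hγ fun t ht => (hm ht).1
    obtain ⟨σ', J', hσ', e'⟩ := c1' σ J hσ (by
      intro t ht
      have : σ t ∈ h '' (γ '' I) := by rw [e]; exact mem_image_of_mem _ ht
      obtain ⟨_, ⟨s, hs, rfl⟩, hst⟩ := this
      rw [← hst]
      exact (hm hs).2)
    exact ⟨σ', J', hσ', by rw [image_comp, e, e']⟩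
  · intro γ I hγ hm
    obtain ⟨σ, J, hσ, e⟩ := c2' γ I hγ fun t ht => (hm ht).1
    obtain ⟨σ', J', hσ', e'⟩ := c2 σ J hσ (by
      intro t ht
      have : σ t ∈ k' '' (γ '' I) := by rw [e]; exact mem_image_of_mem _ ht
      obtain ⟨_, ⟨s, hs, rfl⟩, hst⟩ := this
      rw [← hst]
      exact (hm hs).2)
    exact ⟨σ', J', hσ', by rw [image_comp, e, e']⟩

theorem topEquiv_of_global {ω Ω : (ℝ × ℝ) → (ℝ × ℝ) → ℝ} {h k : ℝ × ℝ → ℝ × ℝ} {B1 B2 : Set (ℝ × ℝ)}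
    (hB1 : IsOpen B1) (hB2 : IsOpen B2) (h1 : (0 : ℝ × ℝ) ∈ B1) (h2 : (0 : ℝ × ℝ) ∈ B2)
    (hc : Continuous h) (kc : Continuous k) (hk : ∀ x, h (k x) = x) (kh : ∀ x, k (h x) = x)
    (h0 : h 0 = 0)
    (c1 : ∀ γ I, IsIntegralCurveOnBDE ω γ I → MapsTo γ I B1 → MapsTo (fun t => h (γ t)) I B2 →
      ∃ σ J, IsIntegralCurveOnBDE Ω σ J ∧ (fun t => h (γ t)) '' I = σ '' J)
    (c2 : ∀ γ I, IsIntegralCurveOnBDE Ω γ I → MapsTo γ I B2 → MapsTo (fun t => k (γ t)) I B1 →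
      ∃ σ J, IsIntegralCurveOnBDE ω σ J ∧ (fun t => k (γ t)) '' I = σ '' J) : TopEquivAt0 ω Ω := by
  have k0 : k 0 = 0 := by have := kh 0; rwa [h0] at this
  have inv : InvOn k h (B1 ∩ h ⁻¹' B2) (B2 ∩ k ⁻¹' B1) := ⟨fun x _ => kh x, fun x _ => hk x⟩
  refine ⟨B1 ∩ h ⁻¹' B2, B2 ∩ k ⁻¹' B1, h, k, hB1.inter (hB2.preimage hc), hB2.inter (hB1.preimage kc),
    ⟨h1, by simpa [h0] using h2⟩, ⟨h2, by simpa [k0] using h1⟩, h0, hc.continuousOn, kc.continuousOn,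
    inv.bijOn ?_ ?_, inv, ?_, ?_⟩
  · intro x hx
    exact ⟨hx.2, by simpa [kh] using hx.1⟩
  · intro x hx
    exact ⟨hx.2, by simpa [hk] using hx.1⟩
  · intro γ I hγ hm
    obtain ⟨σ, J, a, b⟩ := c1 γ I hγ (fun t ht => (hm ht).1) (fun t ht => (hm ht).2)
    exact ⟨σ, J, a, by rw [← b, image_image]⟩
  · intro γ I hγ hm
    obtain ⟨σ, J, a, b⟩ := c2 γ I hγ (fun t ht => (hm ht).1) (fun t ht => (hm ht).2)
    exact ⟨σ, J, a, by rw [← b, image_image]⟩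

theorem topEquiv_of_diffeo {ω Ω : (ℝ × ℝ) → (ℝ × ℝ) → ℝ} {h k : ℝ × ℝ → ℝ × ℝ} {U V : Set (ℝ × ℝ)}
    (hU : IsOpen U) (hV : IsOpen V) (h1 : (0 : ℝ × ℝ) ∈ U)
    (hc : ContDiffOn ℝ 1 h U) (kc : ContDiffOn ℝ 1 k V) (hm : MapsTo h U V) (km : MapsTo k V U)
    (hk : ∀ x ∈ V, h (k x) = x) (kh : ∀ x ∈ U, k (h x) = x) (h0 : h 0 = 0)
    (hz : ∀ p ∈ U, ∀ v, Ω (h p) (fderiv ℝ h p v) = 0 ↔ ω p v = 0) : TopEquivAt0 ω Ω := by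
  have dh : ∀ p ∈ U, HasFDerivAt h (fderiv ℝ h p) p := fun p hp =>
    ((hc.differentiableOn one_ne_zero).differentiableAt (hU.mem_nhds hp)).hasFDerivAt
  have dk : ∀ p ∈ V, HasFDerivAt k (fderiv ℝ k p) p := fun p hp =>
    ((kc.differentiableOn one_ne_zero).differentiableAt (hV.mem_nhds hp)).hasFDerivAt
  have hcomp : ∀ p ∈ V, ∀ v, fderiv ℝ h (k p) (fderiv ℝ k p v) = v := by
    intro p hp v
    have a := (dh (k p) (km hp)).comp p (dk p hp)
    have b : HasFDerivAt (h ∘ k) (ContinuousLinearMap.id ℝ (ℝ × ℝ)) p :=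
      (hasFDerivAt_id p).congr_of_eventuallyEq (by
        filter_upwards [hV.mem_nhds hp] with x hx using hk x hx)
    exact congrArg (fun L => L v) (a.unique b)
  have kcomp : ∀ p ∈ U, ∀ v, fderiv ℝ k (h p) (fderiv ℝ h p v) = v := by
    intro p hp v
    have a := (dk (h p) (hm hp)).comp p (dh p hp)
    have b : HasFDerivAt (k ∘ h) (ContinuousLinearMap.id ℝ (ℝ × ℝ)) p :=
      (hasFDerivAt_id p).congr_of_eventuallyEq (by
        filter_upwards [hU.mem_nhds hp] with x hx using kh x hx)
    exact congrArg (fun L => L v) (a.unique b)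
  have inv : InvOn k h U V := ⟨fun x hx => kh x hx, fun x hx => hk x hx⟩
  refine ⟨U, V, h, k, hU, hV, h1, by simpa [h0] using hm h1, h0, hc.continuousOn, kc.continuousOn,
    inv.bijOn hm km, inv, ?_, ?_⟩
  · rintro γ I ⟨hI, dγ, cd, hd⟩ hmI
    have cγ : ContinuousOn γ I := fun t ht => (hd t ht).1.continuousAt.continuousWithinAt
    refine ⟨h ∘ γ, I, ⟨hI, fun t => fderiv ℝ h (γ t) (dγ t), ?_, fun t ht => ⟨?_, ?_, ?_⟩⟩, ?_⟩
    · exact ((hc.continuousOn_fderiv_of_isOpen hU le_rfl).comp cγ hmI).clm_apply cd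
    · exact (dh (γ t) (hmI ht)).comp_hasDerivAt t (hd t ht).1
    · intro e
      have := kcomp (γ t) (hmI ht) (dγ t)
      simp only at e
      rw [e, map_zero] at this
      exact (hd t ht).2.1 this.symm
    · exact (hz _ (hmI ht) _).2 (hd t ht).2.2
    · rw [image_comp]
  · rintro γ I ⟨hI, dγ, cd, hd⟩ hmI
    have cγ : ContinuousOn γ I := fun t ht => (hd t ht).1.continuousAt.continuousWithinAt
    refine ⟨k ∘ γ, I, ⟨hI, fun t => fderiv ℝ k (γ t) (dγ t), ?_, fun t ht => ⟨?_, ?_, ?_⟩⟩, ?_⟩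
    · exact ((kc.continuousOn_fderiv_of_isOpen hV le_rfl).comp cγ hmI).clm_apply cd
    · exact (dk (γ t) (hmI ht)).comp_hasDerivAt t (hd t ht).1
    · intro e
      have := hcomp (γ t) (hmI ht) (dγ t)
      simp only at e
      rw [e, map_zero] at this
      exact (hd t ht).2.1 this.symm
    · simp only [Function.comp]
      rw [← hz _ (km (hmI ht)), hcomp _ (hmI ht), hk _ (hmI ht)]
      exact (hd t ht).2.2
    · rw [image_comp]

theorem image_Ioo_of_inj {f : ℝ → ℝ} {a b B : ℝ} (hc : ContinuousOn f (Ioo a b))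
    (hi : InjOn f (Ioo a b)) (hB : ∀ t ∈ Ioo a b, |f t| ≤ B) :
    ∃ c d, f '' Ioo a b = Ioo c d := by
  rcases le_or_gt b a with hab | hab
  · exact ⟨0, 0, by simp [Ioo_eq_empty (not_lt.2 hab)]⟩
  set s := f '' Ioo a b with hs
  have hba : BddAbove s := ⟨B, by rintro _ ⟨t, ht, rfl⟩; exact (abs_le.1 (hB t ht)).2⟩
  have hbb : BddBelow s := ⟨-B, by rintro _ ⟨t, ht, rfl⟩; exact (abs_le.1 (hB t ht)).1⟩
  have hconn : IsConnected s := (isConnected_Ioo hab).image f hc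
  refine ⟨sInf s, sSup s, Subset.antisymm ?_ (hconn.Ioo_csInf_csSup_subset hbb hba)⟩
  rintro _ ⟨t, ht, rfl⟩
  have key : (∃ t1 ∈ Ioo a b, f t1 < f t) ∧ ∃ t2 ∈ Ioo a b, f t < f t2 := by
    have m1 : (a + t) / 2 ∈ Ioo a b := ⟨by linarith [ht.1], by linarith [ht.1, ht.2]⟩
    have m2 : (t + b) / 2 ∈ Ioo a b := ⟨by linarith [ht.1, ht.2], by linarith [ht.2]⟩
    have l1 : (a + t) / 2 < t := by linarith [ht.1]
    have l2 : t < (t + b) / 2 := by linarith [ht.2]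
    rcases ContinuousOn.strictMonoOn_of_injOn_Ioo hab hc hi with h | h
    · exact ⟨⟨_, m1, h m1 ht l1⟩, _, m2, h ht m2 l2⟩
    · exact ⟨⟨_, m2, h ht m2 l2⟩, _, m1, h m1 ht l1⟩
  obtain ⟨⟨t1, h1, h1'⟩, t2, h2, h2'⟩ := key
  exact ⟨(csInf_le hbb (mem_image_of_mem f h1)).trans_lt h1',
    h2'.trans_le (le_csSup hba (mem_image_of_mem f h2))⟩

/-- Data of a normalised equation. -/
structure Dat where
  μ : ℝ × ℝ → ℝ
  n : ℝ × ℝ → ℝ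
  r : ℝ
  K : ℝ
  M : ℝ
  r_pos : 0 < r
  r_le : r ≤ 1
  K_nonneg : 0 ≤ K
  μ_lip : ∀ p q, |μ p - μ q| ≤ K * (|p.1 - q.1| + |p.2 - q.2|)
  n_lip : ∀ p q, |n p - n q| ≤ K * (|p.1 - q.1| + |p.2 - q.2|)
  μ_zero : μ 0 = 0
  μ_le : ∀ p, |μ p| ≤ 1 / 20
  n_pos : ∀ p, 0 < n p
  n_le : ∀ p, n p ≤ M
  Mr : M * r ≤ 1 / 40

theorem lip_cont {f : ℝ × ℝ → ℝ} {K : ℝ}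
    (h : ∀ p q, |f p - f q| ≤ K * (|p.1 - q.1| + |p.2 - q.2|)) : Continuous f := by
  refine continuous_iff_continuousAt.2 fun p => ?_
  rw [ContinuousAt, tendsto_iff_dist_tendsto_zero]
  refine squeeze_zero (fun _ => dist_nonneg) (fun q => h q p) ?_
  have : Continuous (fun q : ℝ × ℝ => K * (|q.1 - p.1| + |q.2 - p.2|)) := by fun_prop
  simpa using this.tendsto p

namespace Dat
variable (D : Dat)

theorem μ_cont : Continuous D.μ := lip_cont D.μ_lip
theorem n_cont : Continuous D.n := lip_cont D.n_lip
theorem M_pos : 0 < D.M := (D.n_pos 0).trans_le (D.n_le 0)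

/-- The box where the equation is in normal form. -/
def box : Set (ℝ × ℝ) := {p | |p.1| < D.r ∧ |p.2| < D.r}

theorem box_open : IsOpen D.box :=
  (isOpen_lt (continuous_fst.abs) continuous_const).inter
    (isOpen_lt (continuous_snd.abs) continuous_const)

theorem box_zero : (0 : ℝ × ℝ) ∈ D.box := by simp [box, D.r_pos]

/-- `ω` has normal form `D` on the box. -/
def Rep (σ : ℝ) (ω : (ℝ × ℝ) → (ℝ × ℝ) → ℝ) : Prop := ∀ p ∈ D.box, ∀ v,
  ω p v = 0 ↔ (v.2 - D.μ p * v.1) ^ 2 = D.n p ^ 2 * (σ * (p.2 ^ 3 - p.1 ^ 2)) * v.1 ^ 2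

end Dat

/-- Unpacked integral curve in the box. -/
structure Crv (D : Dat) (σ : ℝ) (x w dx dw : ℝ → ℝ) (I : Set ℝ) : Prop where
  o : IsOpen I
  oc : I.OrdConnected
  hx : ∀ t ∈ I, HasDerivAt x (dx t) t
  hw : ∀ t ∈ I, HasDerivAt w (dw t) t
  cx : ContinuousOn dx I
  cw : ContinuousOn dw I
  box : ∀ t ∈ I, (x t, w t) ∈ D.box
  ne : ∀ t ∈ I, dx t ≠ 0
  eq : ∀ t ∈ I, (dw t - D.μ (x t, w t) * dx t) ^ 2 =
    D.n (x t, w t) ^ 2 * (σ * (w t ^ 3 - x t ^ 2)) * dx t ^ 2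

theorem Dat.Rep.crv {D : Dat} {σ : ℝ} {ω : (ℝ × ℝ) → (ℝ × ℝ) → ℝ} (h : D.Rep σ ω) {γ : ℝ → ℝ × ℝ}
    {I : Set ℝ} (hγ : IsIntegralCurveOnBDE ω γ I) (hm : MapsTo γ I D.box) :
    ∃ dx dw, Crv D σ (fun t => (γ t).1) (fun t => (γ t).2) dx dw I := by
  obtain ⟨⟨a, b, rfl⟩, dγ, hc, hd⟩ := hγ
  have he : ∀ t ∈ Ioo a b, ((dγ t).2 - D.μ (γ t) * (dγ t).1) ^ 2 =
      D.n (γ t) ^ 2 * (σ * ((γ t).2 ^ 3 - (γ t).1 ^ 2)) * (dγ t).1 ^ 2 := fun t ht =>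
    (h _ (hm ht) _).1 (hd t ht).2.2
  refine ⟨fun t => (dγ t).1, fun t => (dγ t).2, isOpen_Ioo, ordConnected_Ioo,
    fun t ht => (hd t ht).1.fst, fun t ht => (hd t ht).1.snd,
    continuous_fst.comp_continuousOn hc, continuous_snd.comp_continuousOn hc, fun t ht => hm ht,
    fun t ht e => ?_, he⟩
  have := he t ht
  rw [e] at this
  simp at this
  exact (hd t ht).2.1 (Prod.ext e this)

theorem Dat.Rep.curve {D : Dat} {σ : ℝ} {ω : (ℝ × ℝ) → (ℝ × ℝ) → ℝ} (h : D.Rep σ ω)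
    {x w dx dw : ℝ → ℝ} {a b : ℝ} (hc : Crv D σ x w dx dw (Ioo a b)) :
    IsIntegralCurveOnBDE ω (fun t => (x t, w t)) (Ioo a b) := by
  refine ⟨⟨a, b, rfl⟩, fun t => (dx t, dw t), hc.cx.prodMk hc.cw, fun t ht =>
    ⟨(hc.hx t ht).prodMk (hc.hw t ht), fun e => hc.ne t ht (congrArg Prod.fst e), ?_⟩⟩
  exact (h _ (hc.box t ht) _).2 (hc.eq t ht)

namespace Crv
variable {D : Dat} {σ : ℝ} {x w dx dw : ℝ → ℝ} {I : Set ℝ} (h : Crv D σ x w dx dw I)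
include h

theorem sub {J : Set ℝ} (hJ : IsOpen J) (hJc : J.OrdConnected) (hs : J ⊆ I) :
    Crv D σ x w dx dw J :=
  ⟨hJ, hJc, fun t ht => h.hx t (hs ht), fun t ht => h.hw t (hs ht), h.cx.mono hs, h.cw.mono hs,
    fun t ht => h.box t (hs ht), fun t ht => h.ne t (hs ht), fun t ht => h.eq t (hs ht)⟩

theorem nonneg {t : ℝ} (ht : t ∈ I) : 0 ≤ σ * (w t ^ 3 - x t ^ 2) := by
  by_contra hc
  push Not at hc
  have h1 : 0 < D.n (x t, w t) ^ 2 * dx t ^ 2 := by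
    have := D.n_pos (x t, w t)
    have := h.ne t ht
    positivity
  have := h.eq t ht
  nlinarith [sq_nonneg (dw t - D.μ (x t, w t) * dx t)]

theorem xcont : ContinuousOn x I := fun t ht => (h.hx t ht).continuousAt.continuousWithinAt
theorem wcont : ContinuousOn w I := fun t ht => (h.hw t ht).continuousAt.continuousWithinAt

theorem inj : InjOn x I := by
  intro a ha b hb hab
  by_contra hne
  wlog hlt : a < b generalizing a b
  · exact this hb ha hab.symm (Ne.symm hne) (lt_of_le_of_ne (not_lt.1 hlt) (Ne.symm hne))
  have hs := h.oc.out ha hb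
  obtain ⟨c, hc, hc'⟩ := exists_hasDerivAt_eq_zero hlt (h.xcont.mono hs) hab
    fun t ht => h.hx t (hs (Ioo_subset_Icc_self ht))
  exact h.ne c (hs (Ioo_subset_Icc_self hc)) hc'

theorem dw_of_zero {t : ℝ} (ht : t ∈ I) (h0 : w t ^ 3 - x t ^ 2 = 0) :
    dw t = D.μ (x t, w t) * dx t := by
  have := h.eq t ht
  rw [h0] at this
  have := pow_eq_zero_iff (two_ne_zero) |>.1 (this.trans (by ring))
  linarith

theorem zero_of_discr (hσ : σ = 1 ∨ σ = -1) {t : ℝ} (ht : t ∈ I) (h0 : w t ^ 3 - x t ^ 2 = 0) :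
    x t = 0 ∧ w t = 0 := by
  have hmin : IsLocalMin (fun t => σ * (w t ^ 3 - x t ^ 2)) t := by
    filter_upwards [h.o.mem_nhds ht] with s hs
    rw [h0, mul_zero]
    exact h.nonneg hs
  have hd : HasDerivAt (fun t => σ * (w t ^ 3 - x t ^ 2))
      (σ * (3 * w t ^ 2 * dw t - 2 * x t * dx t)) t := by
    have := (((h.hw t ht).pow 3).sub ((h.hx t ht).pow 2)).const_mul σ
    refine this.congr_deriv ?_
    norm_num
  have hz := hmin.hasDerivAt_eq_zero hd
  have hz2 : 3 * w t ^ 2 * dw t - 2 * x t * dx t = 0 := by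
    rcases hσ with e | e <;> rw [e] at hz <;> linarith
  rw [h.dw_of_zero ht h0] at hz2
  have hz3 : 3 * w t ^ 2 * D.μ (x t, w t) - 2 * x t = 0 := by
    have : (3 * w t ^ 2 * D.μ (x t, w t) - 2 * x t) * dx t = 0 := by linarith
    exact (mul_eq_zero.1 this).resolve_right (h.ne t ht)
  have hw1 : |w t| ≤ 1 := (h.box t ht).2.le.trans D.r_le
  have hμ := abs_le.1 (D.μ_le (x t, w t))
  have hw2 := abs_le.1 hw1
  set m := D.μ (x t, w t)
  have hw0 : 0 ≤ w t := by
    by_contra hc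
    push Not at hc
    nlinarith [sq_nonneg (x t), pow_pos (neg_pos.2 hc) 3]
  have e1 : x t = 3 / 2 * w t ^ 2 * m := by linarith
  have hm2 : m ^ 2 ≤ 1 / 400 := by nlinarith
  have : w t ^ 3 * (1 - 9 / 4 * w t * m ^ 2) = 0 := by
    rw [e1] at h0; nlinarith
  have hpos : 0 < 1 - 9 / 4 * w t * m ^ 2 := by nlinarith [sq_nonneg m]
  have hw3 : w t = 0 := by
    have := (mul_eq_zero.1 this).resolve_right hpos.ne'
    exact pow_eq_zero_iff (three_ne_zero) |>.1 this
  exact ⟨by rw [e1, hw3]; ring, hw3⟩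

theorem pos_of_one (hσ : σ = 1) {t : ℝ} (ht : t ∈ I) : 0 < w t ^ 3 - x t ^ 2 := by
  subst hσ
  have hn := h.nonneg ht
  rw [one_mul] at hn
  rcases hn.eq_or_lt with e | e
  swap
  · exact e
  exfalso
  obtain ⟨x0, w0⟩ := h.zero_of_discr (Or.inl rfl) ht e.symm
  have hdw : dw t = 0 := by
    rw [h.dw_of_zero ht e.symm, x0, w0]
    have := D.μ_zero
    rw [show ((0:ℝ), (0:ℝ)) = 0 from rfl, this, zero_mul]
  have ho := (hasDerivAt_iff_isLittleO.1 (h.hx t ht)).def (c := |dx t| / 2)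
    (by have := abs_pos.2 (h.ne t ht); positivity)
  have ho2 := (hasDerivAt_iff_isLittleO.1 (h.hw t ht)).def (c := 1) one_pos
  have hclose : ∀ᶠ s in nhds t, |s - t| < dx t ^ 2 / 4 := by
    have : Continuous fun s : ℝ => |s - t| := by fun_prop
    exact this.continuousAt.eventually_lt continuousAt_const (by
      have := h.ne t ht
      simp
      positivity)
  obtain ⟨s, hst, hs⟩ := ((frequently_gt_nhds t).and_eventually
    (((ho.and ho2).and hclose).and (h.o.mem_nhds ht))).exists
  obtain ⟨⟨⟨h1, h2⟩, h3⟩, hsI⟩ := hs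
  simp only [x0, w0, hdw, smul_eq_mul, mul_zero, sub_zero, Real.norm_eq_abs, one_mul] at h1 h2
  have hp : 0 < s - t := by linarith
  rw [abs_of_pos hp] at h1 h2 h3
  have h4 := h.nonneg hsI
  set τ := s - t
  have h5 : |dx t| / 2 * τ ≤ |x s| := by
    have := abs_sub_abs_le_abs_sub (τ * dx t) (x s)
    rw [abs_sub_comm, abs_mul, abs_of_pos hp] at this
    linarith
  have h6 : (|dx t| / 2 * τ) ^ 2 ≤ x s ^ 2 := by
    rw [← sq_abs (x s)]
    exact pow_le_pow_left₀ (by positivity) h5 2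
  have h7 : w s ^ 3 ≤ τ ^ 3 := by
    have := le_abs_self (w s)
    exact (Odd.pow_le_pow (by decide)).2 (by linarith)
  rw [mul_pow, div_pow, sq_abs] at h6
  have : τ ^ 3 < dx t ^ 2 / 2 ^ 2 * τ ^ 2 := by
    have : τ * τ ^ 2 < dx t ^ 2 / 4 * τ ^ 2 := mul_lt_mul_of_pos_right h3 (by positivity)
    linarith
  linarith

theorem exists_sign (hpos : ∀ t ∈ I, 0 < σ * (w t ^ 3 - x t ^ 2)) : ∃ a : ℝ, (a = 1 ∨ a = -1) ∧
    ∀ t ∈ I, dw t = (D.μ (x t, w t) +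
      a * (D.n (x t, w t) * √(σ * (w t ^ 3 - x t ^ 2)))) * dx t := by
  have cxw : ContinuousOn (fun t => (x t, w t)) I := h.xcont.prodMk h.wcont
  have cμ := D.μ_cont.comp_continuousOn cxw
  have cn := D.n_cont.comp_continuousOn cxw
  have hc := h.xcont
  have hc2 := h.wcont
  have h1 : ContinuousOn (fun t => dw t - D.μ (x t, w t) * dx t) I := h.cw.sub (cμ.mul h.cx)
  have h2 : ContinuousOn (fun t => D.n (x t, w t) * √(σ * (w t ^ 3 - x t ^ 2)) * dx t) I :=
    (cn.mul (Real.continuous_sqrt.comp_continuousOn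
      (continuousOn_const.mul ((hc2.pow 3).sub (hc.pow 2))))).mul h.cx
  have := IsPreconnected.eq_or_eq_neg_of_sq_eq h.oc.isPreconnected h1 h2 (fun t ht => by
    simp only [Pi.pow_apply]
    rw [mul_pow, mul_pow, Real.sq_sqrt (h.nonneg ht)]
    exact h.eq t ht) (fun {t} ht => by
      have a := D.n_pos (x t, w t)
      have b := Real.sqrt_pos.2 (hpos t ht)
      have c := h.ne t ht
      positivity)
  rcases this with e | e
  · refine ⟨1, Or.inl rfl, fun t ht => ?_⟩
    have := e ht
    simp only at this
    linarith
  · refine ⟨-1, Or.inr rfl, fun t ht => ?_⟩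
    have := e ht
    simp only [Pi.neg_apply] at this
    linarith

end Crv

/-- `√(s² + m³)` with `m` the positive part. -/
def phi (s y : ℝ) : ℝ := √(s ^ 2 + (max y 0) ^ 3)

theorem phi_sq (s y : ℝ) : phi s y ^ 2 = s ^ 2 + (max y 0) ^ 3 :=
  Real.sq_sqrt (by have : 0 ≤ max y 0 := le_max_right _ _; positivity)
theorem phi_nonneg (s y : ℝ) : 0 ≤ phi s y := Real.sqrt_nonneg _
theorem phi_cont : Continuous fun q : ℝ × ℝ => phi q.1 q.2 := by unfold phi; fun_prop
theorem phi_of_nonpos {s y : ℝ} (hs : 0 ≤ s) (hy : y ≤ 0) : phi s y = s := by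
  rw [phi, max_eq_right hy]; simp [Real.sqrt_sq hs]
theorem le_phi {s : ℝ} (y : ℝ) : s ≤ phi s y := by
  have := phi_sq s y
  have : 0 ≤ max y 0 := le_max_right _ _
  have : 0 ≤ (max y 0) ^ 3 := by positivity
  refine le_of_sq_le_sq ?_ (phi_nonneg s y) <;> nlinarith
theorem sq_le_phi (s : ℝ) {y : ℝ} (hy : y ≤ 1) : (max y 0) ^ 2 ≤ phi s y := by
  have h1 := phi_sq s y
  have h0 : 0 ≤ max y 0 := le_max_right _ _
  have h2 : max y 0 ≤ 1 := max_le hy zero_le_one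
  refine abs_le_of_sq_le_sq' ?_ (phi_nonneg s y) |>.2
  have : 0 ≤ (max y 0) ^ 3 * (1 - max y 0) := mul_nonneg (by positivity) (by linarith)
  nlinarith [sq_nonneg s]
theorem phi_pos_iff {s y : ℝ} (hs : 0 ≤ s) : 0 < phi s y ↔ 0 < s ∨ 0 < y := by
  have h0 : 0 ≤ max y 0 := le_max_right _ _
  unfold phi
  rw [Real.sqrt_pos]
  constructor
  · intro h
    by_contra hc
    push Not at hc
    rw [max_eq_right hc.2, le_antisymm hc.1 hs] at h
    norm_num at h
  · rintro (h | h)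
    · positivity
    · rw [max_eq_left h.le]; positivity
theorem phi_sub {s y1 y2 : ℝ} (h12 : y1 ≤ y2) :
    phi s y1 ≤ phi s y2 ∧
    (phi s y2 - phi s y1) * phi s y2 ≤ 3 * (max y2 0) ^ 2 * (y2 - y1) := by
  have e1 := phi_sq s y1
  have e2 := phi_sq s y2
  have m1 : 0 ≤ max y1 0 := le_max_right _ _
  have m2 : max y1 0 ≤ max y2 0 := max_le_max_right 0 h12
  have m3 : max y2 0 - max y1 0 ≤ y2 - y1 := by
    rcases le_total y1 0 with h | h <;> rcases le_total y2 0 with h' | h' <;> simp [h, h'] <;> linarith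
  set a := max y1 0
  set b := max y2 0
  have n1 := phi_nonneg s y1
  have n2 := phi_nonneg s y2
  have hle : phi s y1 ≤ phi s y2 := by
    refine abs_le_of_sq_le_sq' ?_ n2 |>.2
    rw [e1, e2]
    have := pow_le_pow_left₀ m1 m2 3
    linarith
  refine ⟨hle, ?_⟩
  have h3 : b ^ 3 - a ^ 3 ≤ 3 * b ^ 2 * (b - a) := by
    nlinarith [mul_nonneg (sub_nonneg.2 m2) (mul_nonneg (by linarith : 0 ≤ 2 * b + a) (sub_nonneg.2 m2))]
  have h4 : 3 * b ^ 2 * (b - a) ≤ 3 * b ^ 2 * (y2 - y1) := mul_le_mul_of_nonneg_left m3 (by positivity)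
  nlinarith [mul_nonneg (sub_nonneg.2 hle) n1]
theorem phi_lip (s : ℝ) {y1 y2 : ℝ} (h1 : y1 ≤ 1) (h2 : y2 ≤ 1) :
    |phi s y1 - phi s y2| ≤ 3 * |y1 - y2| := by
  wlog h12 : y1 ≤ y2 generalizing y1 y2
  · rw [abs_sub_comm, abs_sub_comm y1]; exact this h2 h1 (le_of_not_ge h12)
  obtain ⟨a, b⟩ := phi_sub (s := s) h12
  rw [abs_sub_comm, abs_sub_comm y1, abs_of_nonneg (sub_nonneg.2 a), abs_of_nonneg (sub_nonneg.2 h12)]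
  rcases (phi_nonneg s y2).eq_or_lt with e | e
  · have := phi_nonneg s y1
    nlinarith
  · have := sq_le_phi s h2
    by_contra hc
    push Not at hc
    have h5 := mul_lt_mul_of_pos_right hc e
    nlinarith [mul_le_mul_of_nonneg_right this (sub_nonneg.2 h12)]
theorem phi_neg_le {s y r : ℝ} (hs : 0 ≤ s) (hsr : s ≤ r) (hr : r ≤ 1) (hy : y ≤ r) :
    phi s y ≤ 2 * r := by
  have h0 : 0 ≤ max y 0 := le_max_right _ _
  have h1 : max y 0 ≤ r := max_le hy (hs.trans hsr)
  have h2 : (max y 0) ^ 3 ≤ r ^ 2 := by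
    have : (max y 0) ^ 2 ≤ r ^ 2 := pow_le_pow_left₀ h0 h1 2
    nlinarith [sq_nonneg (max y 0)]
  refine abs_le_of_sq_le_sq' ?_ (by linarith) |>.2
  rw [phi_sq]
  nlinarith

theorem G0_alg {s u v t z p1 p2 C Δ : ℝ} (hs0 : 0 < s) (X1 : 0 < u) (X2 : 0 < v)
    (d1 : u / 2 ≤ u - 3 / 2 * z * p1) (d2 : v / 2 ≤ v - 3 / 2 * t ^ 2 * p2)
    (f1 : u ≤ v) (f2 : (v - u) * v ≤ 3 * t ^ 2 * Δ) (g1 : t ^ 2 ≤ v) (g2 : v ^ 2 = s ^ 2 + t ^ 3)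
    (g3 : s ≤ u) (q1 : |p1| ≤ 1 / 10) (q2 : |p2| ≤ C * (v + t))
    (z1 : t ^ 2 - z ≤ 2 * t * Δ ∧ 0 ≤ t ^ 2 - z) (t0 : 0 < t) (t1 : t ≤ 1) (hΔ0 : 0 ≤ Δ)
    (C0 : 0 ≤ C) (hp : |p1 - p2| ≤ 12 * C * Δ) :
    |p1 * (s / (u - 3 / 2 * z * p1)) - p2 * (s / (v - 3 / 2 * t ^ 2 * p2))| ≤ 80 * C * Δ := by
  have hd1 : 0 < u - 3 / 2 * z * p1 := by linarith
  have hd2 : 0 < v - 3 / 2 * t ^ 2 * p2 := by linarith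
  have e : p1 * (s / (u - 3 / 2 * z * p1)) - p2 * (s / (v - 3 / 2 * t ^ 2 * p2)) =
      s * ((p1 - p2) * v + p2 * (v - u) - 3 / 2 * p1 * p2 * (t ^ 2 - z)) /
        ((u - 3 / 2 * z * p1) * (v - 3 / 2 * t ^ 2 * p2)) := by
    rw [mul_div_assoc', mul_div_assoc', div_sub_div _ _ hd1.ne' hd2.ne']
    congr 1
    ring
  rw [e, abs_div, abs_of_pos (mul_pos hd1 hd2), div_le_iff₀ (mul_pos hd1 hd2), abs_mul,
    abs_of_pos hs0]
  have A1 : |(p1 - p2) * v| ≤ 12 * C * Δ * v := by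
    rw [abs_mul, abs_of_pos X2]
    exact mul_le_mul_of_nonneg_right hp X2.le
  have A2 : |p2 * (v - u)| ≤ 6 * C * Δ * v := by
    rw [abs_mul, abs_of_nonneg (sub_nonneg.2 f1)]
    have w1 : |p2| * (v - u) * v ≤ C * (v + t) * (3 * t ^ 2 * Δ) := by
      rw [mul_assoc]
      exact mul_le_mul q2 f2 (mul_nonneg (sub_nonneg.2 f1) X2.le) (by positivity)
    have w2 : (v + t) * t ^ 2 ≤ 2 * v ^ 2 := by nlinarith [sq_nonneg s]
    have w3 : C * (v + t) * (3 * t ^ 2 * Δ) ≤ 6 * C * Δ * v * v := by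
      have := mul_le_mul_of_nonneg_left w2 (by positivity : 0 ≤ 3 * C * Δ)
      linarith
    exact le_of_mul_le_mul_right (w1.trans w3) X2
  have A3 : |3 / 2 * p1 * p2 * (t ^ 2 - z)| ≤ C * Δ * v := by
    rw [abs_mul, abs_mul, abs_mul, abs_of_nonneg z1.2, abs_of_pos (by norm_num : (0:ℝ) < 3 / 2)]
    have w1 : |p2| * (t ^ 2 - z) ≤ C * (v + t) * (2 * t * Δ) :=
      mul_le_mul q2 z1.1 z1.2 (by positivity)
    have w2 : (v + t) * t ≤ 2 * v := by nlinarith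
    have w3 : C * (v + t) * (2 * t * Δ) ≤ 4 * C * Δ * v := by
      have := mul_le_mul_of_nonneg_left w2 (by positivity : 0 ≤ 2 * C * Δ)
      linarith
    have w4 : |p1| * (|p2| * (t ^ 2 - z)) ≤ 1 / 10 * (4 * C * Δ * v) :=
      mul_le_mul q1 (w1.trans w3) (mul_nonneg (abs_nonneg _) z1.2) (by norm_num)
    have : 0 ≤ C * Δ * v := by positivity
    linarith
  have A : |(p1 - p2) * v + p2 * (v - u) - 3 / 2 * p1 * p2 * (t ^ 2 - z)| ≤ 20 * C * Δ * v := by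
    refine (abs_sub _ _).trans ?_
    have := abs_add_le ((p1 - p2) * v) (p2 * (v - u))
    have : 0 ≤ C * Δ * v := by positivity
    linarith
  calc _ ≤ u * (20 * C * Δ * v) := mul_le_mul g3 A (abs_nonneg _) X1.le
    _ = 80 * C * Δ * (u / 2 * (v / 2)) := by ring
    _ ≤ _ := mul_le_mul_of_nonneg_left (mul_le_mul d1 d2 (by positivity) hd1.le) (by positivity)

namespace Dat
variable (D : Dat)

/-- slope -/
def p (a s y : ℝ) : ℝ := D.μ (phi s y, y) + a * (D.n (phi s y, y) * phi s (-y))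
/-- `dx / ds` -/
def kap (a s y : ℝ) : ℝ := if y ≤ 0 then 1 else s / (phi s y - 3 / 2 * y ^ 2 * D.p a s y)
/-- right hand side -/
def G0 (a s y : ℝ) : ℝ := D.p a s y * D.kap a s y

theorem p_cont (a : ℝ) : Continuous fun q : ℝ × ℝ => D.p a q.1 q.2 := by
  have h1 : Continuous fun q : ℝ × ℝ => (phi q.1 q.2, q.2) := phi_cont.prodMk continuous_snd
  have h2 : Continuous fun q : ℝ × ℝ => phi q.1 (-q.2) :=
    phi_cont.comp (continuous_fst.prodMk continuous_snd.neg)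
  exact (D.μ_cont.comp h1).add (continuous_const.mul ((D.n_cont.comp h1).mul h2))

variable {a s y : ℝ} (ha : |a| = 1)
include ha

theorem p_le (hs : 0 ≤ s) (hsr : s ≤ D.r) (hy : -D.r ≤ y) : |D.p a s y| ≤ 1 / 10 := by
  have h1 := D.μ_le (phi s y, y)
  have h2 := D.n_pos (phi s y, y)
  have h3 := D.n_le (phi s y, y)
  have h4 : phi s (-y) ≤ 2 * D.r := phi_neg_le hs hsr D.r_le (by linarith)
  have h5 := phi_nonneg s (-y)
  have h6 : D.n (phi s y, y) * phi s (-y) ≤ D.M * (2 * D.r) := mul_le_mul h3 h4 h5 D.M_pos.le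
  unfold p
  refine (abs_add_le _ _).trans ?_
  rw [abs_mul, ha, one_mul, abs_of_nonneg (mul_nonneg h2.le h5)]
  linarith [D.Mr]

theorem den_ge (hs : 0 ≤ s) (hsr : s ≤ D.r) (hy : -D.r ≤ y) (hy' : y ≤ 1) :
    phi s y / 2 ≤ phi s y - 3 / 2 * (max y 0) ^ 2 * D.p a s y := by
  have h1 := (abs_le.1 (D.p_le ha hs hsr hy)).2
  have h2 := sq_le_phi s hy'
  nlinarith [sq_nonneg (max y 0)]

omit ha in
theorem kap_eq (hs : 0 ≤ s) (h : 0 < phi s y) :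
    D.kap a s y = s / (phi s y - 3 / 2 * (max y 0) ^ 2 * D.p a s y) := by
  unfold kap
  split_ifs with hy
  · rw [phi_of_nonpos hs hy] at h
    rw [phi_of_nonpos hs hy, max_eq_right hy]
    field_simp
    ring
  · rw [max_eq_left (not_le.1 hy).le]

theorem kap_mem (hs : 0 ≤ s) (hsr : s ≤ D.r) (hy : -D.r ≤ y) (hy' : y ≤ 1) :
    0 ≤ D.kap a s y ∧ D.kap a s y ≤ 2 := by
  by_cases h : 0 < phi s y
  · rw [D.kap_eq hs h]
    have h1 := D.den_ge ha hs hsr hy hy'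
    have h2 : 0 < phi s y - 3 / 2 * (max y 0) ^ 2 * D.p a s y := by linarith
    refine ⟨div_nonneg hs h2.le, (div_le_iff₀ h2).2 ?_⟩
    linarith [le_phi (s := s) y]
  · rw [phi_pos_iff hs] at h
    push Not at h
    simp [kap, h.2]

theorem G0_le (hs : 0 ≤ s) (hsr : s ≤ D.r) (hy : -D.r ≤ y) (hy' : y ≤ 1) :
    |D.G0 a s y| ≤ 1 / 5 := by
  obtain ⟨k1, k2⟩ := D.kap_mem ha hs hsr hy hy'
  have := D.p_le ha hs hsr hy
  unfold G0
  rw [abs_mul, abs_of_nonneg k1]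
  nlinarith [abs_nonneg (D.p a s y)]

omit ha in
theorem p_zero : D.p a 0 0 = 0 := by
  have : phi 0 0 = 0 := phi_of_nonpos le_rfl le_rfl
  have h := D.μ_zero
  rw [show (0 : ℝ × ℝ) = ((0:ℝ), (0:ℝ)) from rfl] at h
  simp [p, this, h]

theorem G0_contOn : ContinuousOn (fun q : ℝ × ℝ => D.G0 a q.1 q.2) (Icc 0 D.r ×ˢ Icc (-D.r) D.r) := by
  rintro ⟨s, y⟩ ⟨hs, hy⟩
  simp only at hs hy
  have hy1 := hy.2.trans D.r_le
  have cp := (D.p_cont a).continuousAt (x := (s, y))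
  have cphi := phi_cont.continuousAt (x := (s, y))
  by_cases h : 0 < phi s y
  · have h1 := D.den_ge ha hs.1 hs.2 hy.1 hy1
    have h2 : phi s y - 3 / 2 * (max y 0) ^ 2 * D.p a s y ≠ 0 := by
      have : 0 < phi s y / 2 := by positivity
      linarith
    have hc : ContinuousAt (fun q : ℝ × ℝ => D.p a q.1 q.2 * (q.1 / (phi q.1 q.2 -
        3 / 2 * (max q.2 0) ^ 2 * D.p a q.1 q.2))) (s, y) := by
      refine cp.mul (continuousAt_fst.div (cphi.sub (ContinuousAt.mul ?_ cp)) h2)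
      exact Continuous.continuousAt (by fun_prop)
    refine hc.continuousWithinAt.congr_of_eventuallyEq ?_ ?_
    · filter_upwards [self_mem_nhdsWithin, nhdsWithin_le_nhds (continuousAt_const.eventually_lt cphi h)] with q hq hq'
      rw [G0, D.kap_eq hq.1.1 hq']
    · simp only [G0]
      rw [D.kap_eq hs.1 h]
  · rw [phi_pos_iff hs.1] at h
    push Not at h
    have s0 : s = 0 := le_antisymm h.1 hs.1
    subst s0
    rcases h.2.eq_or_lt with e | e
    · subst e
      have h0 : D.G0 a 0 0 = 0 := by rw [G0, D.p_zero, zero_mul]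
      rw [ContinuousWithinAt]
      simp only [h0]
      refine squeeze_zero_norm' (a := fun q : ℝ × ℝ => 2 * |D.p a q.1 q.2|) ?_ ?_
      · filter_upwards [self_mem_nhdsWithin] with q hq
        obtain ⟨k1, k2⟩ := D.kap_mem ha hq.1.1 hq.1.2 hq.2.1 (hq.2.2.trans D.r_le)
        rw [G0, Real.norm_eq_abs, abs_mul, abs_of_nonneg k1]
        nlinarith [abs_nonneg (D.p a q.1 q.2)]
      · have : Tendsto (fun q : ℝ × ℝ => 2 * |D.p a q.1 q.2|) (nhds (0, 0)) (nhds (2 * |D.p a 0 0|)) :=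
          (cp.abs.const_mul 2)
        rw [D.p_zero, abs_zero, mul_zero] at this
        exact this.mono_left nhdsWithin_le_nhds
    · refine cp.continuousWithinAt.congr_of_eventuallyEq ?_ ?_
      · have : ∀ᶠ q : ℝ × ℝ in nhds ((0:ℝ), y), q.2 < 0 :=
          continuousAt_snd.eventually_lt continuousAt_const e
        filter_upwards [nhdsWithin_le_nhds this] with q hq
        simp [G0, kap, hq.le]
      · simp [G0, kap, e.le]

theorem p_lip (hs : 0 ≤ s) (hsr : s ≤ D.r) {y1 y2 : ℝ} (h1 : |y1| ≤ D.r) (h2 : |y2| ≤ D.r) :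
    |D.p a s y1 - D.p a s y2| ≤ (12 * D.K + 3 * D.M) * |y1 - y2| := by
  have hr := D.r_le
  have b1 := abs_le.1 h1
  have b2 := abs_le.1 h2
  have l1 := phi_lip s (y1 := y1) (y2 := y2) (by linarith) (by linarith)
  have l2 := phi_lip s (y1 := -y1) (y2 := -y2) (by linarith) (by linarith)
  rw [show -y1 - -y2 = -(y1 - y2) by ring, abs_neg] at l2
  have m := D.μ_lip (phi s y1, y1) (phi s y2, y2)
  have n := D.n_lip (phi s y1, y1) (phi s y2, y2)
  simp only at m n
  have hK := D.K_nonneg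
  have r1 : phi s (-y1) ≤ 2 := (phi_neg_le hs hsr hr (by linarith)).trans (by linarith)
  have r0 := phi_nonneg s (-y1)
  have n2 := D.n_le (phi s y2, y2)
  have n0 := D.n_pos (phi s y2, y2)
  have hm : |D.μ (phi s y1, y1) - D.μ (phi s y2, y2)| ≤ D.K * (4 * |y1 - y2|) :=
    m.trans (mul_le_mul_of_nonneg_left (by linarith) hK)
  have hn : |D.n (phi s y1, y1) - D.n (phi s y2, y2)| ≤ D.K * (4 * |y1 - y2|) :=
    n.trans (mul_le_mul_of_nonneg_left (by linarith) hK)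
  have e : D.p a s y1 - D.p a s y2 = (D.μ (phi s y1, y1) - D.μ (phi s y2, y2)) +
      a * ((D.n (phi s y1, y1) - D.n (phi s y2, y2)) * phi s (-y1) +
        D.n (phi s y2, y2) * (phi s (-y1) - phi s (-y2))) := by unfold p; ring
  have t1 : |(D.n (phi s y1, y1) - D.n (phi s y2, y2)) * phi s (-y1)| ≤ D.K * (4 * |y1 - y2|) * 2 := by
    rw [abs_mul, abs_of_nonneg r0]
    exact mul_le_mul hn r1 r0 (by positivity)
  have t2 : |D.n (phi s y2, y2) * (phi s (-y1) - phi s (-y2))| ≤ D.M * (3 * |y1 - y2|) := by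
    rw [abs_mul, abs_of_nonneg n0.le]
    exact mul_le_mul n2 l2 (abs_nonneg _) D.M_pos.le
  rw [e]
  refine (abs_add_le _ _).trans ?_
  rw [abs_mul, ha, one_mul]
  have := abs_add_le ((D.n (phi s y1, y1) - D.n (phi s y2, y2)) * phi s (-y1))
    (D.n (phi s y2, y2) * (phi s (-y1) - phi s (-y2)))
  linarith

theorem G0_lip (hs : 0 ≤ s) (hsr : s ≤ D.r) {y1 y2 : ℝ} (h1 : |y1| ≤ D.r) (h2 : |y2| ≤ D.r) :
    |D.G0 a s y1 - D.G0 a s y2| ≤ 80 * (D.K + D.M) * |y1 - y2| := by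
  wlog h12 : y1 ≤ y2 generalizing y1 y2
  · rw [abs_sub_comm, abs_sub_comm y1]; exact this h2 h1 (le_of_not_ge h12)
  have hK := D.K_nonneg
  have hM := D.M_pos
  have hr := D.r_le
  have b1 := abs_le.1 h1
  have b2 := abs_le.1 h2
  have hp := D.p_lip ha hs hsr h1 h2
  have hweak : (12 * D.K + 3 * D.M) * |y1 - y2| ≤ 80 * (D.K + D.M) * |y1 - y2| :=
    mul_le_mul_of_nonneg_right (by linarith) (abs_nonneg _)
  rcases le_or_gt y2 0 with hy2 | hy2
  · have e1 : D.G0 a s y1 = D.p a s y1 := by simp [G0, kap, h12.trans hy2]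
    have e2 : D.G0 a s y2 = D.p a s y2 := by simp [G0, kap, hy2]
    rw [e1, e2]
    exact hp.trans hweak
  have hΔ : |y1 - y2| = y2 - y1 := by rw [abs_sub_comm, abs_of_nonneg (by linarith)]
  rcases hs.eq_or_lt with hs0 | hs0
  · subst hs0
    have e2 : D.G0 a 0 y2 = 0 := by simp [G0, kap, not_le.2 hy2]
    rw [e2]
    rcases le_or_gt y1 0 with hy1 | hy1
    · have e1 : D.G0 a 0 y1 = D.p a 0 y1 - D.p a 0 0 := by simp [G0, kap, hy1, D.p_zero]
      have := D.p_lip ha hs hsr h1 (y2 := 0) (by simpa using D.r_pos.le)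
      rw [e1, sub_zero]
      rw [sub_zero, abs_of_nonpos hy1] at this
      rw [hΔ] at hweak ⊢
      nlinarith
    · have e1 : D.G0 a 0 y1 = 0 := by simp [G0, kap, not_le.2 hy1]
      rw [e1, sub_zero, abs_zero]
      positivity
  have X1 : 0 < phi s y1 := (phi_pos_iff hs).2 (Or.inl hs0)
  have X2 : 0 < phi s y2 := (phi_pos_iff hs).2 (Or.inl hs0)
  have d1 := D.den_ge ha hs hsr (y := y1) (by linarith) (by linarith)
  have d2 := D.den_ge ha hs hsr (y := y2) (by linarith) (by linarith)
  rw [G0, G0, D.kap_eq hs X1, D.kap_eq hs X2]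
  obtain ⟨f1, f2⟩ := phi_sub (s := s) h12
  have g1 := sq_le_phi s (y := y2) (by linarith)
  have g2 := phi_sq s y2
  have g3 := le_phi (s := s) y1
  have q1 := D.p_le ha hs hsr (y := y1) (by linarith)
  have q2 : |D.p a s y2| ≤ (D.K + D.M) * (phi s y2 + max y2 0) := by
    have m := D.μ_lip (phi s y2, y2) 0
    rw [D.μ_zero] at m
    simp only [sub_zero, Prod.fst_zero, Prod.snd_zero] at m
    rw [abs_of_pos X2, abs_of_pos hy2] at m
    have n1 := D.n_pos (phi s y2, y2)
    have n2 := D.n_le (phi s y2, y2)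
    unfold p
    rw [phi_of_nonpos hs (by linarith : -y2 ≤ 0), max_eq_left hy2.le]
    refine (abs_add_le _ _).trans ?_
    rw [abs_mul, ha, one_mul, abs_of_nonneg (a := D.n (phi s y2, y2) * s) (mul_nonneg n1.le hs)]
    have := mul_le_mul n2 (le_phi (s := s) y2) hs hM.le
    nlinarith [mul_nonneg hM.le hy2.le]
  have z1 : (max y2 0) ^ 2 - (max y1 0) ^ 2 ≤ 2 * max y2 0 * (y2 - y1) ∧
      0 ≤ (max y2 0) ^ 2 - (max y1 0) ^ 2 := by
    rw [max_eq_left hy2.le]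
    rcases le_total y1 0 with h | h
    · rw [max_eq_right h]; constructor <;> nlinarith
    · rw [max_eq_left h]; constructor <;> nlinarith
  have t0 : 0 < max y2 0 := by rw [max_eq_left hy2.le]; exact hy2
  have t1 : max y2 0 ≤ 1 := by rw [max_eq_left hy2.le]; linarith
  rw [hΔ] at hp ⊢
  exact G0_alg hs0 X1 X2 d1 d2 f1 f2 g1 g2 g3 q1 q2 z1 t0 t1 (sub_nonneg.2 h12) (by linarith)
    (hp.trans (mul_le_mul_of_nonneg_right (by linarith) (sub_nonneg.2 h12)))

end Dat

namespace Dat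
variable (D : Dat)

/-- Mirror image. -/
def m : Dat where
  μ := fun p => -D.μ (-p.1, p.2)
  n := fun p => D.n (-p.1, p.2)
  r := D.r
  K := D.K
  M := D.M
  r_pos := D.r_pos
  r_le := D.r_le
  K_nonneg := D.K_nonneg
  μ_lip := fun p q => by
    have := D.μ_lip (-p.1, p.2) (-q.1, q.2)
    rw [show -D.μ (-p.1, p.2) - -D.μ (-q.1, q.2) = -(D.μ (-p.1, p.2) - D.μ (-q.1, q.2)) by ring,
      abs_neg]
    simp only at this
    rwa [show -p.1 - -q.1 = -(p.1 - q.1) by ring, abs_neg] at this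
  n_lip := fun p q => by
    have := D.n_lip (-p.1, p.2) (-q.1, q.2)
    simp only at this
    rwa [show -p.1 - -q.1 = -(p.1 - q.1) by ring, abs_neg] at this
  μ_zero := by
    have := D.μ_zero
    rw [show (0 : ℝ × ℝ) = ((0:ℝ), (0:ℝ)) from rfl] at this
    simp [this]
  μ_le := fun p => by rw [abs_neg]; exact D.μ_le _
  n_pos := fun p => D.n_pos _
  n_le := fun p => D.n_le _
  Mr := D.Mr

theorem m_m : D.m.m = D := by
  cases D; simp [m]

/-- clamped right hand side -/
def H (a s y : ℝ) : ℝ :=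
  D.G0 a (max 0 (min s D.r)) (max (-D.r) (min y D.r)) + a * min (max (s - D.r) 0) 1
/-- right hand side on the whole plane -/
def G (a s y : ℝ) : ℝ := if 0 ≤ s then D.H a s y else -D.m.H (-a) (-s) y

theorem clamp_s (s : ℝ) : 0 ≤ max 0 (min s D.r) ∧ max 0 (min s D.r) ≤ D.r :=
  ⟨le_max_left _ _, max_le D.r_pos.le (min_le_right _ _)⟩
theorem clamp_y (y : ℝ) : -D.r ≤ max (-D.r) (min y D.r) ∧ max (-D.r) (min y D.r) ≤ D.r :=
  ⟨le_max_left _ _, max_le (by linarith [D.r_pos]) (min_le_right _ _)⟩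

theorem clamp_lip (y1 y2 : ℝ) :
    |max (-D.r) (min y1 D.r) - max (-D.r) (min y2 D.r)| ≤ |y1 - y2| := by
  rw [max_comm, max_comm (-D.r)]
  exact (abs_max_sub_max_le_abs _ _ _).trans (abs_inf_sub_inf_le_abs _ _ _)

theorem far_mem (s : ℝ) : 0 ≤ min (max (s - D.r) 0) 1 ∧ min (max (s - D.r) 0) 1 ≤ 1 :=
  ⟨le_min (le_max_right _ _) zero_le_one, min_le_right _ _⟩

theorem H_cont {a : ℝ} (ha : |a| = 1) : Continuous fun q : ℝ × ℝ => D.H a q.1 q.2 := by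
  have h1 : Continuous fun q : ℝ × ℝ => (max 0 (min q.1 D.r), max (-D.r) (min q.2 D.r)) := by fun_prop
  have h2 := (D.G0_contOn ha).comp_continuous h1 fun q => ⟨D.clamp_s q.1, D.clamp_y q.2⟩
  exact h2.add (by fun_prop)

theorem H_le {a : ℝ} (ha : |a| = 1) (s y : ℝ) : |D.H a s y| ≤ 2 := by
  have h1 := D.G0_le ha (D.clamp_s s).1 (D.clamp_s s).2 (D.clamp_y y).1 ((D.clamp_y y).2.trans D.r_le)
  have h2 := D.far_mem s
  refine (abs_add_le _ _).trans ?_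
  rw [abs_mul, ha, abs_of_nonneg h2.1]
  linarith

theorem H_lip {a : ℝ} (ha : |a| = 1) (s y1 y2 : ℝ) :
    |D.H a s y1 - D.H a s y2| ≤ 80 * (D.K + D.M) * |y1 - y2| := by
  have h1 := D.G0_lip ha (D.clamp_s s).1 (D.clamp_s s).2
    (abs_le.2 (D.clamp_y y1)) (abs_le.2 (D.clamp_y y2))
  unfold H
  rw [add_sub_add_right_eq_sub]
  refine h1.trans (mul_le_mul_of_nonneg_left (D.clamp_lip _ _) ?_)
  have := D.K_nonneg
  have := D.M_pos
  positivity

theorem p_m_zero (a y : ℝ) (hy : y ≤ 0) : D.m.p (-a) 0 y = -D.p a 0 y := by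
  simp only [p, m, phi_of_nonpos le_rfl hy, neg_zero]
  ring

theorem H_m_zero (a y : ℝ) : D.m.H (-a) 0 y = -D.H a 0 y := by
  have h0 : max 0 (min 0 D.r) = 0 := by simp
  have e : D.m.r = D.r := rfl
  have h1 : max (0 - D.r) 0 = 0 := by simp [D.r_pos.le]
  unfold H
  rw [e, h0, h1]
  simp only [G0, kap]
  split_ifs with h
  · rw [D.p_m_zero a _ h]; simp
  · simp

theorem G_m (a s y : ℝ) : D.m.G (-a) (-s) y = -D.G a s y := by
  unfold G
  rw [m_m, neg_neg, neg_neg]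
  rcases lt_trichotomy s 0 with h | h | h
  · rw [if_pos (by linarith), if_neg (by linarith), neg_neg]
  · subst h
    simp [D.H_m_zero]
  · rw [if_neg (by linarith), if_pos h.le]

/-- The Lipschitz constant. -/
def KK : NNReal := (80 * (D.K + D.M)).toNNReal

theorem ok {a : ℝ} (ha : |a| = 1) : OdeOk (D.G a) D.KK 2 := by
  have ha' : |-a| = 1 := by rwa [abs_neg]
  refine ⟨?_, fun s => ?_, fun s y => ?_⟩
  · have h2 : Continuous fun q : ℝ × ℝ => -D.m.H (-a) (-q.1) q.2 :=
      ((D.m.H_cont ha').comp (continuous_fst.neg.prodMk continuous_snd)).neg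
    refine Continuous.if_le (D.H_cont ha) h2 continuous_const continuous_fst ?_
    intro q hq
    rw [← hq, neg_zero, D.H_m_zero, neg_neg]
  · refine LipschitzWith.of_dist_le_mul fun y1 y2 => ?_
    have e : ((D.KK : NNReal) : ℝ) = 80 * (D.K + D.M) := Real.coe_toNNReal _ (by
      have := D.K_nonneg
      have := D.M_pos
      positivity)
    rw [Real.dist_eq, Real.dist_eq, e]
    unfold G
    split_ifs
    · exact D.H_lip ha s y1 y2
    · have := D.m.H_lip ha' (-s) y2 y1
      rw [abs_sub_comm y1]
      rwa [neg_sub_neg]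
  · show |_| ≤ (2 : ℝ)
    unfold G
    split_ifs
    · exact D.H_le ha s y
    · rw [abs_neg]; exact D.m.H_le ha' _ _

theorem G0_lt {s y : ℝ} (hs : 0 < s) (hsr : s ≤ D.r) (hy : -D.r ≤ y) (hy' : y ≤ D.r) :
    D.G0 (-1) s y < D.G0 1 s y := by
  have hp : D.p (-1) s y < D.p 1 s y := by
    have := D.n_pos (phi s y, y)
    have := (phi_pos_iff (y := -y) hs.le).2 (Or.inl hs)
    have := mul_pos ‹0 < D.n (phi s y, y)› this
    unfold p
    linarith
  have X : 0 < phi s y := (phi_pos_iff hs.le).2 (Or.inl hs)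
  have a1 : |(1:ℝ)| = 1 := by simp
  have a2 : |(-1:ℝ)| = 1 := by simp
  have d1 := D.den_ge a1 hs.le hsr hy (hy'.trans D.r_le)
  have d2 := D.den_ge a2 hs.le hsr hy (hy'.trans D.r_le)
  rw [G0, G0, D.kap_eq hs.le X, D.kap_eq hs.le X, mul_div_assoc', mul_div_assoc',
    div_lt_div_iff₀ (by linarith) (by linarith)]
  have := mul_pos (mul_pos hs X) (sub_pos.2 hp)
  nlinarith

theorem hp : HP (D.G 1) (D.G (-1)) D.KK 2 := by
  have a1 : |(1:ℝ)| = 1 := by simp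
  have a2 : |(-1:ℝ)| = 1 := by simp
  have hlt : ∀ s y, 0 < s → D.G (-1) s y < D.G 1 s y := by
    intro s y hs
    have h1 := D.G0_lt (s := max 0 (min s D.r)) (lt_max_of_lt_right (lt_min hs D.r_pos)) (D.clamp_s s).2
      (D.clamp_y y).1 (D.clamp_y y).2
    have h2 := D.far_mem s
    unfold G
    rw [if_pos hs.le, if_pos hs.le]
    unfold H
    linarith
  refine ⟨D.ok a1, D.ok a2, fun s y hs => ?_, fun s y hs _ => hlt s y hs, D.r + 1, ?_, ?_⟩
  · rcases hs.eq_or_lt with e | e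
    · have c : ∀ a, |a| = 1 → Continuous fun s => D.G a s y := fun a ha =>
        (D.ok ha).cont.comp (continuous_id.prodMk continuous_const)
      subst e
      refine le_of_tendsto_of_tendsto (b := nhdsWithin 0 (Ioi 0))
        (((c _ a2).tendsto 0).mono_left nhdsWithin_le_nhds)
        (((c _ a1).tendsto 0).mono_left nhdsWithin_le_nhds) ?_
      filter_upwards [self_mem_nhdsWithin] with s hs using (hlt s y hs).le
    · exact (hlt s y e).le
  · linarith [D.r_pos]
  · intro s hs y1 y2
    have h0 : 0 ≤ s := by linarith [D.r_pos]
    have e : min (max (s - D.r) 0) 1 = 1 := by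
      rw [max_eq_left (by linarith)]; exact min_eq_right (by linarith)
    have h1 := D.G0_le a1 (D.clamp_s s).1 (D.clamp_s s).2 (D.clamp_y y1).1 ((D.clamp_y y1).2.trans D.r_le)
    have h2 := D.G0_le a2 (D.clamp_s s).1 (D.clamp_s s).2 (D.clamp_y y2).1 ((D.clamp_y y2).2.trans D.r_le)
    unfold G
    rw [if_pos h0, if_pos h0]
    unfold H
    rw [e]
    linarith [abs_le.1 h1, abs_le.1 h2]

end Dat

/-- unsigned `s` coordinate -/
def sqc (x w : ℝ) : ℝ := √(x ^ 2 - (max w 0) ^ 3)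
/-- signed `s` coordinate -/
def Sc (q : ℝ × ℝ) : ℝ := if 0 ≤ q.1 then sqc q.1 q.2 else -sqc q.1 q.2
/-- signed `x` from `s` -/
def Phi (s y : ℝ) : ℝ := if 0 ≤ s then phi s y else -phi (-s) y
/-- reflection -/
def rf (q : ℝ × ℝ) : ℝ × ℝ := (-q.1, q.2)
/-- points of the closed region where leaves live -/
def good (q : ℝ × ℝ) : Prop := 0 < q.1 ^ 2 - (max q.2 0) ^ 3 ∨ (q.1 = 0 ∧ q.2 ≤ 0)

theorem rf_rf (q : ℝ × ℝ) : rf (rf q) = q := by simp [rf]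
theorem rf_cont : Continuous rf := by unfold rf; fun_prop
theorem sqc_nonneg (x w : ℝ) : 0 ≤ sqc x w := Real.sqrt_nonneg _
theorem sqc_neg (x w : ℝ) : sqc (-x) w = sqc x w := by simp [sqc]
theorem sqc_cont : Continuous fun q : ℝ × ℝ => sqc q.1 q.2 := by unfold sqc; fun_prop
theorem sqc_zero (w : ℝ) : sqc 0 w = 0 := by
  have : 0 ≤ max w 0 := le_max_right _ _
  exact Real.sqrt_eq_zero_of_nonpos (by have : 0 ≤ (max w 0) ^ 3 := by positivity
                                        linarith)
theorem sqc_phi {s : ℝ} (y : ℝ) (hs : 0 ≤ s) : sqc (phi s y) y = s := by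
  rw [sqc, phi_sq, add_sub_cancel_right, Real.sqrt_sq hs]
theorem phi_sqc {x w : ℝ} (h : phi 0 w ≤ x) : phi (sqc x w) w = x := by
  have h0 := phi_nonneg 0 w
  have h1 := phi_sq 0 w
  have h2 : 0 ≤ x ^ 2 - (max w 0) ^ 3 := by nlinarith
  rw [phi, sqc, Real.sq_sqrt h2, sub_add_cancel, Real.sqrt_sq (h0.trans h)]
theorem sqc_bd {x w : ℝ} (h : x = phi 0 w) : sqc x w = 0 := by
  rw [h, sqc_phi _ le_rfl]
theorem phi_zero_le {s : ℝ} (y : ℝ) : phi 0 y ≤ phi s y := by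
  unfold phi
  exact Real.sqrt_le_sqrt (by nlinarith [sq_nonneg s])
theorem Sc_cont : Continuous Sc := by
  refine Continuous.if_le sqc_cont sqc_cont.neg continuous_const continuous_fst ?_
  intro q hq
  rw [← hq, sqc_zero, neg_zero]
theorem Sc_rf (q : ℝ × ℝ) : Sc (rf q) = -Sc q := by
  unfold Sc rf
  simp only [sqc_neg]
  rcases lt_trichotomy q.1 0 with h | h | h
  · rw [if_pos (by linarith), if_neg (by linarith), neg_neg]
  · simp [h, sqc_zero]
  · rw [if_neg (by linarith), if_pos h.le]
theorem phi_zero_lt {x w : ℝ} (h : 0 < x ^ 2 - (max w 0) ^ 3) (hx : 0 ≤ x) : phi 0 w < x := by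
  refine lt_of_pow_lt_pow_left₀ 2 hx ?_
  rw [phi_sq]; linarith
theorem good_rf {q : ℝ × ℝ} (h : good q) : good (rf q) := by
  simpa [good, rf] using h
theorem good.Phi {q : ℝ × ℝ} (h : good q) : Phi (Sc q) q.2 = q.1 := by
  rcases h with h | ⟨h, h'⟩
  · have hp : 0 < sqc q.1 q.2 := Real.sqrt_pos.2 h
    unfold Sc
    split_ifs with h0
    · rw [_root_.Phi, if_pos hp.le, phi_sqc (phi_zero_lt h h0).le]
    · have hq := sqc_neg q.1 q.2
      have h2 : phi 0 q.2 < -q.1 := phi_zero_lt (by simpa using h) (by linarith)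
      rw [_root_.Phi, if_neg (by linarith), neg_neg, ← hq, phi_sqc h2.le, neg_neg]
  · rw [Sc, if_pos h.ge, h, sqc_zero, _root_.Phi, if_pos le_rfl, phi_of_nonpos le_rfl h']
theorem good.cases {q : ℝ × ℝ} (h : good q) : phi 0 q.2 ≤ q.1 ∨ q.1 ≤ -phi 0 q.2 := by
  rcases h with h | ⟨h, h'⟩
  · rcases le_total 0 q.1 with h0 | h0
    · exact Or.inl (phi_zero_lt h h0).le
    · exact Or.inr (by linarith [phi_zero_lt (x := -q.1) (w := q.2) (by simpa using h) (by linarith)])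
  · left; rw [phi_of_nonpos le_rfl h', h]

namespace Dat
variable (D D' : Dat)

/-- Right part of the homeomorphism. -/
def hR (q : ℝ × ℝ) : ℝ × ℝ :=
  (phi (D.hp.K D'.hp id (sqc q.1 q.2, q.2)).1 (D.hp.K D'.hp id (sqc q.1 q.2, q.2)).2,
    (D.hp.K D'.hp id (sqc q.1 q.2, q.2)).2)

/-- The homeomorphism. -/
def hom (q : ℝ × ℝ) : ℝ × ℝ := if phi 0 q.2 ≤ q.1 then D.hR D' q else
  if q.1 ≤ -phi 0 q.2 then rf (D.m.hR D'.m (rf q)) else q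

theorem hR_cont : Continuous (D.hR D') := by
  have h1 : Continuous fun q : ℝ × ℝ => D.hp.K D'.hp id (sqc q.1 q.2, q.2) :=
    (D.hp.K_cont D'.hp monotone_id continuous_id).comp_continuous
      (sqc_cont.prodMk continuous_snd) fun q => sqc_nonneg _ _
  exact (phi_cont.comp h1).prodMk (continuous_snd.comp h1)

theorem hR_bd {q : ℝ × ℝ} (h : q.1 = phi 0 q.2) : D.hR D' q = q := by
  rw [hR, sqc_bd h, HP.K_zero]
  exact Prod.ext h.symm rfl

theorem hR_ge (q : ℝ × ℝ) : phi 0 (D.hR D' q).2 ≤ (D.hR D' q).1 := phi_zero_le _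

theorem hR_sqc (q : ℝ × ℝ) : (sqc (D.hR D' q).1 (D.hR D' q).2, (D.hR D' q).2) =
    D.hp.K D'.hp id (sqc q.1 q.2, q.2) := by
  rw [hR]
  simp only
  rw [sqc_phi _ (D.hp.K_nonneg D'.hp _)]

theorem hR_hR {q : ℝ × ℝ} (h : phi 0 q.2 ≤ q.1) : D'.hR D (D.hR D' q) = q := by
  conv_lhs => rw [hR]
  rw [D.hR_sqc D', D.hp.K_K D'.hp monotone_id (fun u => rfl) (sqc_nonneg _ _)]
  exact Prod.ext (phi_sqc h) rfl

theorem hom_right {q : ℝ × ℝ} (h : phi 0 q.2 ≤ q.1) : D.hom D' q = D.hR D' q := if_pos h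

theorem hom_left {q : ℝ × ℝ} (h : q.1 ≤ -phi 0 q.2) : D.hom D' q = rf (D.m.hR D'.m (rf q)) := by
  unfold hom
  split_ifs with h'
  · have := phi_nonneg 0 q.2
    rw [D.hR_bd D' (by linarith), D.m.hR_bd D'.m (by simp only [rf]; linarith), rf_rf]
  · rfl

theorem hom_cont : Continuous (D.hom D') := by
  have c0 : Continuous fun q : ℝ × ℝ => phi 0 q.2 :=
    phi_cont.comp (continuous_const.prodMk continuous_snd)
  refine Continuous.if_le (D.hR_cont D') (Continuous.if_le
    (rf_cont.comp ((D.m.hR_cont D'.m).comp rf_cont)) continuous_id continuous_fst c0.neg ?_)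
    c0 continuous_fst ?_
  · intro q hq
    rw [D.m.hR_bd D'.m (by simp only [rf]; linarith), rf_rf]
  · intro q hq
    rw [D.hR_bd D' hq.symm]
    split_ifs with h'
    · have := phi_nonneg 0 q.2
      rw [D.m.hR_bd D'.m (by simp only [rf]; linarith), rf_rf]
    · rfl

theorem hom_hom (q : ℝ × ℝ) : D'.hom D (D.hom D' q) = q := by
  by_cases h1 : phi 0 q.2 ≤ q.1
  · rw [D.hom_right D' h1, D'.hom_right D (D.hR_ge D' q), D.hR_hR D' h1]
  by_cases h2 : q.1 ≤ -phi 0 q.2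
  · have h3 : phi 0 (rf q).2 ≤ (rf q).1 := by simp only [rf]; linarith
    have h4 := D.m.hR_ge D'.m (rf q)
    rw [D.hom_left D' h2, D'.hom_left D (by simp only [rf] at h4 ⊢; linarith), rf_rf,
      D.m.hR_hR D'.m h3, rf_rf]
  · have e : ∀ D D' : Dat, D.hom D' q = q := fun D D' => by rw [hom, if_neg h1, if_neg h2]
    rw [e, e]

theorem hom_good {q : ℝ × ℝ} (h : good q) : good (D.hom D' q) ∧
    (0 ≤ q.1 → 0 ≤ (D.hom D' q).1) ∧ (q.1 ≤ 0 → (D.hom D' q).1 ≤ 0) := by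
  have key : ∀ D D' : Dat, ∀ q : ℝ × ℝ, 0 < q.1 ^ 2 - (max q.2 0) ^ 3 → 0 ≤ q.1 →
      good (D.hR D' q) ∧ 0 < (D.hR D' q).1 := by
    intro D D' q h h0
    have h1 : 0 < sqc q.1 q.2 := Real.sqrt_pos.2 h
    have h2 := D.hR_sqc D' q
    have h3 : 0 < sqc (D.hR D' q).1 (D.hR D' q).2 := by
      rcases (sqc_nonneg (D.hR D' q).1 (D.hR D' q).2).eq_or_lt with e | e
      · have := (D.hp.K_eq_zero D'.hp strictMono_id (q := (sqc q.1 q.2, q.2)) h1.le).1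
          (by rw [← h2, ← e])
        simp only at this
        linarith
      · exact e
    refine ⟨Or.inl (Real.sqrt_pos.1 h3), ?_⟩
    refine lt_of_le_of_ne ((phi_nonneg _ _).trans (D.hR_ge D' q)) fun e => ?_
    rw [← e, sqc_zero] at h3
    exact lt_irrefl _ h3
  rcases h with h | ⟨h, h'⟩
  · rcases lt_trichotomy q.1 0 with h0 | h0 | h0
    · have hr : 0 < (rf q).1 ^ 2 - (max (rf q).2 0) ^ 3 := by simpa [rf] using h
      obtain ⟨k1, k2⟩ := key D.m D'.m (rf q) hr (by simp only [rf]; linarith)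
      have : q.1 ≤ -phi 0 q.2 := by
        have := phi_zero_lt hr (by simp only [rf]; linarith)
        simp only [rf] at this
        linarith
      rw [D.hom_left D' this]
      refine ⟨good_rf k1, fun _ => by linarith, fun _ => ?_⟩
      simp only [rf] at k2 ⊢
      linarith
    · exfalso
      have : 0 ≤ max q.2 0 := le_max_right _ _
      have : 0 ≤ max q.2 0 ^ 3 := by positivity
      rw [h0] at h
      linarith
    · obtain ⟨k1, k2⟩ := key D D' q h h0.le
      rw [D.hom_right D' (phi_zero_lt h h0.le).le]
      exact ⟨k1, fun _ => k2.le, fun _ => by linarith⟩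
  · have e : q.1 = phi 0 q.2 := by rw [h, phi_of_nonpos le_rfl h']
    rw [D.hom_right D' e.ge, D.hR_bd D' e]
    exact ⟨Or.inr ⟨h, h'⟩, id, id⟩

variable {a : ℝ} (ha : |a| = 1)

/-- Label of the leaf. -/
def L (q : ℝ × ℝ) : ℝ := (D.ok ha).lab (Sc q) q.2

theorem L_cont : Continuous (D.L ha) := (D.ok ha).lab_cont.comp (Sc_cont.prodMk continuous_snd)

theorem lab_m (ha' : |-a| = 1) (s y : ℝ) : (D.m.ok ha').lab (-s) y = (D.ok ha).lab s y := by
  have h : ∀ t, HasDerivAt (fun t => (D.ok ha).sol s y (-t))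
      (D.m.G (-a) t ((D.ok ha).sol s y (-t))) t := by
    intro t
    have h1 := ((D.ok ha).sol_deriv s y (-t)).scomp t (hasDerivAt_neg t)
    have e := D.G_m a (-t) ((D.ok ha).sol s y (-t))
    rw [neg_neg] at e
    rw [e]
    have h2 : HasDerivAt (fun t => (D.ok ha).sol s y (-t)) _ t := h1
    convert h2 using 1
    simp
  have := (D.m.ok ha').sol_unique h (-s)
  simp only [neg_neg, (D.ok ha).sol_init] at this
  rw [OdeOk.lab, this]
  simp only [neg_zero]
  rfl

theorem L_m (ha' : |-a| = 1) (q : ℝ × ℝ) : D.m.L ha' (rf q) = D.L ha q := by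
  rw [L, Sc_rf]
  exact D.lab_m ha ha' (Sc q) q.2

theorem hR_L {q : ℝ × ℝ} (h : phi 0 q.2 ≤ q.1) : D'.L ha (D.hR D' q) = D.L ha q := by
  have h0 : 0 ≤ q.1 := (phi_nonneg _ _).trans h
  have h0' : 0 ≤ (D.hR D' q).1 := (phi_nonneg _ _).trans (D.hR_ge D' q)
  have h1 := D.hp.K_labs D'.hp monotone_id (q := (sqc q.1 q.2, q.2)) (sqc_nonneg _ _)
  rw [← D.hR_sqc D' q] at h1
  rw [L, L, Sc, Sc, if_pos h0, if_pos h0']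
  have : a = 1 ∨ a = -1 := by
    rcases abs_choice a with e | e <;> rw [e] at ha
    · exact Or.inl ha
    · right; linarith
  rcases this with e | e
  · subst e
    exact congrArg Prod.fst h1
  · subst e
    exact congrArg Prod.snd h1

theorem hom_L {q : ℝ × ℝ} (h : good q) : D'.L ha (D.hom D' q) = D.L ha q := by
  have ha' : |-a| = 1 := by rwa [abs_neg]
  rcases h.cases with h1 | h1
  · rw [D.hom_right D' h1, D.hR_L D' ha h1]
  · rw [D.hom_left D' h1, ← D'.L_m ha ha', rf_rf, D.m.hR_L D'.m ha' (by simp only [rf]; linarith),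
      D.L_m ha ha']

theorem hom_zero : D.hom D' 0 = 0 := by
  have e : (0 : ℝ × ℝ).1 = phi 0 (0 : ℝ × ℝ).2 := by
    rw [phi_of_nonpos le_rfl (by simp)]; rfl
  rw [D.hom_right D' e.ge, D.hR_bd D' e]

end Dat

theorem max_cube (y : ℝ) : (max (-y) 0) ^ 3 = (max y 0) ^ 3 - y ^ 3 := by
  rcases le_total y 0 with h | h
  · rw [max_eq_left (by linarith), max_eq_right h]; ring
  · rw [max_eq_right (by linarith), max_eq_left h]; ring

theorem phi_neg_sq (s y : ℝ) : phi s (-y) ^ 2 = phi s y ^ 2 - y ^ 3 := by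
  rw [phi_sq, phi_sq, max_cube]; ring

theorem hasDerivAt_cube (y : ℝ) : HasDerivAt (fun y : ℝ => (max y 0) ^ 3) (3 * (max y 0) ^ 2) y := by
  rcases lt_trichotomy y 0 with h | h | h
  · rw [max_eq_right h.le]
    have : HasDerivAt (fun _ : ℝ => (0:ℝ)) 0 y := hasDerivAt_const _ _
    norm_num
    refine this.congr_of_eventuallyEq ?_
    filter_upwards [eventually_lt_nhds h] with z hz
    simp [max_eq_right hz.le]
  · subst h
    rw [hasDerivAt_iff_isLittleO]
    refine IsLittleO.of_bound fun c hc => ?_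
    filter_upwards [Metric.ball_mem_nhds (0:ℝ) (ε := min c 1) (by positivity)] with z hz
    rw [mem_ball_zero_iff, Real.norm_eq_abs, lt_min_iff] at hz
    simp
    have h1 : |max z 0| ≤ |z| := by
      rcases le_total z 0 with h | h <;> simp [h]
    have h2 : |max z 0| ^ 3 ≤ |z| ^ 3 := pow_le_pow_left₀ (abs_nonneg _) h1 3
    have h3 : |z| * |z| ≤ c * 1 := mul_le_mul hz.1.le hz.2.le (abs_nonneg _) hc.le
    nlinarith [abs_nonneg z]
  · rw [max_eq_left h.le]
    have : HasDerivAt (fun y : ℝ => y ^ 3) (3 * y ^ 2) y := by simpa using hasDerivAt_pow 3 y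
    refine this.congr_of_eventuallyEq ?_
    filter_upwards [eventually_gt_nhds h] with z hz
    simp [max_eq_left hz.le]

theorem Crv.m {D : Dat} {σ : ℝ} {x w dx dw : ℝ → ℝ} {I : Set ℝ} (h : Crv D σ x w dx dw I) :
    Crv D.m σ (fun t => -x t) w (fun t => -dx t) dw I := by
  refine ⟨h.o, h.oc, fun t ht => (h.hx t ht).neg, h.hw, h.cx.neg, h.cw, fun t ht => ?_,
    fun t ht => neg_ne_zero.2 (h.ne t ht), fun t ht => ?_⟩
  · have := h.box t ht
    simpa [Dat.box, Dat.m] using this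
  · have := h.eq t ht
    simpa [Dat.m] using this

namespace Dat
variable (D : Dat) {a : ℝ} (ha : |a| = 1)

theorem G_eq {s y : ℝ} (hs : 0 ≤ s) (hsr : s ≤ D.r) (hy : |y| ≤ D.r) : D.G a s y = D.G0 a s y := by
  have := abs_le.1 hy
  rw [G, if_pos hs, H, min_eq_left hsr, max_eq_right hs, min_eq_left this.2, max_eq_right this.1,
    max_eq_right (by linarith)]
  simp

theorem G_eq_neg {s y : ℝ} (hs : s < 0) (hsr : -s ≤ D.r) (hy : |y| ≤ D.r) :
    D.G a s y = -D.m.G0 (-a) (-s) y := by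
  have h := D.G_m a s y
  rw [D.m.G_eq (by linarith) hsr hy] at h
  linarith

theorem G_nonpos {x w : ℝ} (hx : |x| ≤ D.r) (hw : |w| ≤ D.r) (hw0 : w ≤ 0) :
    D.G a x w = D.μ (x, w) + a * (D.n (x, w) * √(x ^ 2 - w ^ 3)) := by
  have hx' := abs_le.1 hx
  have e : ∀ s, phi s (-w) = √(s ^ 2 - w ^ 3) := by
    intro s
    rw [phi, max_cube, max_eq_right hw0]
    congr 1
    ring
  rcases le_or_gt 0 x with h | h
  · rw [D.G_eq h hx'.2 hw, G0, kap, if_pos hw0, p, phi_of_nonpos h hw0, e, mul_one]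
  · rw [D.G_eq_neg h (by linarith) hw, G0, kap, if_pos hw0, p,
      phi_of_nonpos (by linarith : 0 ≤ -x) hw0, e]
    simp [Dat.m]
    ring

theorem L_right {x w dx dw : ℝ → ℝ} {I : Set ℝ} (h : Crv D (-1) x w dx dw I)
    (hx : ∀ t ∈ I, 0 < x t) (hpos : ∀ t ∈ I, 0 < (-1) * (w t ^ 3 - x t ^ 2))
    (hsl : ∀ t ∈ I, dw t = (D.μ (x t, w t) +
      a * (D.n (x t, w t) * √((-1) * (w t ^ 3 - x t ^ 2)))) * dx t) {t1 t2 : ℝ} (h1 : t1 ∈ I)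
    (h2 : t2 ∈ I) : D.L ha (x t1, w t1) = D.L ha (x t2, w t2) := by
  have hp : ∀ t ∈ I, 0 < x t ^ 2 - (max (w t) 0) ^ 3 := by
    intro t ht
    have h3 := hpos t ht
    have h4 := hx t ht
    rcases le_total (w t) 0 with h' | h'
    · rw [max_eq_right h']; simp; positivity
    · rw [max_eq_left h']; linarith
  have hS : ∀ t ∈ I, Sc (x t, w t) = √(x t ^ 2 - (max (w t) 0) ^ 3) := fun t ht => by
    rw [Sc, if_pos (hx t ht).le]; rfl
  have hcx := h.xcont
  have hcw := h.wcont
  have hcdx := h.cx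
  have hcdw := h.cw
  refine (D.ok ha).lab_const (s := fun t => Sc (x t, w t)) (y := w)
    (ds := fun t => (2 * x t * dx t - 3 * (max (w t) 0) ^ 2 * dw t) /
      (2 * √(x t ^ 2 - (max (w t) 0) ^ 3))) (dy := dw) h.oc ?_ h.hw ?_ ?_ h1 h2
  · intro t ht
    have d1 : HasDerivAt (fun t => x t ^ 2 - (max (w t) 0) ^ 3)
        (2 * x t * dx t - 3 * (max (w t) 0) ^ 2 * dw t) t := by
      have e1 := (h.hx t ht).pow 2
      have e2 := (hasDerivAt_cube (w t)).comp t (h.hw t ht)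
      have : HasDerivAt (fun t => x t ^ 2 - (max (w t) 0) ^ 3) _ t := e1.sub e2
      convert this using 1
      simp
    refine (d1.sqrt (hp t ht).ne').congr_of_eventuallyEq ?_
    filter_upwards [h.o.mem_nhds ht] with s hs using hS s hs
  · refine ContinuousOn.div (by fun_prop) (by fun_prop) fun t ht => ?_
    have := Real.sqrt_pos.2 (hp t ht)
    positivity
  · intro t ht
    have hb := h.box t ht
    simp only [box, mem_ofPred_eq] at hb
    have hb2 := abs_lt.1 hb.2
    have hx0 := hx t ht
    rw [abs_of_pos hx0] at hb
    set S := √(x t ^ 2 - (max (w t) 0) ^ 3) with hSd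
    have S0 : 0 < S := Real.sqrt_pos.2 (hp t ht)
    have S2 : S ^ 2 = x t ^ 2 - (max (w t) 0) ^ 3 := Real.sq_sqrt (hp t ht).le
    have hphi : phi S (w t) = x t := by
      rw [phi, S2, sub_add_cancel, Real.sqrt_sq hx0.le]
    have Sx : S ≤ x t := by rw [← hphi]; exact le_phi _
    have hphi2 : phi S (-w t) = √((-1) * (w t ^ 3 - x t ^ 2)) := by
      rw [phi, S2, max_cube]; congr 1; ring
    have hpp : D.p a S (w t) = D.μ (x t, w t) +
      a * (D.n (x t, w t) * √((-1) * (w t ^ 3 - x t ^ 2))) := by rw [p, hphi, hphi2]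
    have hs := hsl t ht
    rw [← hpp] at hs
    have hd := D.den_ge ha S0.le (by linarith) (by linarith : -D.r ≤ w t) (by linarith [D.r_le])
    rw [hphi] at hd
    rw [hS t ht, ← hSd, D.G_eq S0.le (by linarith) hb.2.le, G0, D.kap_eq S0.le (by rw [hphi]; exact hx0),
      hphi, hs]
    have hd' : x t - 3 / 2 * max (w t) 0 ^ 2 * D.p a S (w t) ≠ 0 := by linarith
    generalize D.p a S (w t) = P at *
    generalize max (w t) 0 = m at *
    rw [show 2 * x t * dx t - 3 * m ^ 2 * (P * dx t) = 2 * (x t - 3 / 2 * m ^ 2 * P) * dx t by ring]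
    generalize x t - 3 / 2 * m ^ 2 * P = d at *
    field_simp

theorem L_neg {x w dx dw : ℝ → ℝ} {I : Set ℝ} (h : Crv D (-1) x w dx dw I)
    (hw : ∀ t ∈ I, w t < 0)
    (hsl : ∀ t ∈ I, dw t = (D.μ (x t, w t) +
      a * (D.n (x t, w t) * √((-1) * (w t ^ 3 - x t ^ 2)))) * dx t) {t1 t2 : ℝ} (h1 : t1 ∈ I)
    (h2 : t2 ∈ I) : D.L ha (x t1, w t1) = D.L ha (x t2, w t2) := by
  have hS : ∀ t ∈ I, Sc (x t, w t) = x t := fun t ht => by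
    have : sqc (x t) (w t) = |x t| := by
      rw [sqc, max_eq_right (hw t ht).le]; simp [Real.sqrt_sq_eq_abs]
    rw [Sc]
    simp only [this]
    split_ifs with h0
    · exact abs_of_nonneg h0
    · rw [abs_of_neg (not_le.1 h0), neg_neg]
  rw [L, L, hS t1 h1, hS t2 h2]
  refine (D.ok ha).lab_const h.oc h.hx h.hw h.cx ?_ h1 h2
  intro t ht
  have hb := h.box t ht
  simp only [box, mem_ofPred_eq] at hb
  rw [hsl t ht, D.G_nonpos hb.1.le hb.2.le (hw t ht).le]
  congr 5
  ring

theorem L_const {x w dx dw : ℝ → ℝ} {I : Set ℝ} (h : Crv D (-1) x w dx dw I)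
    (hpos : ∀ t ∈ I, 0 < (-1) * (w t ^ 3 - x t ^ 2))
    (hsl : ∀ t ∈ I, dw t = (D.μ (x t, w t) +
      a * (D.n (x t, w t) * √((-1) * (w t ^ 3 - x t ^ 2)))) * dx t) {t1 t2 : ℝ} (h1 : t1 ∈ I)
    (h2 : t2 ∈ I) : D.L ha (x t1, w t1) = D.L ha (x t2, w t2) := by
  have ha' : |-a| = 1 := by rwa [abs_neg]
  refine eq_of_germ_isConstant_on (f := fun t => D.L ha (x t, w t)) (s := I) ?_ h.oc.isPreconnected h1 h2
  intro t ht
  have hI := h.o.mem_nhds ht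
  have cx := (h.hx t ht).continuousAt
  have cw := (h.hw t ht).continuousAt
  have main : ∀ P : ℝ → Prop, (∀ᶠ s in nhds t, P s) → (∀ J ⊆ I, Crv D (-1) x w dx dw J → (∀ s ∈ J, P s) →
      ∀ s ∈ J, ∀ s' ∈ J, D.L ha (x s, w s) = D.L ha (x s', w s')) →
      ((fun t => D.L ha (x t, w t) : ℝ → ℝ) : Germ (nhds t) ℝ).IsConstant := by
    intro P hP hJ
    obtain ⟨e, he, hb⟩ := Metric.mem_nhds_iff.1 (inter_mem hP hI)
    refine ⟨D.L ha (x t, w t), ?_⟩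
    filter_upwards [Metric.ball_mem_nhds t he] with s hs
    refine hJ (Metric.ball t e) (fun s hs => (hb hs).2) (h.sub Metric.isOpen_ball ?_ fun s hs => (hb hs).2)
      (fun s hs => (hb hs).1) s hs t (Metric.mem_ball_self he)
    rw [Real.ball_eq_Ioo]
    exact ordConnected_Ioo
  rcases lt_trichotomy (x t) 0 with h0 | h0 | h0
  · refine main _ (cx.eventually_lt continuousAt_const h0) fun J hJI hJ hP s hs s' hs' => ?_
    have := D.m.L_right ha' hJ.m (fun t ht => neg_pos.2 (hP t ht))
      (fun t ht => by simpa using hpos t (hJI ht)) (fun t ht => by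
        rw [hsl t (hJI ht)]
        simp [Dat.m]
        ring) hs hs'
    exact (D.L_m ha ha' (x s, w s)).symm.trans (this.trans (D.L_m ha ha' (x s', w s')))
  · have hw : w t < 0 := by
      have := hpos t ht
      rw [h0] at this
      by_contra hc
      push Not at hc
      have : 0 ≤ w t ^ 3 := by positivity
      linarith
    exact main _ (cw.eventually_lt continuousAt_const hw) fun J hJI hJ hP s hs s' hs' =>
      D.L_neg ha hJ hP (fun t ht => hsl t (hJI ht)) hs hs'
  · exact main _ (continuousAt_const.eventually_lt cx h0) fun J hJI hJ hP s hs s' hs' =>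
      D.L_right ha hJ hP (fun t ht => hpos t (hJI ht)) (fun t ht => hsl t (hJI ht)) hs hs'

end Dat

namespace Dat
variable (D : Dat)

theorem L_zero {a : ℝ} (ha : |a| = 1) : D.L ha ((0:ℝ), (0:ℝ)) = 0 := by
  rw [L, Sc, if_pos le_rfl, sqc_zero, OdeOk.lab_zero]

theorem abs_one {a : ℝ} (h : a = 1 ∨ a = -1) : |a| = 1 := by
  rcases h with h | h <;> simp [h]

theorem L_half {x w dx dw : ℝ → ℝ} {I : Set ℝ} (h : Crv D (-1) x w dx dw I) {t0 : ℝ} (ht0 : t0 ∈ I)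
    (h0 : x t0 = 0) (h0' : w t0 = 0) {S : Set ℝ} (hS : IsOpen S) (hSc : S.OrdConnected)
    (hn : t0 ∉ S) (hne : (nhdsWithin t0 S).NeBot) :
    ∃ (a : ℝ) (ha : |a| = 1), ∀ t ∈ I ∩ S, D.L ha (x t, w t) = 0 := by
  have hc := h.sub (J := I ∩ S) (h.o.inter hS) (h.oc.inter hSc) inter_subset_left
  have hpos : ∀ t ∈ I ∩ S, 0 < (-1) * (w t ^ 3 - x t ^ 2) := by
    intro t ht
    refine lt_of_le_of_ne (h.nonneg ht.1) fun e => ?_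
    have := h.zero_of_discr (Or.inr rfl) ht.1 (by linarith)
    have := h.inj ht.1 ht0 (this.1.trans h0.symm)
    exact hn (this ▸ ht.2)
  obtain ⟨a, ha, hsl⟩ := hc.exists_sign hpos
  refine ⟨a, abs_one ha, fun t ht => ?_⟩
  have c1 : ContinuousAt (fun t => D.L (abs_one ha) (x t, w t)) t0 :=
    (D.L_cont (abs_one ha)).continuousAt.comp
      ((h.hx t0 ht0).continuousAt.prodMk (h.hw t0 ht0).continuousAt)
  have c2 : Tendsto (fun t => D.L (abs_one ha) (x t, w t)) (nhdsWithin t0 S)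
      (nhds (D.L (abs_one ha) (x t0, w t0))) := c1.mono_left nhdsWithin_le_nhds
  rw [h0, h0', D.L_zero] at c2
  refine tendsto_nhds_unique (tendsto_const_nhds.congr' ?_) c2
  filter_upwards [self_mem_nhdsWithin, nhdsWithin_le_nhds (h.o.mem_nhds ht0)] with s hs hs'
  exact D.L_const (abs_one ha) hc hpos hsl ht ⟨hs', hs⟩

theorem exists_label {x w dx dw : ℝ → ℝ} {c d : ℝ} (h : Crv D (-1) x w dx dw (Ioo c d)) :
    ∃ (u a b : ℝ) (ha : |a| = 1) (hb : |b| = 1), (a = b ∨ u = 0) ∧ ∀ t ∈ Ioo c d,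
      (0 ≤ x t → D.L ha (x t, w t) = u) ∧ (x t ≤ 0 → D.L hb (x t, w t) = u) := by
  rcases le_or_gt d c with hcd | hcd
  · exact ⟨0, 1, 1, by simp, by simp, Or.inl rfl, by simp [Ioo_eq_empty (not_lt.2 hcd)]⟩
  by_cases hpos : ∀ t ∈ Ioo c d, 0 < (-1) * (w t ^ 3 - x t ^ 2)
  · obtain ⟨a, ha, hsl⟩ := h.exists_sign hpos
    obtain ⟨t0, ht0⟩ := nonempty_Ioo.2 hcd
    refine ⟨D.L (abs_one ha) (x t0, w t0), a, a, abs_one ha, abs_one ha, Or.inl rfl, fun t ht => ?_⟩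
    have := D.L_const (abs_one ha) h hpos hsl ht ht0
    exact ⟨fun _ => this, fun _ => this⟩
  · push Not at hpos
    obtain ⟨t0, ht0, hle⟩ := hpos
    have := h.nonneg ht0
    obtain ⟨h0, h0'⟩ := h.zero_of_discr (Or.inr rfl) ht0 (by linarith)
    obtain ⟨a, ha, hr⟩ := D.L_half h ht0 h0 h0' isOpen_Ioi ordConnected_Ioi (S := Ioi t0)
      (by simp) inferInstance
    obtain ⟨b, hb, hl⟩ := D.L_half h ht0 h0 h0' isOpen_Iio ordConnected_Iio (S := Iio t0)
      (by simp) inferInstance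
    have hr' : ∀ t ∈ Ioo c d, t0 ≤ t → D.L ha (x t, w t) = 0 := by
      intro t ht hle
      rcases hle.eq_or_lt with e | e
      · rw [← e, h0, h0', D.L_zero]
      · exact hr t ⟨ht, e⟩
    have hl' : ∀ t ∈ Ioo c d, t ≤ t0 → D.L hb (x t, w t) = 0 := by
      intro t ht hle
      rcases hle.eq_or_lt with e | e
      · rw [e, h0, h0', D.L_zero]
      · exact hl t ⟨ht, e⟩
    rcases h.xcont.strictMonoOn_of_injOn_Ioo hcd h.inj with hm | hm
    · refine ⟨0, a, b, ha, hb, Or.inr rfl, fun t ht => ⟨fun hx => hr' t ht ?_, fun hx => hl' t ht ?_⟩⟩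
      · rw [← h0] at hx; exact (hm.le_iff_le ht0 ht).1 hx
      · rw [← h0] at hx; exact (hm.le_iff_le ht ht0).1 hx
    · refine ⟨0, b, a, hb, ha, Or.inr rfl, fun t ht => ⟨fun hx => hl' t ht ?_, fun hx => hr' t ht ?_⟩⟩
      · rw [← h0] at hx; exact (hm.le_iff_ge ht0 ht).1 hx
      · rw [← h0] at hx; exact (hm.le_iff_ge ht ht0).1 hx

/-! Leaves are curves -/
variable {a : ℝ} (ha : |a| = 1)

theorem G0_eq (ha : |a| = 1) (s y : ℝ) : (D.G0 a s y - D.μ (phi s y, y) * D.kap a s y) ^ 2 =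
    D.n (phi s y, y) ^ 2 * (-1 * (y ^ 3 - phi s y ^ 2)) * D.kap a s y ^ 2 := by
  have h1 := phi_neg_sq s y
  have h2 : a ^ 2 = 1 := by rw [← sq_abs, ha, one_pow]
  rw [G0, p]
  calc _ = a ^ 2 * D.n (phi s y, y) ^ 2 * phi s (-y) ^ 2 * D.kap a s y ^ 2 := by ring
    _ = _ := by rw [h1, h2]; ring

theorem kap_pos (ha : |a| = 1) {s y : ℝ} (hs : 0 < s) (hsr : s ≤ D.r) (hy : |y| ≤ D.r) :
    0 < D.kap a s y := by
  have hX := (phi_pos_iff (y := y) hs.le).2 (Or.inl hs)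
  have := D.den_ge ha hs.le hsr (abs_le.1 hy).1 ((abs_le.1 hy).2.trans D.r_le)
  rw [D.kap_eq hs.le hX]
  exact div_pos hs (by linarith)

theorem phi_deriv (ha : |a| = 1) {Y : ℝ → ℝ} {s : ℝ} (hs : 0 < s) (hsr : s ≤ D.r) (hy : |Y s| ≤ D.r)
    (hd : HasDerivAt Y (D.G0 a s (Y s)) s) :
    HasDerivAt (fun s => phi s (Y s)) (D.kap a s (Y s)) s := by
  have hX := (phi_pos_iff (y := Y s) hs.le).2 (Or.inl hs)
  have hden := D.den_ge ha hs.le hsr (abs_le.1 hy).1 ((abs_le.1 hy).2.trans D.r_le)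
  have e1 := (hasDerivAt_id s).pow 2
  have e2 := (hasDerivAt_cube (Y s)).comp s hd
  have e3 : HasDerivAt (fun s => s ^ 2 + (max (Y s) 0) ^ 3) _ s := e1.add e2
  have e4 : HasDerivAt (fun s => phi s (Y s)) _ s :=
    e3.sqrt (by rw [← phi_sq]; positivity)
  convert e4 using 1
  rw [show √(s ^ 2 + max (Y s) 0 ^ 3) = phi s (Y s) from rfl, G0, D.kap_eq hs.le hX]
  simp
  have h3 : phi s (Y s) - 3 / 2 * max (Y s) 0 ^ 2 * D.p a s (Y s) ≠ 0 := by linarith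
  generalize D.p a s (Y s) = P at *
  generalize max (Y s) 0 = m at *
  generalize phi s (Y s) = f at *
  obtain ⟨d, hd'⟩ : ∃ d, d = f - 3 / 2 * m ^ 2 * P := ⟨_, rfl⟩
  rw [← hd'] at h3 ⊢
  have hf : f = d + 3 / 2 * m ^ 2 * P := by rw [hd']; ring
  rw [eq_div_iff (by positivity), div_mul_eq_mul_div, div_eq_iff h3, hf]
  field_simp

theorem kap_contAt (ha : |a| = 1) {Y : ℝ → ℝ} {s : ℝ} (hs : 0 < s) (hsr : s ≤ D.r) (hy : |Y s| ≤ D.r)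
    (hc : ContinuousAt Y s) : ContinuousAt (fun s => D.kap a s (Y s)) s := by
  have hX := (phi_pos_iff (y := Y s) hs.le).2 (Or.inl hs)
  have hden := D.den_ge ha hs.le hsr (abs_le.1 hy).1 ((abs_le.1 hy).2.trans D.r_le)
  have cc : ContinuousAt (fun s => (s, Y s)) s := continuousAt_id.prodMk hc
  have c1 : ContinuousAt (fun s => phi s (Y s)) s := phi_cont.continuousAt.comp cc
  have c2 : ContinuousAt (fun s => D.p a s (Y s)) s := (D.p_cont a).continuousAt.comp cc
  have c3 : ContinuousAt (fun s => s / (phi s (Y s) - 3 / 2 * (max (Y s) 0) ^ 2 * D.p a s (Y s))) s :=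
    continuousAt_id.div (c1.sub ((continuousAt_const.mul ((hc.max continuousAt_const).pow 2)).mul c2))
      (by linarith)
  refine c3.congr ?_
  filter_upwards [eventually_gt_nhds hs] with t ht
  rw [D.kap_eq ht.le ((phi_pos_iff ht.le).2 (Or.inl ht))]

theorem near0 (ha : |a| = 1) {s y : ℝ} (hs : 0 ≤ s) (hsr : s ≤ D.r) (hy : |y| ≤ D.r)
    (h : y ≤ 0 ∨ |y| ≤ 2 * s) : |D.kap a s y - 1| ≤ 10 * s ∧ |phi s y - s| ≤ 10 * s ^ 2 := by
  rcases le_or_gt y 0 with h0 | h0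
  · rw [kap, if_pos h0, phi_of_nonpos hs h0]
    simp
    exact ⟨hs, sq_nonneg s⟩
  have h1 : y ≤ 2 * s := by
    rcases h with h | h
    · linarith
    · exact (le_abs_self y).trans h
  have s0 : 0 < s := by linarith
  have hX := (phi_pos_iff (y := y) hs).2 (Or.inl s0)
  have hden := D.den_ge ha hs hsr (abs_le.1 hy).1 ((abs_le.1 hy).2.trans D.r_le)
  have hp := abs_le.1 (D.p_le ha hs hsr (abs_le.1 hy).1)
  have h2 := phi_sq s y
  have h3 := le_phi (s := s) y
  have h4 : y ^ 3 ≤ 8 * s ^ 3 := by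
    have := pow_le_pow_left₀ h0.le h1 3
    nlinarith
  have h5 : phi s y ≤ s + 4 * s ^ 2 := by
    refine abs_le_of_sq_le_sq' ?_ (by positivity) |>.2
    rw [h2, max_eq_left h0.le]
    nlinarith [sq_nonneg (s ^ 2)]
  constructor
  · rw [D.kap_eq hs hX]
    rw [max_eq_left h0.le] at hden ⊢
    have hd : 0 < phi s y - 3 / 2 * y ^ 2 * D.p a s y := by linarith
    have h6 : y ^ 2 ≤ 4 * s ^ 2 := by nlinarith
    have h7 : |3 / 2 * y ^ 2 * D.p a s y| ≤ 6 / 10 * s ^ 2 := by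
      rw [abs_mul, abs_of_nonneg (by positivity)]
      have := D.p_le ha hs hsr (abs_le.1 hy).1
      nlinarith [abs_nonneg (D.p a s y), sq_nonneg y]
    have h8 := abs_le.1 h7
    rw [div_sub_one hd.ne', abs_div, abs_of_pos hd, div_le_iff₀ hd, abs_le]
    constructor <;> nlinarith
  · rw [abs_of_nonneg (by linarith)]
    nlinarith [sq_nonneg s]

end Dat

namespace Dat
variable (D : Dat)

/-- Leaf -/
def lY {a b : ℝ} (ha : |a| = 1) (hb : |b| = 1) (u s : ℝ) : ℝ :=
  if 0 ≤ s then (D.ok ha).sol 0 u s else (D.ok hb).sol 0 u s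
def ldY {a b : ℝ} (ha : |a| = 1) (hb : |b| = 1) (u s : ℝ) : ℝ :=
  if 0 ≤ s then D.G a s ((D.ok ha).sol 0 u s) else D.G b s ((D.ok hb).sol 0 u s)
def ldX {a b : ℝ} (ha : |a| = 1) (hb : |b| = 1) (u s : ℝ) : ℝ :=
  if 0 ≤ s then D.kap a s ((D.ok ha).sol 0 u s) else D.m.kap (-b) (-s) ((D.ok hb).sol 0 u s)

variable {a b : ℝ} (ha : |a| = 1) (hb : |b| = 1) (u : ℝ)

theorem G_zero_eq (hab : a = b ∨ u = 0) : D.G a 0 u = D.G b 0 u := by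
  rcases hab with h | h
  · rw [h]
  · subst h
    have h0 : |(0:ℝ)| ≤ D.r := by simpa using D.r_pos.le
    rw [D.G_eq le_rfl D.r_pos.le h0, D.G_eq le_rfl D.r_pos.le h0, G0, G0, D.p_zero, D.p_zero]
    simp

theorem lY_zero : D.lY ha hb u 0 = u := by rw [lY, if_pos le_rfl, OdeOk.sol_init]

theorem lY_cont : Continuous (D.lY ha hb u) := by
  refine Continuous.if_le ((D.ok ha).sol_cont _ _) ((D.ok hb).sol_cont _ _) continuous_const
    continuous_id ?_
  rintro s rfl
  simp [OdeOk.sol_init]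

theorem ldY_cont (hab : a = b ∨ u = 0) : Continuous (D.ldY ha hb u) := by
  refine Continuous.if_le ((D.ok ha).cont.comp (continuous_id.prodMk ((D.ok ha).sol_cont _ _)))
    ((D.ok hb).cont.comp (continuous_id.prodMk ((D.ok hb).sol_cont _ _))) continuous_const
    continuous_id ?_
  rintro s rfl
  simp [OdeOk.sol_init]
  exact D.G_zero_eq u hab

theorem lY_deriv (hab : a = b ∨ u = 0) (s : ℝ) : HasDerivAt (D.lY ha hb u) (D.ldY ha hb u s) s := by
  rcases lt_trichotomy s 0 with h | h | h
  · rw [ldY, if_neg (not_le.2 h)]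
    refine ((D.ok hb).sol_deriv 0 u s).congr_of_eventuallyEq ?_
    filter_upwards [eventually_lt_nhds h] with t ht
    rw [lY, if_neg (not_le.2 ht)]
  · subst h
    rw [ldY, if_pos le_rfl]
    have h1 : HasDerivWithinAt (D.lY ha hb u) (D.G a 0 ((D.ok ha).sol 0 u 0)) (Ici 0) 0 := by
      refine ((D.ok ha).sol_deriv 0 u 0).hasDerivWithinAt.congr (fun t ht => ?_) ?_
      · rw [lY, if_pos (show 0 ≤ t from ht)]
      · rw [lY, if_pos le_rfl]
    have h2 : HasDerivWithinAt (D.lY ha hb u) (D.G a 0 ((D.ok ha).sol 0 u 0)) (Iic 0) 0 := by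
      rw [OdeOk.sol_init, D.G_zero_eq u hab]
      have := ((D.ok hb).sol_deriv 0 u 0).hasDerivWithinAt (s := Iic 0)
      rw [OdeOk.sol_init] at this
      refine this.congr (fun t ht => ?_) ?_
      · rcases (show t ≤ 0 from ht).eq_or_lt with e | e
        · rw [e, lY, if_pos le_rfl, OdeOk.sol_init, OdeOk.sol_init]
        · rw [lY, if_neg (not_le.2 e)]
      · rw [lY, if_pos le_rfl, OdeOk.sol_init, OdeOk.sol_init]
    have := h1.union h2
    rwa [Ici_union_Iic, hasDerivWithinAt_univ] at this
  · rw [ldY, if_pos h.le]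
    refine ((D.ok ha).sol_deriv 0 u s).congr_of_eventuallyEq ?_
    filter_upwards [eventually_gt_nhds h] with t ht
    rw [lY, if_pos ht.le]

theorem le_abs_Phi (s y : ℝ) : |s| ≤ |Phi s y| := by
  rw [Phi]
  split_ifs with h
  · rw [abs_of_nonneg h, abs_of_nonneg (phi_nonneg _ _)]; exact le_phi _
  · rw [abs_neg, abs_of_nonneg (phi_nonneg _ _), abs_of_neg (not_le.1 h)]; exact le_phi _

theorem lnear {u : ℝ} (hu : u ≤ 0) (hur : |u| < D.r) : ∀ᶠ s in nhds (0:ℝ),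
    |D.ldX ha hb u s - 1| ≤ 10 * |s| ∧ |Phi s (D.lY ha hb u s) - s| ≤ 10 * s ^ 2 := by
  have hc := D.lY_cont ha hb u
  have e1 : ∀ᶠ s in nhds (0:ℝ), |D.lY ha hb u s| < D.r :=
    hc.abs.continuousAt.eventually_lt continuousAt_const (by simpa [lY_zero] using hur)
  have e2 : ∀ᶠ s in nhds (0:ℝ), |s| < D.r :=
    continuous_abs.continuousAt.eventually_lt continuousAt_const (by simpa using D.r_pos)
  have e3 : ∀ᶠ s in nhds (0:ℝ), D.lY ha hb u s ≤ 0 ∨ |D.lY ha hb u s| ≤ 2 * |s| := by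
    rcases hu.eq_or_lt with h | h
    · subst h
      refine Eventually.of_forall fun s => Or.inr ?_
      rw [lY]
      split_ifs
      · have := (D.ok ha).sol_lip 0 0 0 s
        simpa [OdeOk.sol_init] using this
      · have := (D.ok hb).sol_lip 0 0 0 s
        simpa [OdeOk.sol_init] using this
    · have : ∀ᶠ s in nhds (0:ℝ), D.lY ha hb u s < 0 :=
        hc.continuousAt.eventually_lt continuousAt_const (by simpa [lY_zero] using h)
      exact this.mono fun s hs => Or.inl hs.le
  filter_upwards [e1, e2, e3] with s h1 h2 h3
  rcases le_or_gt 0 s with h | h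
  · rw [abs_of_nonneg h] at *
    rw [lY, if_pos h] at *
    rw [ldX, if_pos h, Phi, if_pos h]
    exact D.near0 ha h h2.le h1.le h3
  · rw [abs_of_neg h] at *
    rw [lY, if_neg (not_le.2 h)] at *
    rw [ldX, if_neg (not_le.2 h), Phi, if_neg (not_le.2 h)]
    have := D.m.near0 (a := -b) (by simpa using hb) (by linarith : 0 ≤ -s) h2.le h1.le h3
    refine ⟨this.1, ?_⟩
    have h5 := this.2
    rw [neg_sq] at h5
    rwa [show -phi (-s) ((D.ok hb).sol 0 u s) - s = -(phi (-s) ((D.ok hb).sol 0 u s) - -s) by ring,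
      abs_neg]

theorem leaf_crv {c d : ℝ} (hab : a = b ∨ u = 0)
    (hbox : ∀ s ∈ Ioo c d, (Phi s (D.lY ha hb u s), D.lY ha hb u s) ∈ D.box)
    (hu : (0:ℝ) ∈ Ioo c d → u ≤ 0) :
    Crv D (-1) (fun s => Phi s (D.lY ha hb u s)) (D.lY ha hb u) (D.ldX ha hb u) (D.ldY ha hb u)
      (Ioo c d) := by
  have hbb : |-b| = 1 := by simpa using hb
  have key : ∀ s ∈ Ioo c d, HasDerivAt (fun s => Phi s (D.lY ha hb u s)) (D.ldX ha hb u s) s ∧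
      ContinuousAt (D.ldX ha hb u) s ∧ D.ldX ha hb u s ≠ 0 ∧
      (D.ldY ha hb u s - D.μ (Phi s (D.lY ha hb u s), D.lY ha hb u s) * D.ldX ha hb u s) ^ 2 =
    D.n (Phi s (D.lY ha hb u s), D.lY ha hb u s) ^ 2 *
     (-1 * (D.lY ha hb u s ^ 3 - Phi s (D.lY ha hb u s) ^ 2)) * D.ldX ha hb u s ^ 2 := by
    intro s hs
    obtain ⟨b1, b2⟩ := hbox s hs
    simp only at b1 b2
    have b3 := (le_abs_Phi s (D.lY ha hb u s)).trans b1.le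
    rcases lt_trichotomy s 0 with h | h | h
    · have E : ∀ᶠ t in nhds s, t < 0 := eventually_lt_nhds h
      rw [abs_of_neg h] at b3
      have hY : ∀ t < 0, D.lY ha hb u t = (D.ok hb).sol 0 u t := fun t ht => by
        rw [lY, if_neg (not_le.2 ht)]
      have hX : ∀ t < 0, D.ldX ha hb u t = D.m.kap (-b) (-t) ((D.ok hb).sol 0 u t) := fun t ht => by
        rw [ldX, if_neg (not_le.2 ht)]
      rw [hY s h] at b2
      have hd : HasDerivAt (fun t => (D.ok hb).sol 0 u (-t))
          (D.m.G0 (-b) (-s) ((D.ok hb).sol 0 u (- -s))) (-s) := by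
        have := (D.ok hb).sol_deriv 0 u s
        rw [D.G_eq_neg h b3 b2.le] at this
        rw [show D.m.G0 (-b) (-s) ((D.ok hb).sol 0 u (- -s)) =
          (-1 : ℝ) • -D.m.G0 (-b) (-s) ((D.ok hb).sol 0 u s) by simp]
        exact HasDerivAt.scomp (-s) (h := fun t => -t) (by rw [neg_neg]; exact this)
          (hasDerivAt_neg (-s))
      have hpd := D.m.phi_deriv hbb (neg_pos.2 h) b3 (by rw [neg_neg]; exact b2.le) hd
      have hkc := D.m.kap_contAt hbb (Y := fun t => (D.ok hb).sol 0 u (-t)) (neg_pos.2 h) b3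
        
        (by rw [neg_neg]; exact b2.le) (hd.continuousAt)
      refine ⟨?_, ?_, ?_, ?_⟩
      · have t4 := (hpd.scomp s (hasDerivAt_neg s)).neg
        refine (t4.congr_of_eventuallyEq ?_).congr_deriv ?_
        · filter_upwards [E] with t ht
          simp [Phi, not_le.2 ht, hY t ht]
        · rw [hX s h]; simp
      · have t5 := hkc.comp (f := fun t : ℝ => -t) (x := s) continuous_neg.continuousAt
        refine t5.congr ?_
        filter_upwards [E] with t ht
        simp [hX t ht]
      · rw [hX s h]
        exact (D.m.kap_pos hbb (neg_pos.2 h) b3 b2.le).ne'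
      · rw [hX s h, hY s h, Phi, if_neg (not_le.2 h), ldY, if_neg (not_le.2 h),
          D.G_eq_neg h b3 b2.le]
        have := D.m.G0_eq hbb (-s) ((D.ok hb).sol 0 u s)
        simp only [Dat.m] at this ⊢
        linear_combination this
    · subst h
      have hu' := hu hs
      rw [lY_zero] at b2
      have hn := D.lnear ha hb hu' b2
      have h0 := hn.self_of_nhds
      simp at h0
      rw [lY_zero] at h0 ⊢
      have hd1 : D.ldX ha hb u 0 = 1 := by linarith [h0.1]
      have hp0 : Phi 0 u = 0 := h0.2
      refine ⟨?_, ?_, ?_, ?_⟩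
      · rw [hd1, hasDerivAt_iff_isLittleO]
        refine IsLittleO.of_bound fun c hc => ?_
        filter_upwards [hn, Metric.ball_mem_nhds (0:ℝ) (ε := c / 10) (by positivity)] with t ht ht2
        rw [mem_ball_zero_iff, Real.norm_eq_abs] at ht2
        simp [lY_zero, hp0]
        refine ht.2.trans ?_
        rw [← sq_abs]
        nlinarith [abs_nonneg t]
      · rw [ContinuousAt, hd1, tendsto_iff_dist_tendsto_zero]
        refine squeeze_zero' (g := fun t : ℝ => 10 * |t|) (Eventually.of_forall fun _ => dist_nonneg)
          (hn.mono fun t ht => ht.1) ?_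
        have : Continuous (fun t : ℝ => 10 * |t|) := by fun_prop
        simpa using this.tendsto 0
      · rw [hd1]; exact one_ne_zero
      · have hg := D.G0_eq ha 0 u
        rw [hd1, hp0, ldY, if_pos le_rfl, OdeOk.sol_init, D.G_eq le_rfl D.r_pos.le b2.le]
        have hk : D.kap a 0 u = 1 := by
          rw [ldX, if_pos le_rfl, OdeOk.sol_init] at hd1; exact hd1
        have hph : phi 0 u = 0 := by rw [Phi, if_pos le_rfl] at hp0; exact hp0
        rw [hk, hph] at hg
        exact hg
    · have E : ∀ᶠ t in nhds s, 0 < t := eventually_gt_nhds h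
      rw [abs_of_pos h] at b3
      have hY : ∀ t, 0 < t → D.lY ha hb u t = (D.ok ha).sol 0 u t := fun t ht => by
        rw [lY, if_pos ht.le]
      have hX : ∀ t, 0 < t → D.ldX ha hb u t = D.kap a t ((D.ok ha).sol 0 u t) := fun t ht => by
        rw [ldX, if_pos ht.le]
      rw [hY s h] at b2
      have hd := (D.ok ha).sol_deriv 0 u s
      rw [D.G_eq h.le b3 b2.le] at hd
      have hpd := D.phi_deriv ha h b3 b2.le hd
      have hkc := D.kap_contAt ha h b3 b2.le hd.continuousAt
      refine ⟨?_, ?_, ?_, ?_⟩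
      · rw [hX s h]
        refine hpd.congr_of_eventuallyEq ?_
        filter_upwards [E] with t ht
        rw [hY t ht, Phi, if_pos ht.le]
      · refine hkc.congr ?_
        filter_upwards [E] with t ht
        rw [hX t ht]
      · rw [hX s h]
        exact (D.kap_pos ha h b3 b2.le).ne'
      · rw [hX s h, hY s h, Phi, if_pos h.le, ldY, if_pos h.le, D.G_eq h.le b3 b2.le]
        exact D.G0_eq ha s _
  exact ⟨isOpen_Ioo, ordConnected_Ioo, fun s hs => (key s hs).1,
    fun s _ => D.lY_deriv ha hb u hab s, fun s hs => (key s hs).2.1.continuousWithinAt,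
    (D.ldY_cont ha hb u hab).continuousOn, hbox, fun s hs => (key s hs).2.2.1,
    fun s hs => (key s hs).2.2.2⟩

theorem crv_good {D : Dat} {x w dx dw : ℝ → ℝ} {I : Set ℝ} (h : Crv D (-1) x w dx dw I) {t : ℝ}
    (ht : t ∈ I) : good (x t, w t) := by
  have h1 := h.nonneg ht
  rcases h1.eq_or_lt with e | e
  · obtain ⟨h2, h3⟩ := h.zero_of_discr (Or.inr rfl) ht (by linarith)
    exact Or.inr ⟨h2, h3.le⟩
  · rcases le_total (w t) 0 with h4 | h4
    · by_cases h5 : x t = 0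
      · exact Or.inr ⟨h5, h4⟩
      · left
        simp only [max_eq_right h4]
        have := sq_pos_of_ne_zero h5
        simpa using this
    · left
      simp only [max_eq_left h4]
      linarith

theorem image_neg (D' : Dat) {ω Ω : (ℝ × ℝ) → (ℝ × ℝ) → ℝ} (h : D.Rep (-1) ω) (h' : D'.Rep (-1) Ω)
    (γ : ℝ → ℝ × ℝ) (I : Set ℝ) (hγ : IsIntegralCurveOnBDE ω γ I) (hm : MapsTo γ I D.box)
    (hm' : MapsTo (fun t => D.hom D' (γ t)) I D'.box) :
    ∃ σ J, IsIntegralCurveOnBDE Ω σ J ∧ (fun t => D.hom D' (γ t)) '' I = σ '' J := by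
  obtain ⟨dx, dw, hc⟩ := h.crv hγ hm
  obtain ⟨⟨p, q, rfl⟩, -⟩ := hγ
  obtain ⟨u, a, b, ha, hb, hab, hl⟩ := D.exists_label hc
  have hg : ∀ t ∈ Ioo p q, good (γ t) := fun t ht => crv_good hc ht
  have hg' : ∀ t ∈ Ioo p q, good (D.hom D' (γ t)) := fun t ht => (D.hom_good D' (hg t ht)).1
  set S := fun t => Sc (D.hom D' (γ t)) with hS
  have hw : ∀ t ∈ Ioo p q, (D.hom D' (γ t)).2 = D'.lY ha hb u (S t) := by
    intro t ht
    have hx := (D.hom_good D' (hg t ht)).2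
    have e : ∀ {a : ℝ} (ha : |a| = 1), D.L ha (γ t) = u →
        (D.hom D' (γ t)).2 = (D'.ok ha).sol 0 u (S t) := by
      intro a ha h
      rw [← h, ← D.hom_L D' ha (hg t ht), L, OdeOk.sol_lab]
    rw [lY]
    split_ifs with h0
    · rcases le_total 0 (γ t).1 with h1 | h1
      · exact e ha ((hl t ht).1 h1)
      · have h3 : (γ t).1 = 0 ∨ (γ t).1 < 0 := by
          rcases h1.eq_or_lt with h | h
          · exact Or.inl h
          · exact Or.inr h
        rcases h3 with h3 | h3
        · exact e ha ((hl t ht).1 h3.ge)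
        · have hz := (D'.hom_hom D (γ t)) 
          have hS0 : S t = 0 := by
            refine le_antisymm ?_ h0
            have := hx.2 h1
            simp only [hS, Sc]
            split_ifs with h4
            · rw [le_antisymm this h4, sqc_zero]
            · simpa using sqc_nonneg _ _
          have h2 := e hb ((hl t ht).2 h1)
          rw [h2, hS0, OdeOk.sol_init, OdeOk.sol_init]
    · have h1 : (γ t).1 ≤ 0 := by
        by_contra h1
        push Not at h1
        have := hx.1 h1.le
        apply h0
        simp only [hS, Sc, if_pos this]
        exact sqc_nonneg _ _
      exact e hb ((hl t ht).2 h1)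
  have hx' : ∀ t ∈ Ioo p q, Phi (S t) (D'.lY ha hb u (S t)) = (D.hom D' (γ t)).1 := by
    intro t ht
    rw [← hw t ht]
    exact (hg' t ht).Phi
  have he : ∀ t ∈ Ioo p q, D.hom D' (γ t) = (Phi (S t) (D'.lY ha hb u (S t)), D'.lY ha hb u (S t)) :=
    fun t ht => Prod.ext (hx' t ht).symm (hw t ht)
  have hcont : ContinuousOn S (Ioo p q) := by
    have : ContinuousOn γ (Ioo p q) := hc.xcont.prodMk hc.wcont
    exact (Sc_cont.comp (D.hom_cont D')).comp_continuousOn this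
  have hinj : InjOn S (Ioo p q) := by
    intro t1 h1 t2 h2 e
    apply hc.inj h1 h2
    have : D.hom D' (γ t1) = D.hom D' (γ t2) := by rw [he t1 h1, he t2 h2, e]
    have := congrArg (D'.hom D) this
    rw [D.hom_hom, D.hom_hom] at this
    simp [this]
  obtain ⟨c, d, hcd⟩ := image_Ioo_of_inj (B := D'.r) hcont hinj fun t ht => by
    have h1 := (hm' ht).1
    simp only at h1
    rw [← hx' t ht] at h1
    exact (le_abs_Phi _ _).trans h1.le
  have hL := D'.leaf_crv ha hb u (c := c) (d := d) hab ?_ ?_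
  · refine ⟨_, _, h'.curve hL, ?_⟩
    rw [← hcd, image_image]
    exact image_congr he
  · rw [← hcd]
    rintro _ ⟨t, ht, rfl⟩
    rw [← he t ht]
    exact hm' ht
  · rw [← hcd]
    rintro ⟨t, ht, h0⟩
    have h1 := hw t ht
    rw [h0, lY_zero] at h1
    have h2 := hx' t ht
    rw [h0, lY_zero] at h2
    rcases hg' t ht with h3 | h3
    · exfalso
      rw [h1, ← h2, Phi, if_pos le_rfl, phi_sq] at h3
      simp at h3
    · linarith [h3.2]

theorem topEquiv_neg (D D' : Dat) {ω Ω : (ℝ × ℝ) → (ℝ × ℝ) → ℝ} (h : D.Rep (-1) ω)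
    (h' : D'.Rep (-1) Ω) : TopEquivAt0 ω Ω :=
  topEquiv_of_global D.box_open D'.box_open D.box_zero D'.box_zero (D.hom_cont D') (D'.hom_cont D)
    (fun x => D'.hom_hom D x) (fun x => D.hom_hom D' x) (D.hom_zero D')
    (fun γ I h1 h2 h3 => D.image_neg D' h h' γ I h1 h2 h3)
    (fun γ I h1 h2 h3 => D'.image_neg D h' h γ I h1 h2 h3)

end Dat

theorem exp_lip {a b : ℝ} (ha : a ≤ 0) (hb : b ≤ 0) : |Real.exp a - Real.exp b| ≤ |a - b| := by
  wlog h : b ≤ a generalizing a b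
  · rw [abs_sub_comm, abs_sub_comm a]; exact this hb ha (le_of_not_ge h)
  rw [abs_of_nonneg (sub_nonneg.2 (Real.exp_le_exp.2 h)), abs_of_nonneg (by linarith)]
  have h1 : Real.exp b = Real.exp a * Real.exp (b - a) := by rw [← Real.exp_add]; congr 1; ring
  have h2 := Real.add_one_le_exp (b - a)
  have h3 := Real.exp_le_one_iff.2 ha
  have h4 := Real.exp_pos a
  rw [h1]
  nlinarith

/-- clamp to `[0,2]` -/
def cl (s : ℝ) : ℝ := max 0 (min s 2)
theorem cl_mem (s : ℝ) : 0 ≤ cl s ∧ cl s ≤ 2 := ⟨le_max_left _ _, max_le zero_le_two (min_le_right _ _)⟩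
theorem cl_of {s : ℝ} (h0 : 0 ≤ s) (h2 : s ≤ 2) : cl s = s := by
  rw [cl, min_eq_left h2, max_eq_right h0]
theorem cl_cont : Continuous cl := by unfold cl; fun_prop

namespace Dat
variable (D : Dat)

/-- clamped square root of `w` -/
def hq (l : ℝ) : ℝ := Real.exp (min l (Real.log D.r) / 2)
/-- slope in the horn -/
def hpp (a t q : ℝ) : ℝ :=
  D.μ (t * q ^ 3, q ^ 2) + a * (D.n (t * q ^ 3, q ^ 2) * (q ^ 3 * √(1 - t ^ 2)))
def HG (a s l : ℝ) : ℝ :=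
  D.hpp a (cl s - 1) (D.hq l) * D.hq l /
    (1 - 3 / 2 * (cl s - 1) * (D.hpp a (cl s - 1) (D.hq l) * D.hq l)) + a * min (max (s - 2) 0) 1

theorem hq_pos (l : ℝ) : 0 < D.hq l := Real.exp_pos _
theorem logr : Real.log D.r ≤ 0 := Real.log_nonpos D.r_pos.le D.r_le
theorem hq_sq (l : ℝ) : D.hq l ^ 2 ≤ D.r := by
  rw [hq, ← Real.exp_nat_mul]
  push_cast
  rw [mul_div_cancel₀ _ (two_ne_zero), ← Real.le_log_iff_exp_le D.r_pos]
  exact min_le_right _ _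
theorem hq_le (l : ℝ) : D.hq l ≤ 1 := by
  have := D.hq_sq l
  have := D.r_le
  have := D.hq_pos l
  nlinarith
theorem hq_lip (l1 l2 : ℝ) : |D.hq l1 - D.hq l2| ≤ |l1 - l2| := by
  have := D.logr
  have h1 := min_le_right l1 (Real.log D.r)
  have h2 := min_le_right l2 (Real.log D.r)
  refine (exp_lip (by linarith) (by linarith)).trans ?_
  rw [← sub_div, abs_div, abs_two]
  have := abs_inf_sub_inf_le_abs l1 l2 (Real.log D.r)
  have h3 := abs_nonneg (l1 - l2)
  have h4 : |min l1 (Real.log D.r) - min l2 (Real.log D.r)| ≤ |l1 - l2| := this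
  linarith
theorem hq_cont : Continuous D.hq := by unfold hq; fun_prop
theorem hq_eq {w : ℝ} (h0 : 0 < w) (h : w ≤ D.r) : D.hq (Real.log w) = √w := by
  rw [hq, min_eq_left (Real.log_le_log h0 h), ← Real.log_sqrt h0.le, Real.exp_log (Real.sqrt_pos.2 h0)]

theorem hpp_cont (a : ℝ) : Continuous fun q : ℝ × ℝ => D.hpp a q.1 q.2 := by
  have h1 : Continuous fun q : ℝ × ℝ => (q.1 * q.2 ^ 3, q.2 ^ 2) := by fun_prop
  have h2 := D.μ_cont.comp h1
  have h3 := D.n_cont.comp h1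
  exact h2.add (continuous_const.mul (h3.mul (by fun_prop)))

variable {a : ℝ} (ha : |a| = 1)
include ha

theorem sqrt_le1 (t : ℝ) : √(1 - t ^ 2) ≤ 1 := by
  exact Real.sqrt_le_iff.2 ⟨zero_le_one, by nlinarith [sq_nonneg t]⟩

theorem hpp_le {t q : ℝ} (q0 : 0 ≤ q) (q1 : q ≤ 1) (qr : q ^ 2 ≤ D.r) : |D.hpp a t q| ≤ 1 / 10 := by
  refine (abs_add_le _ _).trans ?_
  have h1 := D.μ_le (t * q ^ 3, q ^ 2)
  have h2 := D.n_pos (t * q ^ 3, q ^ 2)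
  have h3 := D.n_le (t * q ^ 3, q ^ 2)
  have h4 := sqrt_le1 ha t
  have h5 := Real.sqrt_nonneg (1 - t ^ 2)
  have h6 : q ^ 3 * √(1 - t ^ 2) ≤ D.r := by
    have : q ^ 3 ≤ q ^ 2 := pow_le_pow_of_le_one q0 q1 (by norm_num)
    have : q ^ 3 * √(1 - t ^ 2) ≤ q ^ 3 * 1 := mul_le_mul_of_nonneg_left h4 (by positivity)
    linarith
  rw [abs_mul, ha, one_mul, abs_of_nonneg (by positivity : 0 ≤ D.n (t * q ^ 3, q ^ 2) * (q ^ 3 * √(1 - t ^ 2)))]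
  have := mul_le_mul h3 h6 (by positivity) D.M_pos.le
  linarith [D.Mr]

theorem hpp_lip {t q q' : ℝ} (t0 : -1 ≤ t) (t1 : t ≤ 1) (q0 : 0 ≤ q) (q1 : q ≤ 1) (q0' : 0 ≤ q') (q1' : q' ≤ 1) :
    |D.hpp a t q - D.hpp a t q'| ≤ (10 * D.K + 3 * D.M) * |q - q'| := by
  have hc : |q ^ 3 - q' ^ 3| ≤ 3 * |q - q'| := by
    rw [show q ^ 3 - q' ^ 3 = (q ^ 2 + q * q' + q' ^ 2) * (q - q') by ring, abs_mul,
      abs_of_nonneg (by positivity)]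
    exact mul_le_mul_of_nonneg_right (by nlinarith) (abs_nonneg _)
  have hs : |q ^ 2 - q' ^ 2| ≤ 2 * |q - q'| := by
    rw [show q ^ 2 - q' ^ 2 = (q + q') * (q - q') by ring, abs_mul, abs_of_nonneg (by positivity)]
    exact mul_le_mul_of_nonneg_right (by linarith) (abs_nonneg _)
  have ht : |t * q ^ 3 - t * q' ^ 3| ≤ 3 * |q - q'| := by
    rw [← mul_sub, abs_mul]
    have : |t| ≤ 1 := abs_le.2 ⟨t0, t1⟩
    nlinarith [abs_nonneg t, abs_nonneg (q ^ 3 - q' ^ 3)]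
  have hK := D.K_nonneg
  have h1 : |D.μ (t * q ^ 3, q ^ 2) - D.μ (t * q' ^ 3, q' ^ 2)| ≤ 5 * D.K * |q - q'| := by
    refine (D.μ_lip _ _).trans ?_
    have := mul_le_mul_of_nonneg_left (add_le_add ht hs) hK
    simp only at this ⊢
    linarith
  have h2 : |D.n (t * q ^ 3, q ^ 2) - D.n (t * q' ^ 3, q' ^ 2)| ≤ 5 * D.K * |q - q'| := by
    refine (D.n_lip _ _).trans ?_
    have := mul_le_mul_of_nonneg_left (add_le_add ht hs) hK
    simp only at this ⊢
    linarith
  have h4 := sqrt_le1 ha t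
  have h5 := Real.sqrt_nonneg (1 - t ^ 2)
  have h6 := D.n_pos (t * q' ^ 3, q' ^ 2)
  have h7 := D.n_le (t * q' ^ 3, q' ^ 2)
  have hq3 : q ^ 3 ≤ 1 := pow_le_one₀ q0 q1
  have hM := D.M_pos
  unfold hpp
  generalize D.n (t * q ^ 3, q ^ 2) = n1 at *
  generalize D.n (t * q' ^ 3, q' ^ 2) = n2 at *
  generalize √(1 - t ^ 2) = V at *
  have h8 : |n1 * (q ^ 3 * V) - n2 * (q' ^ 3 * V)| ≤ (5 * D.K + 3 * D.M) * |q - q'| := by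
    rw [show n1 * (q ^ 3 * V) - n2 * (q' ^ 3 * V) = ((n1 - n2) * q ^ 3 + n2 * (q ^ 3 - q' ^ 3)) * V by ring,
      abs_mul, abs_of_nonneg h5]
    refine (mul_le_of_le_one_right (abs_nonneg _) h4).trans ((abs_add_le _ _).trans ?_)
    rw [abs_mul, abs_mul, abs_of_pos h6, abs_of_nonneg (by positivity : 0 ≤ q ^ 3)]
    have := mul_le_of_le_one_right (abs_nonneg (n1 - n2)) hq3
    have := mul_le_mul h7 hc (abs_nonneg _) hM.le
    linarith
  rw [add_sub_add_comm, ← mul_sub]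
  refine (abs_add_le _ _).trans ?_
  rw [abs_mul, ha, one_mul]
  linarith

theorem hz_le {t l : ℝ} : |D.hpp a t (D.hq l) * D.hq l| ≤ 1 / 10 := by
  rw [abs_mul, abs_of_pos (D.hq_pos l)]
  have := D.hpp_le ha (t := t) (D.hq_pos l).le (D.hq_le l) (D.hq_sq l)
  have := D.hq_le l
  nlinarith [abs_nonneg (D.hpp a t (D.hq l)), D.hq_pos l]

omit ha in
theorem den_pos {t z : ℝ} (t0 : -1 ≤ t) (t1 : t ≤ 1) (hz : |z| ≤ 1 / 10) : 17 / 20 ≤ 1 - 3 / 2 * t * z := by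
  have h1 := abs_le.1 hz
  have : |t * z| ≤ 1 / 10 := by
    rw [abs_mul]
    have : |t| ≤ 1 := abs_le.2 ⟨t0, t1⟩
    nlinarith [abs_nonneg t, abs_nonneg z]
  have := abs_le.1 this
  nlinarith

theorem HG_ok : OdeOk (D.HG a) (2 * (10 * D.K + 3 * D.M + 1)).toNNReal 2 := by
  have hcl := fun s => cl_mem s
  refine ⟨?_, fun s => ?_, fun s y => ?_⟩
  · have h1 : Continuous fun q : ℝ × ℝ => (cl q.1 - 1, D.hq q.2) :=
      ((cl_cont.comp continuous_fst).sub continuous_const).prodMk (D.hq_cont.comp continuous_snd)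
    have h2 := ((D.hpp_cont a).comp h1).mul (D.hq_cont.comp continuous_snd)
    refine Continuous.add (Continuous.div h2 (continuous_const.sub ((continuous_const.mul
      ((cl_cont.comp continuous_fst).sub continuous_const)).mul h2)) fun q => ?_) (by fun_prop)
    have := den_pos (t := cl q.1 - 1) (by linarith [(hcl q.1).1]) (by linarith [(hcl q.1).2])
      (D.hz_le ha (t := cl q.1 - 1) (l := q.2))
    exact (lt_of_lt_of_le (by norm_num) this).ne'
  · refine LipschitzWith.of_dist_le_mul fun y1 y2 => ?_
    have hK := D.K_nonneg
    have hM := D.M_pos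
    rw [Real.dist_eq, Real.dist_eq, Real.coe_toNNReal _ (by positivity)]
    unfold HG
    rw [add_sub_add_right_eq_sub]
    have t0 : -1 ≤ cl s - 1 := by linarith [(hcl s).1]
    have t1 : cl s - 1 ≤ 1 := by linarith [(hcl s).2]
    generalize cl s - 1 = t at *
    have d1 := den_pos t0 t1 (D.hz_le ha (t := t) (l := y1))
    have d2 := den_pos t0 t1 (D.hz_le ha (t := t) (l := y2))
    have hl := D.hpp_lip ha t0 t1 (D.hq_pos y1).le (D.hq_le y1) (D.hq_pos y2).le (D.hq_le y2)
    have hb := D.hpp_le ha (t := t) (D.hq_pos y2).le (D.hq_le y2) (D.hq_sq y2)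
    have hq := D.hq_lip y1 y2
    have b1 := D.hq_pos y1
    have b2 := D.hq_le y1
    generalize D.hpp a t (D.hq y1) = p1 at *
    generalize D.hpp a t (D.hq y2) = p2 at *
    generalize D.hq y1 = q1 at *
    generalize D.hq y2 = q2 at *
    have hz : |p1 * q1 - p2 * q2| ≤ (10 * D.K + 3 * D.M + 1) * |y1 - y2| := by
      rw [show p1 * q1 - p2 * q2 = (p1 - p2) * q1 + p2 * (q1 - q2) by ring]
      refine (abs_add_le _ _).trans ?_
      rw [abs_mul, abs_mul, abs_of_pos b1]
      have e1 := mul_le_of_le_one_right (abs_nonneg (p1 - p2)) b2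
      have e2 : (10 * D.K + 3 * D.M) * |q1 - q2| ≤ (10 * D.K + 3 * D.M) * |y1 - y2| :=
        mul_le_mul_of_nonneg_left hq (by positivity)
      have e3 : |p2| * |q1 - q2| ≤ 1 * |y1 - y2| :=
        mul_le_mul (by linarith) hq (abs_nonneg _) zero_le_one
      linarith
    rw [div_sub_div _ _ (by linarith) (by linarith), abs_div, div_le_iff₀ (abs_pos.2 (by
      have := mul_pos (by linarith : 0 < 1 - 3 / 2 * t * (p1 * q1)) (by linarith : 0 < 1 - 3 / 2 * t * (p2 * q2))
      exact this.ne'))]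
    rw [abs_of_pos (mul_pos (by linarith : 0 < 1 - 3 / 2 * t * (p1 * q1)) (by linarith : 0 < 1 - 3 / 2 * t * (p2 * q2)))]
    have e4 : p1 * q1 * (1 - 3 / 2 * t * (p2 * q2)) - (1 - 3 / 2 * t * (p1 * q1)) * (p2 * q2) =
      p1 * q1 - p2 * q2 := by ring
    rw [e4]
    refine hz.trans ?_
    have e5 := mul_le_mul d1 d2 (by norm_num) (by linarith)
    have e6 : 0 ≤ (10 * D.K + 3 * D.M + 1) * |y1 - y2| := by positivity
    nlinarith
  · show |_| ≤ (2 : ℝ)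
    have t0 : -1 ≤ cl s - 1 := by linarith [(hcl s).1]
    have t1 : cl s - 1 ≤ 1 := by linarith [(hcl s).2]
    have d1 := den_pos t0 t1 (D.hz_le ha (t := cl s - 1) (l := y))
    have h1 := D.hz_le ha (t := cl s - 1) (l := y)
    refine (abs_add_le _ _).trans ?_
    rw [abs_mul, ha, abs_div, abs_of_pos (by linarith : 0 < 1 - 3 / 2 * (cl s - 1) * (D.hpp a (cl s - 1) (D.hq y) * D.hq y))]
    have h2 : min (max (s - 2) 0) 1 ≤ 1 := min_le_right _ _
    have h3 : 0 ≤ min (max (s - 2) 0) 1 := le_min (le_max_right _ _) zero_le_one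
    have h4 := (div_le_iff₀ (by linarith : 0 < 1 - 3 / 2 * (cl s - 1) * (D.hpp a (cl s - 1) (D.hq y) * D.hq y))).2
      (show |D.hpp a (cl s - 1) (D.hq y) * D.hq y| ≤ 1 * _ by linarith)
    rw [abs_of_nonneg h3]
    linarith

omit ha in
theorem hHP : HP (D.HG 1) (D.HG (-1)) (2 * (10 * D.K + 3 * D.M + 1)).toNNReal 2 := by
  have a1 : |(1:ℝ)| = 1 := by simp
  have a2 : |(-1:ℝ)| = 1 := by simp
  have hcl := fun s => cl_mem s
  have base : ∀ s y, D.hpp (-1) (cl s - 1) (D.hq y) * D.hq y /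
    (1 - 3 / 2 * (cl s - 1) * (D.hpp (-1) (cl s - 1) (D.hq y) * D.hq y)) ≤
     D.hpp 1 (cl s - 1) (D.hq y) * D.hq y /
    (1 - 3 / 2 * (cl s - 1) * (D.hpp 1 (cl s - 1) (D.hq y) * D.hq y)) ∧ (0 < s → s < 2 →
    D.hpp (-1) (cl s - 1) (D.hq y) * D.hq y /
    (1 - 3 / 2 * (cl s - 1) * (D.hpp (-1) (cl s - 1) (D.hq y) * D.hq y)) <
     D.hpp 1 (cl s - 1) (D.hq y) * D.hq y /
    (1 - 3 / 2 * (cl s - 1) * (D.hpp 1 (cl s - 1) (D.hq y) * D.hq y))) := by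
    intro s y
    have t0 : -1 ≤ cl s - 1 := by linarith [(hcl s).1]
    have t1 : cl s - 1 ≤ 1 := by linarith [(hcl s).2]
    have ht : 0 < s → s < 2 → 0 < 1 - (cl s - 1) ^ 2 := fun h0 h2 => by
      rw [cl_of h0.le h2.le]; nlinarith
    generalize cl s - 1 = t at *
    have d1 := den_pos t0 t1 (D.hz_le a1 (t := t) (l := y))
    have d2 := den_pos t0 t1 (D.hz_le a2 (t := t) (l := y))
    have q0 := D.hq_pos y
    have n0 := D.n_pos (t * D.hq y ^ 3, D.hq y ^ 2)
    have e : D.hpp 1 t (D.hq y) = D.hpp (-1) t (D.hq y) + 2 * (D.n (t * D.hq y ^ 3, D.hq y ^ 2) *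
      (D.hq y ^ 3 * √(1 - t ^ 2))) := by unfold hpp; ring
    generalize D.n (t * D.hq y ^ 3, D.hq y ^ 2) = N at *
    generalize D.hpp 1 t (D.hq y) = p1 at *
    generalize D.hpp (-1) t (D.hq y) = p2 at *
    generalize D.hq y = q at *
    rw [div_le_div_iff₀ (by linarith) (by linarith), div_lt_div_iff₀ (by linarith) (by linarith)]
    constructor
    · have : p2 ≤ p1 := by rw [e]; have := Real.sqrt_nonneg (1 - t ^ 2); nlinarith [show 0 ≤ N * (q ^ 3 * √(1 - t ^ 2)) by positivity]
      nlinarith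
    · intro h0 h2
      have := Real.sqrt_pos.2 (ht h0 h2)
      have : p2 < p1 := by rw [e]; nlinarith [show 0 < N * (q ^ 3 * √(1 - t ^ 2)) by positivity]
      nlinarith
  refine ⟨D.HG_ok a1, D.HG_ok a2, fun s y _ => ?_, fun s y h0 h2 => ?_, 3, by norm_num, fun s hs y1 y2 => ?_⟩
  · have h3 : 0 ≤ min (max (s - 2) 0) 1 := le_min (le_max_right _ _) zero_le_one
    have := (base s y).1
    unfold HG
    linarith
  · have h3 : 0 ≤ min (max (s - 2) 0) 1 := le_min (le_max_right _ _) zero_le_one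
    unfold HG
    rcases lt_or_gt_of_ne h2 with h | h
    · have := (base s y).2 h0 h
      linarith
    · have h4 : 0 < min (max (s - 2) 0) 1 := lt_min (lt_max_of_lt_left (by linarith)) one_pos
      have := (base s y).1
      linarith
  · have h4 : min (max (s - 2) 0) 1 = 1 := min_eq_right (le_max_of_le_left (by linarith))
    have t0 : -1 ≤ cl s - 1 := by linarith [(hcl s).1]
    have t1 : cl s - 1 ≤ 1 := by linarith [(hcl s).2]
    unfold HG
    rw [h4]
    have z1 := D.hz_le a1 (t := cl s - 1) (l := y1)
    have z2 := D.hz_le a2 (t := cl s - 1) (l := y2)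
    have d1 := den_pos t0 t1 z1
    have d2 := den_pos t0 t1 z2
    have z1 := abs_le.1 z1
    have z2 := abs_le.1 z2
    have f1 := (le_div_iff₀ (by linarith : 0 < 1 - 3 / 2 * (cl s - 1) * (D.hpp 1 (cl s - 1) (D.hq y1) * D.hq y1))).2
      (show (-(1 / 2) : ℝ) * _ ≤ D.hpp 1 (cl s - 1) (D.hq y1) * D.hq y1 by linarith)
    have f2 := (div_le_iff₀ (by linarith : 0 < 1 - 3 / 2 * (cl s - 1) * (D.hpp (-1) (cl s - 1) (D.hq y2) * D.hq y2))).2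
      (show D.hpp (-1) (cl s - 1) (D.hq y2) * D.hq y2 ≤ (1 / 2 : ℝ) * _ by linarith)
    linarith

end Dat

/-- point with horn coordinates `(s,l)` and excess `ρ` -/
def hP (s l ρ : ℝ) : ℝ × ℝ := ((s - 1) * Real.exp (l / 2) ^ 3 + ρ, Real.exp l)
/-- admissible excess -/
def hAdm (s ρ : ℝ) : Prop := 0 ≤ s ∧ s ≤ 2 ∧ (0 < ρ → s = 2) ∧ (ρ < 0 → s = 0)

theorem sqrt_exp (l : ℝ) : √(Real.exp l) = Real.exp (l / 2) := by
  rw [Real.sqrt_eq_iff_mul_self_eq (Real.exp_pos _).le (Real.exp_pos _).le, ← Real.exp_add]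
  congr 1; ring

theorem cl_adm {s ρ l : ℝ} (h : hAdm s ρ) :
    cl (1 + (hP s l ρ).1 / √(hP s l ρ).2 ^ 3) = s := by
  obtain ⟨h0, h2, h3, h4⟩ := h
  simp only [hP, sqrt_exp]
  have hE := Real.exp_pos (l / 2)
  rw [add_div, mul_div_cancel_right₀ _ (by positivity)]
  rcases lt_trichotomy ρ 0 with h | h | h
  · rw [h4 h]
    have := div_neg_of_neg_of_pos h (show 0 < Real.exp (l / 2) ^ 3 by positivity)
    rw [cl, max_eq_left (min_le_of_left_le (by linarith))]
  · subst h
    rw [zero_div, add_zero, add_sub_cancel, cl_of h0 h2]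
  · rw [h3 h]
    have := div_pos h (show 0 < Real.exp (l / 2) ^ 3 by positivity)
    rw [cl, min_eq_right (by linarith), max_eq_right zero_le_two]

theorem exists_hP (x : ℝ) {w : ℝ} (hw : 0 < w) : ∃ s l ρ, hAdm s ρ ∧ (x, w) = hP s l ρ := by
  have hE : 0 < √w ^ 3 := by have := Real.sqrt_pos.2 hw; positivity
  have hx : x = x / √w ^ 3 * √w ^ 3 := by rw [div_mul_cancel₀ _ hE.ne']
  set z := x / √w ^ 3
  refine ⟨cl (1 + z), Real.log w, x - (cl (1 + z) - 1) * √w ^ 3, ⟨(cl_mem _).1, (cl_mem _).2,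
    fun h => ?_, fun h => ?_⟩, ?_⟩
  · rw [cl, min_eq_right, max_eq_right zero_le_two]
    by_contra h2
    have : 1 + z ≤ cl (1 + z) := by rw [cl, min_eq_left (by linarith)]; exact le_max_right _ _
    nlinarith
  · by_contra h2
    have : cl (1 + z) ≤ 1 + z := by
      have h3 : 0 < cl (1 + z) := lt_of_le_of_ne (cl_mem _).1 (Ne.symm h2)
      rw [cl, lt_max_iff] at h3
      rcases h3 with h3 | h3
      · exact absurd h3 (lt_irrefl _)
      · rw [cl, max_eq_right h3.le]; exact min_le_left _ _
    nlinarith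
  · rw [hP, ← sqrt_exp, Real.exp_log hw]
    ext <;> simp

namespace Dat
variable (D D' : Dat)

def hhom (g : ℝ → ℝ) (q : ℝ × ℝ) : ℝ × ℝ := if q.2 ≤ 0 then q else
  hP (D.hHP.K D'.hHP g (cl (1 + q.1 / √q.2 ^ 3), Real.log q.2)).1
    (D.hHP.K D'.hHP g (cl (1 + q.1 / √q.2 ^ 3), Real.log q.2)).2
    (q.1 - (cl (1 + q.1 / √q.2 ^ 3) - 1) * √q.2 ^ 3)

theorem hhom_hP (g : ℝ → ℝ) {s l ρ : ℝ} (h : hAdm s ρ) : D.hhom D' g (hP s l ρ) =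
    hP (D.hHP.K D'.hHP g (s, l)).1 (D.hHP.K D'.hHP g (s, l)).2 ρ := by
  have h2 : ¬ (hP s l ρ).2 ≤ 0 := not_le.2 (Real.exp_pos _)
  rw [hhom, if_neg h2, cl_adm h]
  congr 2
  · simp [hP]
  · simp [hP]
  · simp [hP, sqrt_exp]

variable (g : ℝ ≃o ℝ) (hT : ∀ u, g (D.hHP.T u) = D'.hHP.T (g u))

include hT in
theorem hadm_K {s ρ : ℝ} (l : ℝ) (h : hAdm s ρ) : hAdm (D.hHP.K D'.hHP g (s, l)).1 ρ :=
  ⟨D.hHP.K_nonneg D'.hHP _, (D.hHP.K_le_two D'.hHP g.strictMono hT (q := (s, l)) h.1).2 h.2.1,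
    fun hr => (D.hHP.K_eq_two D'.hHP g.strictMono hT (q := (s, l)) h.1).2 (h.2.2.1 hr),
    fun hr => (D.hHP.K_eq_zero D'.hHP g.strictMono (q := (s, l)) h.1).2 (h.2.2.2 hr)⟩

include hT in
theorem hhom_hhom (q : ℝ × ℝ) : D'.hhom D g.symm (D.hhom D' g q) = q := by
  obtain ⟨x, w⟩ := q
  rcases le_or_gt w 0 with hw | hw
  · have : ∀ (A B : Dat) (g : ℝ → ℝ), A.hhom B g (x, w) = (x, w) := fun A B g => by
      rw [hhom, if_pos hw]
    rw [this, this]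
  · obtain ⟨s, l, ρ, ha, e⟩ := exists_hP x hw
    rw [e, D.hhom_hP D' g ha, D'.hhom_hP D g.symm (D.hadm_K D' g hT l ha), Prod.mk.eta,
      D.hHP.K_K D'.hHP (g := g) (g' := g.symm) g.monotone (fun u => g.symm_apply_apply u) ha.1]

theorem hhom_zero : D.hhom D' g 0 = 0 := if_pos le_rfl

theorem hK_le {s l : ℝ} (h0 : 0 ≤ s) (h2 : s ≤ 2) (hT : ∀ u, g (D.hHP.T u) = D'.hHP.T (g u)) :
    (D.hHP.K D'.hHP g (s, l)).2 ≤ g (l + 4) + 4 := by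
  have k2 := (D.hHP.K_le_two D'.hHP g.strictMono hT (q := (s, l)) h0).2 h2
  have k0 := D.hHP.K_nonneg D'.hHP (g := g) (s, l)
  have kl := congrArg Prod.fst (D.hHP.K_labs D'.hHP (g := g) g.monotone (q := (s, l)) h0)
  set k := D.hHP.K D'.hHP g (s, l)
  have key : ∀ (A : Dat) (s l : ℝ), 0 ≤ s → s ≤ 2 → |l - (A.hHP.labs (s, l)).1| ≤ 4 := by
    intro A s l h0 h2
    have := A.hHP.p.sol_lip s l 0 s
    rw [OdeOk.sol_init, sub_zero, abs_of_nonneg h0] at this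
    refine this.trans ?_
    norm_num; linarith
  have e1 := abs_le.1 (key D s l h0 h2)
  have e2 := abs_le.1 (key D' k.1 k.2 k0 k2)
  simp only [Prod.mk.eta] at e2
  rw [kl] at e2
  have := g.monotone (show (D.hHP.labs (s, l)).1 ≤ l + 4 by linarith)
  simp only at e2
  linarith

include hT in
theorem hhom_cont : Continuous (D.hhom D' g) := by
  rw [continuous_iff_continuousAt]
  rintro ⟨x, w⟩
  rcases lt_trichotomy w 0 with hw | hw | hw
  · refine continuousAt_id.congr ?_
    filter_upwards [continuous_snd.continuousAt.eventually_lt continuousAt_const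
      (show ((x, w) : ℝ × ℝ).2 < 0 from hw)] with q hq
    rw [hhom, if_pos (show q.2 ≤ 0 from hq.le)]; rfl
  · subst hw
    have hx0 : D.hhom D' g (x, 0) = (x, 0) := by rw [hhom, if_pos le_rfl]
    rw [ContinuousAt, hx0]
    let B : ℝ → ℝ := fun w => if w ≤ 0 then 0 else Real.exp (g (Real.log w + 4) + 4)
    have hB : Tendsto B (nhds 0) (nhds 0) := by
      have hle : Tendsto (fun w : ℝ => Real.exp (g (Real.log w + 4) + 4)) (nhdsWithin 0 (Ioi 0)) (nhds 0) := by
        refine Real.tendsto_exp_atBot.comp ?_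
        refine tendsto_atBot_add_const_right _ _ (g.tendsto_atBot.comp ?_)
        exact tendsto_atBot_add_const_right _ _ Real.tendsto_log_nhdsGT_zero
      suffices this : Tendsto B (nhdsWithin 0 (Iic 0) ⊔ nhdsWithin 0 (Ioi 0)) (nhds 0) by
        rwa [nhdsLE_sup_nhdsGT] at this
      refine Tendsto.sup (tendsto_const_nhds.congr' ?_) (hle.congr' ?_)
      · filter_upwards [self_mem_nhdsWithin] with w hw
        exact (if_pos (show w ≤ 0 from hw)).symm
      · filter_upwards [self_mem_nhdsWithin] with w hw
        exact (if_neg (not_le.2 (show 0 < w from hw))).symm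
    have hle : ∀ q : ℝ × ℝ, 0 ≤ B q.2 ∧ ‖D.hhom D' g q - q‖ ≤ 2 * (√(B q.2) ^ 3 + √q.2 ^ 3) + (B q.2 + |q.2|) := by
      rintro ⟨x, w⟩
      rcases le_or_gt w 0 with hw | hw
      · have b0 : B w = 0 := if_pos hw
        rw [hhom, if_pos (show ((x, w) : ℝ × ℝ).2 ≤ 0 from hw)]
        simp only [b0, sub_self, norm_zero]
        refine ⟨le_rfl, by positivity⟩
      · have b0 : B w = Real.exp (g (Real.log w + 4) + 4) := if_neg (not_le.2 hw)
        obtain ⟨s, l, ρ, ha, e⟩ := exists_hP x hw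
        have hwl : w = Real.exp l := congrArg Prod.snd e
        have hll : Real.log w = l := by rw [hwl, Real.log_exp]
        have hk := D.hK_le D' g (l := l) ha.1 ha.2.1 hT
        have ha' := D.hadm_K D' g hT l ha
        rw [e, D.hhom_hP D' g ha]
        have e2 : (hP s l ρ).2 = w := hwl.symm
        rw [e2, b0]
        refine ⟨(Real.exp_pos _).le, ?_⟩
        set k := D.hHP.K D'.hHP g (s, l)
        have c1 : Real.exp (k.2 / 2) ≤ √(Real.exp (g (Real.log w + 4) + 4)) := by
          rw [sqrt_exp, hll, Real.exp_le_exp]; linarith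
        have c2 : Real.exp k.2 ≤ Real.exp (g (Real.log w + 4) + 4) := by
          rw [hll, Real.exp_le_exp]; linarith
        have c3 : √w = Real.exp (l / 2) := by rw [hwl, sqrt_exp]
        have c4 : Real.exp (k.2 / 2) ^ 3 ≤ √(Real.exp (g (Real.log w + 4) + 4)) ^ 3 := by gcongr
        have p1 : 0 < Real.exp (k.2 / 2) ^ 3 := by positivity
        have p2 : 0 < Real.exp (l / 2) ^ 3 := by positivity
        have p3 := Real.exp_pos k.2
        have p4 := Real.exp_pos l
        have s1 := ha.1
        have s2 := ha.2.1
        have s3 := ha'.1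
        have s4 := ha'.2.1
        rw [c3, abs_of_pos hw, hwl, Prod.norm_def]
        rw [hwl] at c4 c2
        refine max_le ?_ ?_
        · simp only [hP, Prod.fst_sub, Real.norm_eq_abs]
          rw [abs_le]
          constructor <;> nlinarith
        · simp only [hP, Prod.snd_sub, Real.norm_eq_abs]
          rw [abs_le]
          constructor <;> nlinarith
    have hlim : Tendsto (fun q : ℝ × ℝ => 2 * (√(B q.2) ^ 3 + √q.2 ^ 3) + (B q.2 + |q.2|)) (nhds (x, 0)) (nhds 0) := by
      have h1 : Tendsto (fun w : ℝ => 2 * (√(B w) ^ 3 + √w ^ 3) + (B w + |w|)) (nhds 0)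
          (nhds (2 * (√0 ^ 3 + √0 ^ 3) + (0 + |0|))) :=
        (((hB.sqrt.pow 3).add ((Real.continuous_sqrt.tendsto 0).pow 3)).const_mul 2).add
          (hB.add (continuous_abs.tendsto 0))
      simp only [Real.sqrt_zero, abs_zero] at h1
      norm_num at h1
      exact h1.comp (continuous_snd.tendsto (x, (0:ℝ)))
    have h1 : Tendsto (fun q => D.hhom D' g q - q) (nhds (x, 0)) (nhds 0) :=
      squeeze_zero_norm (fun q => (hle q).2) hlim
    have := h1.add (tendsto_id (x := nhds ((x, 0) : ℝ × ℝ)))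
    simpa using this
  · have hev : ∀ᶠ q : ℝ × ℝ in nhds (x, w), 0 < q.2 :=
      continuousAt_const.eventually_lt continuous_snd.continuousAt (show 0 < ((x, w) : ℝ × ℝ).2 from hw)
    have hE : 0 < √w ^ 3 := by have := Real.sqrt_pos.2 hw; positivity
    have c1 : ContinuousAt (fun q : ℝ × ℝ => cl (1 + q.1 / √q.2 ^ 3)) (x, w) := by
      refine cl_cont.continuousAt.comp ?_
      refine continuousAt_const.add (continuous_fst.continuousAt.div (by fun_prop) hE.ne')
    have c2 : ContinuousAt (fun q : ℝ × ℝ => Real.log q.2) (x, w) :=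
      continuous_snd.continuousAt.log hw.ne'
    have c3 : ContinuousAt (fun q : ℝ × ℝ => D.hHP.K D'.hHP g (cl (1 + q.1 / √q.2 ^ 3), Real.log q.2)) (x, w) := by
      have := D.hHP.K_cont D'.hHP (g := g) g.monotone g.continuous
      rw [ContinuousAt]
      refine ((this _ ?_).tendsto).comp (tendsto_nhdsWithin_iff.2 ⟨c1.prodMk c2, ?_⟩)
      · exact (cl_mem _).1
      · exact Eventually.of_forall fun q => (cl_mem _).1
    refine ContinuousAt.congr (f := fun q : ℝ × ℝ => hP
      (D.hHP.K D'.hHP g (cl (1 + q.1 / √q.2 ^ 3), Real.log q.2)).1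
      (D.hHP.K D'.hHP g (cl (1 + q.1 / √q.2 ^ 3), Real.log q.2)).2
      (q.1 - (cl (1 + q.1 / √q.2 ^ 3) - 1) * √q.2 ^ 3)) ?_ ?_
    · have hPc : Continuous fun z : (ℝ × ℝ) × ℝ => hP z.1.1 z.1.2 z.2 := by unfold hP; fun_prop
      have c4 : ContinuousAt (fun q : ℝ × ℝ => q.1 - (cl (1 + q.1 / √q.2 ^ 3) - 1) * √q.2 ^ 3) (x, w) :=
        continuous_fst.continuousAt.sub ((c1.sub continuousAt_const).mul (by fun_prop))
      exact hPc.continuousAt.comp (c3.prodMk c4)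
    · filter_upwards [hev] with q hq
      rw [hhom, if_neg (not_le.2 hq)]

end Dat

namespace Dat
variable (D D' : Dat)

theorem hleaf_crv {a : ℝ} (ha : |a| = 1) (u : ℝ) {c d : ℝ}
    (hs : ∀ s ∈ Ioo c d, 0 < s ∧ s < 2)
    (hbox : ∀ s ∈ Ioo c d, hP s ((D.HG_ok ha).sol 0 u s) 0 ∈ D.box) :
    ∃ dx dw, Crv D 1 (fun s => (hP s ((D.HG_ok ha).sol 0 u s) 0).1)
      (fun s => (hP s ((D.HG_ok ha).sol 0 u s) 0).2) dx dw (Ioo c d) := by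
  set l := (D.HG_ok ha).sol 0 u with hl
  have lc : Continuous l := (D.HG_ok ha).sol_cont 0 u
  have ld : ∀ s, HasDerivAt l (D.HG a s (l s)) s := (D.HG_ok ha).sol_deriv 0 u
  have Gc : Continuous fun s => D.HG a s (l s) := (D.HG_ok ha).cont.comp (continuous_id.prodMk lc)
  refine ⟨fun s => Real.exp (l s / 2) ^ 3 * (1 + 3 / 2 * (s - 1) * D.HG a s (l s)),
    fun s => Real.exp (l s) * D.HG a s (l s), isOpen_Ioo, ordConnected_Ioo, fun s hs => ?_,
    fun s hs => (ld s).exp, by fun_prop, by fun_prop, fun s hs => hbox s hs, fun s h => ?_,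
    fun s h => ?_⟩
  · have h1 : HasDerivAt (fun s => Real.exp (l s / 2)) (Real.exp (l s / 2) * (D.HG a s (l s) / 2)) s :=
      ((ld s).div_const 2).exp
    have h2 := (((hasDerivAt_id s).sub_const 1).mul (h1.pow 3)).add_const (0:ℝ)
    refine h2.congr_deriv ?_
    simp
    ring
  all_goals
    obtain ⟨s0, s2⟩ := hs s h
    have hw : Real.exp (l s) < D.r := by
      have := (hbox s h).2
      rwa [show (hP s (l s) 0).2 = Real.exp (l s) from rfl, abs_of_pos (Real.exp_pos _)] at this
    have hq : D.hq (l s) = Real.exp (l s / 2) := by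
      have := D.hq_eq (Real.exp_pos (l s)) hw.le
      rwa [Real.log_exp, sqrt_exp] at this
    have hG : D.HG a s (l s) = D.hpp a (s - 1) (Real.exp (l s / 2)) * Real.exp (l s / 2) /
        (1 - 3 / 2 * (s - 1) * (D.hpp a (s - 1) (Real.exp (l s / 2)) * Real.exp (l s / 2))) := by
      rw [HG, cl_of s0.le s2.le, hq, max_eq_right (by linarith)]
      simp
    have hz := D.hz_le ha (t := s - 1) (l := l s)
    have hd := den_pos (t := s - 1) (by linarith) (by linarith) hz
    rw [hq] at hd
    have hE := Real.exp_pos (l s / 2)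
    have hee : Real.exp (l s) = Real.exp (l s / 2) ^ 2 := by
      rw [← Real.exp_nat_mul]; congr 1; push_cast; ring
    have hpd : D.hpp a (s - 1) (Real.exp (l s / 2)) = D.μ (hP s (l s) 0) +
        a * (D.n (hP s (l s) 0) * (Real.exp (l s / 2) ^ 3 * √(1 - (s - 1) ^ 2))) := by
      rw [hpp, hP, hee, add_zero]
    set q := Real.exp (l s / 2)
    set p := D.hpp a (s - 1) q
    have hk : 1 + 3 / 2 * (s - 1) * D.HG a s (l s) = 1 / (1 - 3 / 2 * (s - 1) * (p * q)) := by
      have hd' : 1 - 3 / 2 * (s - 1) * (p * q) ≠ 0 := by linarith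
      rw [hG, eq_div_iff hd', add_mul, one_mul, ← mul_div_assoc, div_mul_cancel₀ _ hd']; ring
  · rw [hk]
    have : 0 < 1 / (1 - 3 / 2 * (s - 1) * (p * q)) := by apply one_div_pos.2; linarith
    positivity
  · simp only [Prod.mk.eta]
    have e1 : Real.exp (l s) * D.HG a s (l s) = p * (q ^ 3 * (1 + 3 / 2 * (s - 1) * D.HG a s (l s))) := by
      rw [hk, hG, hee]; field_simp
    rw [e1]
    set κ := q ^ 3 * (1 + 3 / 2 * (s - 1) * D.HG a s (l s))
    have e2 : (hP s (l s) 0).2 ^ 3 - (hP s (l s) 0).1 ^ 2 = (q ^ 3) ^ 2 * √(1 - (s - 1) ^ 2) ^ 2 := by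
      rw [Real.sq_sqrt (by nlinarith), hP, hee]; simp only [q]; ring
    rw [e2, hpd]
    have ha2 : a ^ 2 = 1 := by rw [← sq_abs, ha]; norm_num
    linear_combination D.n (hP s (l s) 0) ^ 2 * ((q ^ 3) ^ 2 * √(1 - (s - 1) ^ 2) ^ 2) * κ ^ 2 * ha2

theorem hlabs_const {x w dx dw : ℝ → ℝ} {I : Set ℝ} (h : Crv D 1 x w dx dw I) :
    ∃ a : ℝ, ∃ ha : a = 1 ∨ a = -1, ∀ t ∈ I, ∀ t' ∈ I,
      (D.HG_ok (abs_one ha)).lab (1 + x t / √(w t) ^ 3) (Real.log (w t)) =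
      (D.HG_ok (abs_one ha)).lab (1 + x t' / √(w t') ^ 3) (Real.log (w t')) := by
  have hpos := fun t ht => h.pos_of_one rfl (t := t) ht
  obtain ⟨a, ha, hs⟩ := h.exists_sign (fun t ht => by rw [one_mul]; exact hpos t ht)
  have wpos : ∀ t ∈ I, 0 < w t := fun t ht => by
    by_contra hw
    have := hpos t ht
    have h3 : w t ^ 3 ≤ 0 := by
      have h2 := sq_nonneg (w t)
      have : w t ^ 3 = w t * w t ^ 2 := by ring
      rw [this]; exact mul_nonpos_of_nonpos_of_nonneg (not_lt.1 hw) h2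
    nlinarith [sq_nonneg (x t)]
  refine ⟨a, ha, fun t ht t' ht' => ?_⟩
  have sd : ∀ t ∈ I, HasDerivAt (fun t => √(w t)) (dw t / (2 * √(w t))) t := fun t ht =>
    (h.hw t ht).sqrt (wpos t ht).ne'
  have cq : ContinuousOn (fun t => √(w t)) I := h.wcont.sqrt
  have cds : ContinuousOn (fun t => (dx t * √(w t) ^ 3 - x t * (3 * √(w t) ^ 2 * (dw t / (2 * √(w t))))) /
      (√(w t) ^ 3) ^ 2) I := by
    have := h.cx
    have := h.cw
    have := h.xcont
    refine ContinuousOn.div ?_ (by fun_prop) fun t ht => ?_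
    · refine (h.cx.mul (cq.pow 3)).sub (h.xcont.mul ((continuousOn_const.mul (cq.pow 2)).mul
        (h.cw.div (continuousOn_const.mul cq) fun t ht => ?_)))
      have := Real.sqrt_pos.2 (wpos t ht); positivity
    · have := Real.sqrt_pos.2 (wpos t ht); positivity
  refine (D.HG_ok (abs_one ha)).lab_const h.oc (s := fun t => 1 + x t / √(w t) ^ 3)
    (y := fun t => Real.log (w t)) (dy := fun t => dw t / w t) (fun t ht => ?_)
    (fun t ht => (h.hw t ht).log (wpos t ht).ne') cds (fun t ht => ?_) ht ht'
  · have hq := Real.sqrt_pos.2 (wpos t ht)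
    have := ((h.hx t ht).div ((sd t ht).pow 3) (pow_pos hq 3).ne').const_add 1
    refine this.congr_deriv ?_
    simp
  · have hq := Real.sqrt_pos.2 (wpos t ht)
    have hb := (h.box t ht).2
    have hw := wpos t ht
    rw [abs_of_pos hw] at hb
    have hq2 : w t = √(w t) ^ 2 := (Real.sq_sqrt hw.le).symm
    have hqe := D.hq_eq hw hb.le
    have hst := hs t ht
    have hp := hpos t ht
    set q := √(w t) with hqd
    have hxz : x t = x t / q ^ 3 * q ^ 3 := by field_simp
    set z := x t / q ^ 3 with hz
    have hz1 : z ^ 2 < 1 := by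
      rw [hxz, hq2] at hp
      have : (q ^ 2) ^ 3 - (z * q ^ 3) ^ 2 = q ^ 6 * (1 - z ^ 2) := by ring
      rw [this] at hp
      have := (pos_iff_pos_of_mul_pos hp).1 (by positivity)
      linarith
    have hz2 := abs_lt.1 ((sq_lt_one_iff_abs_lt_one z).1 hz1)
    have hsq : √(1 * (w t ^ 3 - x t ^ 2)) = q ^ 3 * √(1 - z ^ 2) := by
      rw [show 1 * (w t ^ 3 - x t ^ 2) = (q ^ 3) ^ 2 * (1 - z ^ 2) by rw [hxz, hq2]; ring,
        Real.sqrt_mul (by positivity), Real.sqrt_sq (by positivity)]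
    have hpd : D.hpp a z q = D.μ (x t, w t) + a * (D.n (x t, w t) * √(1 * (w t ^ 3 - x t ^ 2))) := by
      rw [hsq, hpp, ← hxz, ← hq2]
    have hzl := D.hz_le (abs_one ha) (t := z) (l := Real.log (w t))
    have hd := den_pos (t := z) hz2.1.le hz2.2.le hzl
    have hG : D.HG a (1 + z) (Real.log (w t)) = D.hpp a z q * q / (1 - 3 / 2 * z * (D.hpp a z q * q)) := by
      rw [HG, cl_of (by linarith) (by linarith), hqe, max_eq_right (by linarith)]
      simp
    rw [hqe] at hd
    rw [← hpd] at hst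
    rw [hG, hst]
    set p := D.hpp a z q
    rw [hxz]
    have hd' : 1 - 3 / 2 * z * (p * q) ≠ 0 := by linarith
    rw [show dx t * q ^ 3 - z * q ^ 3 * (3 * q ^ 2 * (p * dx t / (2 * q))) =
      dx t * q ^ 3 * (1 - 3 / 2 * z * (p * q)) by field_simp]
    rw [hq2]
    generalize 1 - 3 / 2 * z * (p * q) = d at *
    field_simp

end Dat

namespace Dat
variable (D D' : Dat)

theorem image_pos (g : ℝ ≃o ℝ) (hT : ∀ u, g (D.hHP.T u) = D'.hHP.T (g u))
    {ω Ω : (ℝ × ℝ) → (ℝ × ℝ) → ℝ} (h : D.Rep 1 ω) (h' : D'.Rep 1 Ω) (γ : ℝ → ℝ × ℝ) (I : Set ℝ)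
    (h1 : IsIntegralCurveOnBDE ω γ I) (h2 : MapsTo γ I D.box)
    (h3 : MapsTo (fun t => D.hhom D' g (γ t)) I D'.box) :
    ∃ σ J, IsIntegralCurveOnBDE Ω σ J ∧ (fun t => D.hhom D' g (γ t)) '' I = σ '' J := by
  obtain ⟨dx, dw, hc⟩ := h.crv h1 h2
  obtain ⟨⟨c, d, rfl⟩, -⟩ := h1
  obtain ⟨a, ha, hl⟩ := D.hlabs_const hc
  have hxc := hc.xcont
  have hwc := hc.wcont
  have hpos := fun t ht => hc.pos_of_one rfl (t := t) ht
  have wpos : ∀ t ∈ Ioo c d, 0 < (γ t).2 := fun t ht => by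
    by_contra hw
    have := hpos t ht
    have h3 : (γ t).2 ^ 3 ≤ 0 := by
      have h2 := sq_nonneg (γ t).2
      have : (γ t).2 ^ 3 = (γ t).2 * (γ t).2 ^ 2 := by ring
      rw [this]; exact mul_nonpos_of_nonpos_of_nonneg (not_lt.1 hw) h2
    nlinarith [sq_nonneg (γ t).1]
  set s : ℝ → ℝ := fun t => 1 + (γ t).1 / √(γ t).2 ^ 3 with hs
  have sd : ∀ t ∈ Ioo c d, 0 < s t ∧ s t < 2 := fun t ht => by
    have hp := hpos t ht
    have hq := Real.sqrt_pos.2 (wpos t ht)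
    have hq2 := Real.sq_sqrt (wpos t ht).le
    have hx : (γ t).1 = (s t - 1) * √(γ t).2 ^ 3 := by simp only [hs]; field_simp; ring
    rw [hx] at hp
    nth_rewrite 1 [← hq2] at hp
    have e : (√(γ t).2 ^ 2) ^ 3 - ((s t - 1) * √(γ t).2 ^ 3) ^ 2 = √(γ t).2 ^ 6 * (1 - (s t - 1) ^ 2) := by ring
    rw [e] at hp
    have := (pos_iff_pos_of_mul_pos hp).1 (by positivity)
    constructor <;> nlinarith
  have sad : ∀ t ∈ Ioo c d, hAdm (s t) 0 := fun t ht =>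
    ⟨(sd t ht).1.le, (sd t ht).2.le, fun h => absurd h (lt_irrefl _), fun h => absurd h (lt_irrefl _)⟩
  have hγ : ∀ t ∈ Ioo c d, γ t = hP (s t) (Real.log (γ t).2) 0 := fun t ht => by
    have hq := Real.sqrt_pos.2 (wpos t ht)
    rw [hP, ← sqrt_exp, Real.exp_log (wpos t ht)]
    ext
    · simp only [hs]; field_simp; ring
    · rfl
  set k : ℝ → ℝ × ℝ := fun t => D.hHP.K D'.hHP g (s t, Real.log (γ t).2) with hk
  have him : ∀ t ∈ Ioo c d, D.hhom D' g (γ t) = hP (k t).1 (k t).2 0 := fun t ht => by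
    conv_lhs => rw [hγ t ht]
    rw [D.hhom_hP D' g (sad t ht)]
  have kpos : ∀ t ∈ Ioo c d, 0 < (k t).1 ∧ (k t).1 < 2 := fun t ht => by
    have a1 := (D.hadm_K D' g hT (Real.log (γ t).2) (sad t ht))
    refine ⟨lt_of_le_of_ne a1.1 fun e => ?_, lt_of_le_of_ne a1.2.1 fun e => ?_⟩
    · exact (sd t ht).1.ne' ((D.hHP.K_eq_zero D'.hHP g.strictMono (q := (s t, _)) (sd t ht).1.le).1 e.symm)
    · exact (sd t ht).2.ne ((D.hHP.K_eq_two D'.hHP g.strictMono hT (q := (s t, _)) (sd t ht).1.le).1 e)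
  rcases (Ioo c d).eq_empty_or_nonempty with hI | ⟨t0, ht0⟩
  · exact ⟨fun _ => 0, Ioo 0 0, ⟨⟨0, 0, rfl⟩, fun _ => 0, continuousOn_const, by simp⟩, by simp [hI]⟩
  obtain ⟨v, hv⟩ : ∃ v, ∀ t ∈ Ioo c d, (k t).2 = (D'.HG_ok (abs_one ha)).sol 0 v (k t).1 := by
    refine ⟨g ((D.HG_ok (abs_one ha)).lab (s t0) (Real.log (γ t0).2)), fun t ht => ?_⟩
    rw [← hl t ht t0 ht0]
    have kl := D.hHP.K_labs D'.hHP (g := g) g.monotone (q := (s t, Real.log (γ t).2)) (sd t ht).1.le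
    have : (D'.HG_ok (abs_one ha)).lab (k t).1 (k t).2 =
        g ((D.HG_ok (abs_one ha)).lab (s t) (Real.log (γ t).2)) := by
      rcases ha with rfl | rfl
      · exact congrArg Prod.fst kl
      · exact congrArg Prod.snd kl
    rw [← this, OdeOk.sol_lab]
  have scont : ContinuousOn s (Ioo c d) := by
    refine continuousOn_const.add (hxc.div (hwc.sqrt.pow 3) fun t ht => ?_)
    exact (pow_pos (Real.sqrt_pos.2 (wpos t ht)) 3).ne'
  have kcont : ContinuousOn k (Ioo c d) :=
    (D.hHP.K_cont D'.hHP (g := g) g.monotone g.continuous).comp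
      (scont.prodMk (hwc.log fun t ht => (wpos t ht).ne')) fun t ht => (sd t ht).1.le
  have himv : ∀ t ∈ Ioo c d, D.hhom D' g (γ t) =
      hP (k t).1 ((D'.HG_ok (abs_one ha)).sol 0 v (k t).1) 0 := fun t ht => by
    rw [him t ht, ← hv t ht]
  have kinj : InjOn (fun t => (k t).1) (Ioo c d) := fun t ht t' ht' e => by
    refine hc.inj ht ht' ?_
    have e' : (k t).1 = (k t').1 := e
    have : D.hhom D' g (γ t) = D.hhom D' g (γ t') := by rw [himv t ht, himv t' ht', e']
    have := congrArg (D'.hhom D g.symm) this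
    rw [D.hhom_hhom D' g hT, D.hhom_hhom D' g hT] at this
    exact congrArg Prod.fst this
  obtain ⟨c', d', hcd⟩ := image_Ioo_of_inj (B := 2) (continuous_fst.comp_continuousOn kcont) kinj
    (fun t ht => abs_le.2 ⟨(by linarith [(kpos t ht).1] : -2 ≤ (k t).1), (kpos t ht).2.le⟩)
  have hcd' : (fun t => (k t).1) '' Ioo c d = Ioo c' d' := hcd
  obtain ⟨ex, ew, hcc⟩ := D'.hleaf_crv (abs_one ha) v (c := c') (d := d')
    (by rw [← hcd']; rintro _ ⟨t, ht, rfl⟩; exact kpos t ht)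
    (by rw [← hcd']; rintro _ ⟨t, ht, rfl⟩; rw [← himv t ht]; exact h3 ht)
  refine ⟨_, _, h'.curve hcc, ?_⟩
  rw [← hcd', image_image]
  exact image_congr fun t ht => himv t ht

theorem topEquiv_pos {ω Ω : (ℝ × ℝ) → (ℝ × ℝ) → ℝ} (h : D.Rep 1 ω)
    (h' : D'.Rep 1 Ω) : TopEquivAt0 ω Ω := by
  obtain ⟨g, hT⟩ := D.hHP.exists_conj D'.hHP
  have hT' : ∀ u, g.symm (D'.hHP.T u) = D.hHP.T (g.symm u) := fun u => by
    rw [OrderIso.symm_apply_eq, hT, OrderIso.apply_symm_apply]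
  have := D'.hhom_hhom D g.symm hT'
  rw [OrderIso.symm_symm] at this
  refine topEquiv_of_global D.box_open D'.box_open D.box_zero D'.box_zero (D.hhom_cont D' g hT)
    (D'.hhom_cont D g.symm hT') this (D.hhom_hhom D' g hT) (D.hhom_zero D' g)
    (fun γ I h1 h2 h3 => D.image_pos D' g hT h h' γ I h1 h2 h3)
    (fun γ I h1 h2 h3 => D'.image_pos D g.symm hT' h' h γ I h1 h2 h3)

/-- the model -/
def model : Dat where
  μ _ := 0
  n _ := 1
  r := 1 / 40
  K := 0
  M := 1
  r_pos := by norm_num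
  r_le := by norm_num
  K_nonneg := le_rfl
  μ_lip _ _ := by simp
  n_lip _ _ := by simp
  μ_zero := rfl
  μ_le _ := by norm_num
  n_pos _ := one_pos
  n_le _ := le_rfl
  Mr := by norm_num

theorem topEquiv_of_rep {σ : ℝ} (hσ : σ = 1 ∨ σ = -1) {ω : (ℝ × ℝ) → (ℝ × ℝ) → ℝ} (h : D.Rep σ ω) :
    TopEquivAt0 ω (BDE (fun _ => 1) (fun _ => 0) (fun p => σ * p.1 ^ 2 + p.2 ^ 3)) := by
  rcases hσ with rfl | rfl
  · have h1 : model.Rep 1 (BDE (fun _ => 1) (fun _ => 0) (fun p => 1 * p.1 ^ 2 + (-p.2) ^ 3)) := by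
      intro p hp v
      simp only [model, BDE]
      constructor <;> intro h <;> linarith
    refine (D.topEquiv_pos model h h1).trans ?_
    refine topEquiv_of_diffeo (h := fun p => (p.1, -p.2)) (k := fun p => (p.1, -p.2)) isOpen_univ
      isOpen_univ (mem_univ _) (by fun_prop) (by fun_prop) (mapsTo_univ _ _) (mapsTo_univ _ _)
      (by simp) (by simp) (by simp) ?_
    intro p _ v
    have hd : HasFDerivAt (fun p : ℝ × ℝ => (p.1, -p.2))
        ((ContinuousLinearMap.fst ℝ ℝ ℝ).prod (-ContinuousLinearMap.snd ℝ ℝ ℝ)) p :=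
      hasFDerivAt_fst.prodMk hasFDerivAt_snd.neg
    rw [hd.fderiv]
    simp [BDE]
  · refine D.topEquiv_neg model h ?_
    intro p hp v
    simp only [model, BDE]
    constructor <;> intro h <;> linarith

end Dat

theorem pint_hasFDerivAt {G : Type} [NormedAddCommGroup G] [NormedSpace ℝ G] [CompleteSpace G]
    {F : ℝ × (ℝ × ℝ) → G} (hF : ContDiff ℝ 1 F) (p : ℝ × ℝ) :
    HasFDerivAt (fun p => ∫ τ in (0:ℝ)..1, F (τ, p))
      (∫ τ in (0:ℝ)..1, (fderiv ℝ F (τ, p)).comp (ContinuousLinearMap.inr ℝ ℝ (ℝ × ℝ))) p := by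
  have hc : Continuous fun q : ℝ × (ℝ × ℝ) => (fderiv ℝ F q).comp (ContinuousLinearMap.inr ℝ ℝ (ℝ × ℝ)) := by
    have := hF.continuous_fderiv one_ne_zero
    fun_prop
  have hk : IsCompact (Icc (0:ℝ) 1 ×ˢ Metric.closedBall p 1) :=
    isCompact_Icc.prod (isCompact_closedBall _ _)
  obtain ⟨C, hC⟩ := hk.exists_bound_of_continuousOn hc.continuousOn
  have hcF := hF.continuous
  refine intervalIntegral.hasFDerivAt_integral_of_dominated_of_fderiv_le (bound := fun _ => C)
    (s := Metric.closedBall p 1) (F := fun p τ => F (τ, p))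
    (F' := fun p τ => (fderiv ℝ F (τ, p)).comp (ContinuousLinearMap.inr ℝ ℝ (ℝ × ℝ)))
    (Metric.closedBall_mem_nhds p one_pos) ?_ ?_ ?_ ?_ ?_ ?_
  · refine Eventually.of_forall fun q => ?_
    have : Continuous fun τ => F (τ, q) := by fun_prop
    exact this.aestronglyMeasurable
  · have : Continuous fun τ => F (τ, p) := by fun_prop
    exact this.intervalIntegrable _ _
  · have : Continuous fun τ : ℝ => (fderiv ℝ F (τ, p)).comp (ContinuousLinearMap.inr ℝ ℝ (ℝ × ℝ)) :=
      hc.comp (by fun_prop : Continuous fun τ : ℝ => (τ, p))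
    exact this.aestronglyMeasurable
  · refine Eventually.of_forall fun t ht q hq => hC (t, q) ⟨?_, hq⟩
    rw [uIoc_of_le zero_le_one] at ht
    exact ⟨ht.1.le, ht.2⟩
  · exact intervalIntegrable_const
  · refine Eventually.of_forall fun t ht q hq => ?_
    have h1 := (hF.differentiable one_ne_zero (t, q)).hasFDerivAt
    exact h1.comp q (hasFDerivAt_prodMk_right t q)

theorem pint_contDiff (n : ℕ) : ∀ {G : Type} [NormedAddCommGroup G] [NormedSpace ℝ G] [CompleteSpace G]
    {F : ℝ × (ℝ × ℝ) → G}, ContDiff ℝ n F → ContDiff ℝ n (fun p => ∫ τ in (0:ℝ)..1, F (τ, p)) := by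
  induction n with
  | zero =>
    intro G _ _ _ F hF
    have := hF.continuous
    simp only [Nat.cast_zero, contDiff_zero]
    exact intervalIntegral.continuous_parametric_intervalIntegral_of_continuous' (by fun_prop) 0 1
  | succ n ih =>
    intro G _ _ _ F hF
    rw [show ((n + 1 : ℕ) : WithTop ℕ∞) = (n : WithTop ℕ∞) + 1 by norm_cast] at hF ⊢
    rw [contDiff_succ_iff_hasFDerivAt]
    refine ⟨_, ?_, fun p => pint_hasFDerivAt (hF.of_le ?_) p⟩
    · refine ih (F := fun q => (fderiv ℝ F q).comp (ContinuousLinearMap.inr ℝ ℝ (ℝ × ℝ))) ?_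
      exact (hF.fderiv_right le_rfl).clm_comp contDiff_const
    · exact le_add_self

theorem pdx_eq {g : ℝ × ℝ → ℝ} {p : ℝ × ℝ} (h : DifferentiableAt ℝ g p) : pdx g p = fderiv ℝ g p (1, 0) := by
  have h1 : HasDerivAt (fun s : ℝ => (s, p.2)) ((1 : ℝ), (0 : ℝ)) p.1 :=
    (hasDerivAt_id _).prodMk (hasDerivAt_const _ _)
  exact (h.hasFDerivAt.comp_hasDerivAt p.1 h1).deriv
theorem pdy_eq {g : ℝ × ℝ → ℝ} {p : ℝ × ℝ} (h : DifferentiableAt ℝ g p) : pdy g p = fderiv ℝ g p (0, 1) := by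
  have h1 : HasDerivAt (fun s : ℝ => (p.1, s)) ((0 : ℝ), (1 : ℝ)) p.2 :=
    (hasDerivAt_const _ _).prodMk (hasDerivAt_id _)
  exact (h.hasFDerivAt.comp_hasDerivAt p.2 h1).deriv
theorem fderiv_eq_pd {g : ℝ × ℝ → ℝ} {p : ℝ × ℝ} (h : DifferentiableAt ℝ g p) (v : ℝ × ℝ) :
    fderiv ℝ g p v = v.1 * pdx g p + v.2 * pdy g p := by
  rw [pdx_eq h, pdy_eq h, ← smul_eq_mul, ← smul_eq_mul, ← map_smul, ← map_smul, ← map_add]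
  simp

theorem pdx_cd {g : ℝ × ℝ → ℝ} {n m : WithTop ℕ∞} (h : ContDiff ℝ n g) (hm : m + 1 ≤ n) : ContDiff ℝ m (pdx g) := by
  have hd : Differentiable ℝ g := h.differentiable (fun h0 => by subst h0; simp at hm)
  rw [show pdx g = fun p => fderiv ℝ g p (1, 0) from funext fun p => pdx_eq (hd p)]
  exact (h.fderiv_right hm).clm_apply contDiff_const
theorem pdy_cd {g : ℝ × ℝ → ℝ} {n m : WithTop ℕ∞} (h : ContDiff ℝ n g) (hm : m + 1 ≤ n) : ContDiff ℝ m (pdy g) := by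
  have hd : Differentiable ℝ g := h.differentiable (fun h0 => by subst h0; simp at hm)
  rw [show pdy g = fun p => fderiv ℝ g p (0, 1) from funext fun p => pdy_eq (hd p)]
  exact (h.fderiv_right hm).clm_apply contDiff_const

/-- Hadamard in the first variable. -/
theorem hadamard1 {g : ℝ × ℝ → ℝ} {n : ℕ} (h : ContDiff ℝ (n + 1 : ℕ) g) :
    ∃ H : ℝ × ℝ → ℝ, ContDiff ℝ n H ∧ ∀ p : ℝ × ℝ, g p = g (0, p.2) + p.1 * H p := by
  have hp : ContDiff ℝ n (pdx g) := pdx_cd h (by norm_cast)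
  have hd : Differentiable ℝ g := h.differentiable (by norm_cast)
  refine ⟨fun p => ∫ τ in (0:ℝ)..1, pdx g (τ * p.1, p.2), ?_, fun p => ?_⟩
  · exact pint_contDiff n (F := fun q => pdx g (q.1 * q.2.1, q.2.2)) (hp.comp (by fun_prop))
  · have hc := hp.continuous
    have := intervalIntegral.integral_eq_sub_of_hasDerivAt (a := 0) (b := 1)
      (f := fun τ => g (τ * p.1, p.2)) (f' := fun τ => p.1 * pdx g (τ * p.1, p.2)) (fun τ _ => ?_)
      (Continuous.intervalIntegrable (by fun_prop) _ _)
    · rw [intervalIntegral.integral_const_mul] at this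
      simp only [one_mul, zero_mul, Prod.mk.eta] at this
      linarith
    · have h1 : HasDerivAt (fun τ : ℝ => (τ * p.1, p.2)) (p.1, (0 : ℝ)) τ := by
        have := ((hasDerivAt_id τ).mul_const p.1).prodMk (hasDerivAt_const τ p.2)
        simpa using this
      have h2 := (hd (τ * p.1, p.2)).hasFDerivAt.comp_hasDerivAt τ h1
      rw [fderiv_eq_pd (hd _)] at h2
      rw [zero_mul, add_zero] at h2
      exact h2

/-- Hadamard at the origin. -/
theorem hadamard2 {g : ℝ × ℝ → ℝ} (h : ContDiff ℝ (⊤ : ℕ∞) g) :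
    ∃ a b : ℝ × ℝ → ℝ, ContDiff ℝ (⊤ : ℕ∞) a ∧ ContDiff ℝ (⊤ : ℕ∞) b ∧
      ∀ p : ℝ × ℝ, g p = g 0 + (p.1 * a p + p.2 * b p) := by
  have hx : ContDiff ℝ (⊤ : ℕ∞) (pdx g) := pdx_cd h (by norm_cast)
  have hy : ContDiff ℝ (⊤ : ℕ∞) (pdy g) := pdy_cd h (by norm_cast)
  have hd : Differentiable ℝ g := h.differentiable (by norm_cast)
  refine ⟨fun p => ∫ τ in (0:ℝ)..1, pdx g (τ * p.1, τ * p.2),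
    fun p => ∫ τ in (0:ℝ)..1, pdy g (τ * p.1, τ * p.2), ?_, ?_, fun p => ?_⟩
  · exact contDiff_infty.2 fun n => pint_contDiff n (F := fun q => pdx g (q.1 * q.2.1, q.1 * q.2.2))
      ((contDiff_infty.1 hx n).comp (by fun_prop))
  · exact contDiff_infty.2 fun n => pint_contDiff n (F := fun q => pdy g (q.1 * q.2.1, q.1 * q.2.2))
      ((contDiff_infty.1 hy n).comp (by fun_prop))
  · have hc := hx.continuous
    have hc' := hy.continuous
    have := intervalIntegral.integral_eq_sub_of_hasDerivAt (a := 0) (b := 1)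
      (f := fun τ => g (τ * p.1, τ * p.2))
      (f' := fun τ => p.1 * pdx g (τ * p.1, τ * p.2) + p.2 * pdy g (τ * p.1, τ * p.2)) (fun τ _ => ?_)
      (Continuous.intervalIntegrable (by fun_prop) _ _)
    · rw [intervalIntegral.integral_add (Continuous.intervalIntegrable (by fun_prop) _ _)
        (Continuous.intervalIntegrable (by fun_prop) _ _), intervalIntegral.integral_const_mul,
        intervalIntegral.integral_const_mul] at this
      simp only [one_mul, zero_mul, Prod.mk.eta] at this
      have e : ((0:ℝ), (0:ℝ)) = 0 := rfl
      rw [e] at this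
      linarith
    · have h1 : HasDerivAt (fun τ : ℝ => (τ * p.1, τ * p.2)) (p.1, p.2) τ := by
        have := ((hasDerivAt_id τ).mul_const p.1).prodMk ((hasDerivAt_id τ).mul_const p.2)
        simpa using this
      have h2 := (hd (τ * p.1, τ * p.2)).hasFDerivAt.comp_hasDerivAt τ h1
      rw [fderiv_eq_pd (hd _)] at h2
      exact h2

/-- powers of the maximal ideal -/
def IdM : ℕ → (ℝ × ℝ → ℝ) → Prop
  | 0, g => ContDiff ℝ (⊤ : ℕ∞) g
  | m + 1, g => ∃ a b, IdM m a ∧ IdM m b ∧ g = fun p => p.1 * a p + p.2 * b p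

theorem IdM.cd : ∀ {m : ℕ} {g : ℝ × ℝ → ℝ}, IdM m g → ContDiff ℝ (⊤ : ℕ∞) g
  | 0, _, h => h
  | m + 1, _, ⟨a, b, ha, hb, e⟩ => by
    have := ha.cd
    have := hb.cd
    rw [e]; fun_prop

theorem IdM.add : ∀ {m : ℕ} {g h : ℝ × ℝ → ℝ}, IdM m g → IdM m h → IdM m (fun p => g p + h p)
  | 0, _, _, h, h' => ContDiff.add h h'
  | m + 1, _, _, ⟨a, b, ha, hb, e⟩, ⟨a', b', ha', hb', e'⟩ =>
    ⟨_, _, ha.add ha', hb.add hb', by rw [e, e']; funext p; ring⟩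

theorem IdM.pdx : ∀ {m : ℕ} {g : ℝ × ℝ → ℝ}, IdM (m + 1) g → IdM m (pdx g) ∧ IdM m (pdy g)
  | 0, _, h => ⟨pdx_cd h.cd (by norm_cast), pdy_cd h.cd (by norm_cast)⟩
  | m + 1, g, ⟨a, b, ha, hb, e⟩ => by
    have ha1 := ha.pdx
    have hb1 := hb.pdx
    have da : Differentiable ℝ a := ha.cd.differentiable (by norm_cast)
    have db : Differentiable ℝ b := hb.cd.differentiable (by norm_cast)
    have hx : _root_.pdx g = fun p => a p + (p.1 * _root_.pdx a p + p.2 * _root_.pdx b p) := by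
      funext p
      rw [e]
      have d1 : HasDerivAt (fun s => a (s, p.2)) (_root_.pdx a p) p.1 :=
        DifferentiableAt.hasDerivAt (f := fun s => a (s, p.2))
          ((da _).comp p.1 (f := fun s : ℝ => (s, p.2)) (by fun_prop))
      have d2 : HasDerivAt (fun s => b (s, p.2)) (_root_.pdx b p) p.1 :=
        DifferentiableAt.hasDerivAt (f := fun s => b (s, p.2))
          ((db _).comp p.1 (f := fun s : ℝ => (s, p.2)) (by fun_prop))
      have := (((hasDerivAt_id p.1).mul d1).add (d2.const_mul p.2)).deriv
      refine Eq.trans this ?_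
      simp; ring
    have hy : _root_.pdy g = fun p => b p + (p.1 * _root_.pdy a p + p.2 * _root_.pdy b p) := by
      funext p
      rw [e]
      have d1 : HasDerivAt (fun s => a (p.1, s)) (_root_.pdy a p) p.2 :=
        DifferentiableAt.hasDerivAt (f := fun s => a (p.1, s))
          ((da _).comp p.2 (f := fun s : ℝ => (p.1, s)) (by fun_prop))
      have d2 : HasDerivAt (fun s => b (p.1, s)) (_root_.pdy b p) p.2 :=
        DifferentiableAt.hasDerivAt (f := fun s => b (p.1, s))
          ((db _).comp p.2 (f := fun s : ℝ => (p.1, s)) (by fun_prop))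
      have := ((d1.const_mul p.1).add ((hasDerivAt_id p.2).mul d2)).deriv
      refine Eq.trans this ?_
      simp; ring
    rw [hx, hy]
    exact ⟨ha.add ⟨_, _, ha1.1, hb1.1, rfl⟩, hb.add ⟨_, _, ha1.2, hb1.2, rfl⟩⟩

theorem fst_bigO : (fun p : ℝ × ℝ => p.1) =O[nhds 0] fun p => ‖p‖ :=
  IsBigO.of_bound 1 (Eventually.of_forall fun p => by simpa using norm_fst_le p)
theorem snd_bigO : (fun p : ℝ × ℝ => p.2) =O[nhds 0] fun p => ‖p‖ :=
  IsBigO.of_bound 1 (Eventually.of_forall fun p => by simpa using norm_snd_le p)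

theorem IdM.bigO : ∀ {m : ℕ} {g : ℝ × ℝ → ℝ}, IdM m g → g =O[nhds 0] fun p => ‖p‖ ^ m
  | 0, g, h => by
    simpa using (h.cd.continuous.continuousAt (x := 0)).isBigO_one ℝ
  | m + 1, g, ⟨a, b, ha, hb, e⟩ => by
    rw [e]
    simp only [pow_succ']
    exact (fst_bigO.mul ha.bigO).add (snd_bigO.mul hb.bigO)

theorem pow_littleO (m : ℕ) : (fun p : ℝ × ℝ => ‖p‖ ^ (m + 1)) =o[nhds 0] fun p => ‖p‖ ^ m := by
  have h1 : (fun p : ℝ × ℝ => ‖p‖) =o[nhds 0] fun _ => (1:ℝ) := by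
    rw [isLittleO_one_iff]
    simpa using (continuous_norm (E := ℝ × ℝ)).tendsto 0
  have := (isBigO_refl (fun p : ℝ × ℝ => ‖p‖ ^ m) (nhds 0)).mul_isLittleO h1
  simpa [pow_succ] using this

theorem poly_zero : ∀ (m : ℕ) (p : Polynomial ℝ), p.natDegree ≤ m →
    (fun t : ℝ => p.eval t) =o[nhdsWithin 0 {0}ᶜ] (fun t => t ^ m) → p = 0
  | m, p, hd, ho => by
    have h0 : p.coeff 0 = 0 := by
      have h1 : Tendsto (fun t : ℝ => p.eval t) (nhdsWithin 0 {0}ᶜ) (nhds 0) := by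
        have hb : (fun t : ℝ => t ^ m) =O[nhdsWithin 0 {0}ᶜ] fun _ => (1:ℝ) := by
          have : ContinuousAt (fun t : ℝ => t ^ m) 0 := by fun_prop
          exact (this.isBigO_one ℝ).mono nhdsWithin_le_nhds
        exact (isLittleO_one_iff ℝ).1 (ho.trans_isBigO hb)
      have h2 : Tendsto (fun t : ℝ => p.eval t) (nhdsWithin 0 {0}ᶜ) (nhds (p.eval 0)) :=
        (p.continuous.tendsto 0).mono_left nhdsWithin_le_nhds
      rw [Polynomial.coeff_zero_eq_eval_zero]
      exact tendsto_nhds_unique h2 h1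
    have hX := Polynomial.divX_mul_X_add p
    rw [h0, map_zero, add_zero] at hX
    cases m with
    | zero =>
      rw [Polynomial.eq_C_of_natDegree_le_zero hd, h0, map_zero]
    | succ m =>
      have := poly_zero m p.divX (by rw [Polynomial.natDegree_divX_eq_natDegree_tsub_one]; omega) ?_
      · rw [← hX, this, zero_mul]
      · have h3 := (isBigO_refl (fun t : ℝ => t⁻¹) (nhdsWithin 0 {0}ᶜ)).mul_isLittleO ho
        refine h3.congr' ?_ ?_
        · filter_upwards [self_mem_nhdsWithin] with t ht
          have ht : t ≠ 0 := ht
          conv_lhs => rw [← hX]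
          simp
          field_simp
        · filter_upwards [self_mem_nhdsWithin] with t ht
          have ht : t ≠ 0 := ht
          field_simp
          ring

/-- functions polynomial of degree at most `m` on lines -/
def PolyFn (m : ℕ) (Q : ℝ × ℝ → ℝ) : Prop :=
  ∀ v : ℝ × ℝ, ∃ p : Polynomial ℝ, p.natDegree ≤ m ∧ ∀ t : ℝ, Q (t • v) = p.eval t

theorem taylor_split : ∀ (m : ℕ) {g : ℝ × ℝ → ℝ}, ContDiff ℝ (⊤ : ℕ∞) g →
    ∃ Q R, PolyFn m Q ∧ IdM (m + 1) R ∧ ∀ p, g p = Q p + R p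
  | 0, g, h => by
    obtain ⟨a, b, ha, hb, e⟩ := hadamard2 h
    exact ⟨fun _ => g 0, _, fun v => ⟨Polynomial.C (g 0), by simp, by simp⟩, ⟨a, b, ha, hb, rfl⟩, e⟩
  | m + 1, g, h => by
    obtain ⟨a, b, ha, hb, e⟩ := hadamard2 h
    obtain ⟨Q, R, hQ, hR, e1⟩ := taylor_split m ha
    obtain ⟨Q', R', hQ', hR', e2⟩ := taylor_split m hb
    refine ⟨fun p => g 0 + (p.1 * Q p + p.2 * Q' p), _, fun v => ?_, ⟨R, R', hR, hR', rfl⟩, fun p => ?_⟩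
    · obtain ⟨q, hq, hv⟩ := hQ v
      obtain ⟨q', hq', hv'⟩ := hQ' v
      refine ⟨Polynomial.C (g 0) + Polynomial.X * (Polynomial.C v.1 * q + Polynomial.C v.2 * q'), ?_, fun t => ?_⟩
      · refine (Polynomial.natDegree_C_add).le.trans ?_
        refine Polynomial.natDegree_mul_le.trans ?_
        have h1 := Polynomial.natDegree_C_mul_le v.1 q
        have h2 := Polynomial.natDegree_C_mul_le v.2 q'
        have h3 := Polynomial.natDegree_add_le (Polynomial.C v.1 * q) (Polynomial.C v.2 * q')
        have h4 := max_le (h1.trans hq) (h2.trans hq')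
        have h5 := Polynomial.natDegree_X_le (R := ℝ)
        omega
      · simp only [hv, hv']
        simp
        ring
    · rw [e, e1, e2]; ring

theorem IdM_of_littleO {m : ℕ} {g : ℝ × ℝ → ℝ} (h : ContDiff ℝ (⊤ : ℕ∞) g)
    (ho : g =o[nhds 0] fun p => ‖p‖ ^ m) : IdM (m + 1) g := by
  obtain ⟨Q, R, hQ, hR, e⟩ := taylor_split m h
  have hQo : Q =o[nhds 0] fun p => ‖p‖ ^ m := by
    have := ho.sub (hR.bigO.trans_isLittleO (pow_littleO m))
    refine this.congr (fun p => ?_) (fun _ => rfl)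
    rw [e]; ring
  have : Q = 0 := by
    funext v
    obtain ⟨p, hp, hv⟩ := hQ v
    have ht : Tendsto (fun t : ℝ => t • v) (nhdsWithin 0 {0}ᶜ) (nhds 0) := by
      have : Continuous fun t : ℝ => t • v := by fun_prop
      simpa using (this.tendsto 0).mono_left nhdsWithin_le_nhds
    have h1 := hQo.comp_tendsto ht
    have h2 : p = 0 := by
      refine poly_zero m p hp ?_
      refine (h1.congr_left (f₂ := fun t => p.eval t) fun t => hv t).trans_isBigO ?_
      refine IsBigO.of_bound (‖v‖ ^ m) (Eventually.of_forall fun t => ?_)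
      simp [norm_smul, mul_pow, mul_comm]
    have := hv 1
    rw [one_smul, h2] at this
    simpa using this
  have : g = R := by funext p; rw [e, this]; simp
  rw [this]; exact hR

theorem pdx_sub {f P : ℝ × ℝ → ℝ} (hf : Differentiable ℝ f) (hP : Differentiable ℝ P) (p : ℝ × ℝ) :
    pdx (fun p => f p - P p) p = pdx f p - pdx P p ∧ pdy (fun p => f p - P p) p = pdy f p - pdy P p := by
  rw [pdx_eq (hf p), pdx_eq (hP p), pdx_eq ((hf p).fun_sub (hP p)), pdy_eq (hf p), pdy_eq (hP p),
    pdy_eq ((hf p).fun_sub (hP p)), fderiv_fun_sub (hf p) (hP p)]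
  exact ⟨rfl, rfl⟩

theorem jet_pd {f P : ℝ × ℝ → ℝ} {k : ℕ} (hf : ContDiff ℝ (⊤ : ℕ∞) f) (hP : ContDiff ℝ (⊤ : ℕ∞) P)
    (h : HasJetAt0 f P (k + 1)) : HasJetAt0 (pdx f) (pdx P) k ∧ HasJetAt0 (pdy f) (pdy P) k := by
  have h1 := (IdM_of_littleO (hf.sub hP) h).pdx
  have e := pdx_sub (hf.differentiable (by norm_cast)) (hP.differentiable (by norm_cast))
  have b1 := h1.1.bigO.trans_isLittleO (pow_littleO k)
  have b2 := h1.2.bigO.trans_isLittleO (pow_littleO k)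
  exact ⟨b1.congr_left fun p => (e p).1, b2.congr_left fun p => (e p).2⟩

theorem quad_bigO {A B C : ℝ × ℝ → ℝ} (hA : Continuous A) (hB : Continuous B) (hC : Continuous C) :
    (fun p : ℝ × ℝ => A p * p.1 ^ 2 + B p * (p.1 * p.2) + C p * p.2 ^ 2) =O[nhds 0] fun p => ‖p‖ ^ 2 := by
  have h1 := fst_bigO.pow 2
  have h2 := snd_bigO.pow 2
  have h3 : (fun p : ℝ × ℝ => p.1 * p.2) =O[nhds 0] fun p => ‖p‖ ^ 2 :=
    (fst_bigO.mul snd_bigO).congr_right fun p => (sq _).symm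
  have e : ∀ {F : ℝ × ℝ → ℝ}, Continuous F → F =O[nhds 0] fun _ => (1:ℝ) := fun h => (h.tendsto 0).isBigO_one ℝ
  have := (((e hA).mul h1).add ((e hB).mul h3)).add ((e hC).mul h2)
  simpa using this

theorem quad_littleO {A B C : ℝ × ℝ → ℝ} (hA : Continuous A) (hB : Continuous B) (hC : Continuous C)
    (hA0 : A 0 = 0) (hB0 : B 0 = 0) (hC0 : C 0 = 0) :
    (fun p : ℝ × ℝ => A p * p.1 ^ 2 + B p * (p.1 * p.2) + C p * p.2 ^ 2) =o[nhds 0] fun p => ‖p‖ ^ 2 := by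
  have h1 := fst_bigO.pow 2
  have h2 := snd_bigO.pow 2
  have h3 : (fun p : ℝ × ℝ => p.1 * p.2) =O[nhds 0] fun p => ‖p‖ ^ 2 :=
    (fst_bigO.mul snd_bigO).congr_right fun p => (sq _).symm
  have e : ∀ {F : ℝ × ℝ → ℝ}, Continuous F → F 0 = 0 → F =o[nhds 0] fun _ => (1:ℝ) := fun h h0 => by
    rw [isLittleO_one_iff]; simpa [h0] using h.tendsto 0
  have := (((e hA hA0).mul_isBigO h1).add ((e hB hB0).mul_isBigO h3)).add ((e hC hC0).mul_isBigO h2)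
  simpa using this

/-- cubic 3-jet polynomial of `f_xx` -/
def Pxx (ε α c50 c41 c32 c23 : ℝ) (p : ℝ × ℝ) : ℝ :=
  12 * ε * p.1 ^ 2 + 6 * α * (p.1 * p.2) + 3 / 4 * ε * α ^ 2 * p.2 ^ 2 + 20 * c50 * p.1 ^ 3 + 12 * c41 * p.1 ^ 2 * p.2
    + 6 * c32 * p.1 * p.2 ^ 2 + 2 * c23 * p.2 ^ 3

theorem jets (ε α c50 c41 c32 c23 c14 c05 : ℝ)
    (f : ℝ × ℝ → ℝ) (hf : ContDiff ℝ (⊤ : ℕ∞) f)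
    (hjet : HasJetAt0 f
      (fun p => p.2 ^ 2 + ε * p.1 ^ 4 + α * p.1 ^ 3 * p.2 +
        ε * (3 / 8) * α ^ 2 * p.1 ^ 2 * p.2 ^ 2 +
        c50 * p.1 ^ 5 + c41 * p.1 ^ 4 * p.2 + c32 * p.1 ^ 3 * p.2 ^ 2 +
        c23 * p.1 ^ 2 * p.2 ^ 3 + c14 * p.1 * p.2 ^ 4 + c05 * p.2 ^ 5) 5) :
    HasJetAt0 (fxx f) (Pxx ε α c50 c41 c32 c23) 3 ∧
    (fxy f =O[nhds 0] fun p => ‖p‖ ^ 2) ∧ ((fun p => fyy f p - 2) =O[nhds 0] fun p => ‖p‖ ^ 2) ∧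
    HasJetAt0 (bdeDiscr f) (fun p => -2 * Pxx ε α c50 c41 c32 c23 p) 3 := by
  obtain ⟨jx, jy⟩ := jet_pd hf (by fun_prop) hjet
  have ex : pdx (fun p : ℝ × ℝ => p.2 ^ 2 + ε * p.1 ^ 4 + α * p.1 ^ 3 * p.2 +
        ε * (3 / 8) * α ^ 2 * p.1 ^ 2 * p.2 ^ 2 +
        c50 * p.1 ^ 5 + c41 * p.1 ^ 4 * p.2 + c32 * p.1 ^ 3 * p.2 ^ 2 +
        c23 * p.1 ^ 2 * p.2 ^ 3 + c14 * p.1 * p.2 ^ 4 + c05 * p.2 ^ 5) =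
      fun p => 4 * ε * p.1 ^ 3 + 3 * α * p.1 ^ 2 * p.2 + 3 / 4 * ε * α ^ 2 * p.1 * p.2 ^ 2 + 5 * c50 * p.1 ^ 4
        + 4 * c41 * p.1 ^ 3 * p.2 + 3 * c32 * p.1 ^ 2 * p.2 ^ 2 + 2 * c23 * p.1 * p.2 ^ 3 + c14 * p.2 ^ 4 := by
    funext p
    simp only [pdx]
    have h (n : ℕ) : HasDerivAt (fun s : ℝ => s ^ n) (n * p.1 ^ (n-1)) p.1 := hasDerivAt_pow n _
    refine HasDerivAt.deriv (HasDerivAt.congr_deriv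
      ((((((((((hasDerivAt_const _ _).add ((h 4).const_mul ε)).add (((h 3).const_mul α).mul_const _)).add
        (((h 2).const_mul _).mul_const _)).add ((h 5).const_mul _)).add (((h 4).const_mul _).mul_const _)).add
        (((h 3).const_mul _).mul_const _)).add (((h 2).const_mul _).mul_const _)).add
        (((hasDerivAt_id _).const_mul _).mul_const _)).add (hasDerivAt_const _ _)) ?_)
    norm_num
    ring
  have ey : pdy (fun p : ℝ × ℝ => p.2 ^ 2 + ε * p.1 ^ 4 + α * p.1 ^ 3 * p.2 +
        ε * (3 / 8) * α ^ 2 * p.1 ^ 2 * p.2 ^ 2 +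
        c50 * p.1 ^ 5 + c41 * p.1 ^ 4 * p.2 + c32 * p.1 ^ 3 * p.2 ^ 2 +
        c23 * p.1 ^ 2 * p.2 ^ 3 + c14 * p.1 * p.2 ^ 4 + c05 * p.2 ^ 5) =
      fun p => 2 * p.2 + α * p.1 ^ 3 + 3 / 4 * ε * α ^ 2 * p.1 ^ 2 * p.2
        + c41 * p.1 ^ 4 + 2 * c32 * p.1 ^ 3 * p.2 + 3 * c23 * p.1 ^ 2 * p.2 ^ 2 + 4 * c14 * p.1 * p.2 ^ 3
        + 5 * c05 * p.2 ^ 4 := by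
    funext p
    simp only [pdy]
    have h (n : ℕ) : HasDerivAt (fun s : ℝ => s ^ n) (n * p.2 ^ (n-1)) p.2 := hasDerivAt_pow n _
    refine HasDerivAt.deriv (HasDerivAt.congr_deriv
      ((((((((((h 2).add (hasDerivAt_const _ _)).add ((hasDerivAt_id _).const_mul _)).add
        ((h 2).const_mul _)).add (hasDerivAt_const _ _)).add ((hasDerivAt_id _).const_mul _)).add
        ((h 2).const_mul _)).add ((h 3).const_mul _)).add
        ((h 4).const_mul _)).add ((h 5).const_mul _)) ?_)
    norm_num
    ring
  rw [ex] at jx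
  rw [ey] at jy
  have hfx : ContDiff ℝ (⊤ : ℕ∞) (pdx f) := pdx_cd hf (by norm_cast)
  have hfy : ContDiff ℝ (⊤ : ℕ∞) (pdy f) := pdy_cd hf (by norm_cast)
  obtain ⟨jxx, jxy⟩ := jet_pd hfx (by fun_prop) jx
  obtain ⟨-, jyy⟩ := jet_pd hfy (by fun_prop) jy
  have exx : pdx (fun p : ℝ × ℝ => 4 * ε * p.1 ^ 3 + 3 * α * p.1 ^ 2 * p.2 + 3 / 4 * ε * α ^ 2 * p.1 * p.2 ^ 2 + 5 * c50 * p.1 ^ 4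
        + 4 * c41 * p.1 ^ 3 * p.2 + 3 * c32 * p.1 ^ 2 * p.2 ^ 2 + 2 * c23 * p.1 * p.2 ^ 3 + c14 * p.2 ^ 4) =
      Pxx ε α c50 c41 c32 c23 := by
    funext p
    simp only [pdx, Pxx]
    have h (n : ℕ) : HasDerivAt (fun s : ℝ => s ^ n) (n * p.1 ^ (n-1)) p.1 := hasDerivAt_pow n _
    refine HasDerivAt.deriv (HasDerivAt.congr_deriv
      (((((((((h 3).const_mul _).add (((h 2).const_mul _).mul_const _)).add
        (((hasDerivAt_id _).const_mul _).mul_const _)).add ((h 4).const_mul _)).add (((h 3).const_mul _).mul_const _)).add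
        (((h 2).const_mul _).mul_const _)).add (((hasDerivAt_id _).const_mul _).mul_const _)).add
        (hasDerivAt_const _ _)) ?_)
    norm_num
    ring
  have exy : pdy (fun p : ℝ × ℝ => 4 * ε * p.1 ^ 3 + 3 * α * p.1 ^ 2 * p.2 + 3 / 4 * ε * α ^ 2 * p.1 * p.2 ^ 2 + 5 * c50 * p.1 ^ 4
        + 4 * c41 * p.1 ^ 3 * p.2 + 3 * c32 * p.1 ^ 2 * p.2 ^ 2 + 2 * c23 * p.1 * p.2 ^ 3 + c14 * p.2 ^ 4) =
      fun p => (3 * α + 4 * c41 * p.1) * p.1 ^ 2 + (3 / 2 * ε * α ^ 2 + 6 * c32 * p.1) * (p.1 * p.2)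
        + (6 * c23 * p.1 + 4 * c14 * p.2) * p.2 ^ 2 := by
    funext p
    simp only [pdy]
    have h (n : ℕ) : HasDerivAt (fun s : ℝ => s ^ n) (n * p.2 ^ (n-1)) p.2 := hasDerivAt_pow n _
    refine HasDerivAt.deriv (HasDerivAt.congr_deriv
      ((((((((hasDerivAt_const _ _).add ((hasDerivAt_id _).const_mul _)).add
        ((h 2).const_mul _)).add (hasDerivAt_const _ _)).add ((hasDerivAt_id _).const_mul _)).add
        ((h 2).const_mul _)).add ((h 3).const_mul _)).add ((h 4).const_mul _)) ?_)
    norm_num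
    ring
  have eyy : pdy (fun p : ℝ × ℝ => 2 * p.2 + α * p.1 ^ 3 + 3 / 4 * ε * α ^ 2 * p.1 ^ 2 * p.2
        + c41 * p.1 ^ 4 + 2 * c32 * p.1 ^ 3 * p.2 + 3 * c23 * p.1 ^ 2 * p.2 ^ 2 + 4 * c14 * p.1 * p.2 ^ 3
        + 5 * c05 * p.2 ^ 4) =
      fun p => 2 + ((3 / 4 * ε * α ^ 2 + 2 * c32 * p.1) * p.1 ^ 2 + (6 * c23 * p.1) * (p.1 * p.2)
        + (12 * c14 * p.1 + 20 * c05 * p.2) * p.2 ^ 2) := by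
    funext p
    simp only [pdy]
    have h (n : ℕ) : HasDerivAt (fun s : ℝ => s ^ n) (n * p.2 ^ (n-1)) p.2 := hasDerivAt_pow n _
    refine HasDerivAt.deriv (HasDerivAt.congr_deriv
      (((((((((hasDerivAt_id _).const_mul _).add (hasDerivAt_const _ _)).add ((hasDerivAt_id _).const_mul _)).add
        (hasDerivAt_const _ _)).add ((hasDerivAt_id _).const_mul _)).add
        ((h 2).const_mul _)).add ((h 3).const_mul _)).add ((h 4).const_mul _)) ?_)
    norm_num
    ring
  rw [exx] at jxx
  rw [exy] at jxy
  rw [eyy] at jyy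
  have j32 : ∀ {g : ℝ × ℝ → ℝ}, (g =o[nhds 0] fun p => ‖p‖ ^ 3) → g =O[nhds 0] fun p => ‖p‖ ^ 2 :=
    fun h => (h.trans (pow_littleO 2)).isBigO
  have oxy : fxy f =O[nhds 0] fun p => ‖p‖ ^ 2 := by
    refine ((j32 jxy).add (quad_bigO (A := fun p => (3 * α + 4 * c41 * p.1)) (B := fun p => (3 / 2 * ε * α ^ 2 + 6 * c32 * p.1))
      (C := fun p => (6 * c23 * p.1 + 4 * c14 * p.2)) (by fun_prop) (by fun_prop) (by fun_prop))).congr_left fun p => ?_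
    simp [fxy]
  have oyy : (fun p => fyy f p - 2) =O[nhds 0] fun p => ‖p‖ ^ 2 := by
    refine ((j32 jyy).add (quad_bigO (A := fun p => (3 / 4 * ε * α ^ 2 + 2 * c32 * p.1)) (B := fun p => (6 * c23 * p.1))
      (C := fun p => (12 * c14 * p.1 + 20 * c05 * p.2)) (by fun_prop) (by fun_prop) (by fun_prop))).congr_left fun p => ?_
    simp [fyy]; ring
  have oxx : fxx f =O[nhds 0] fun p => ‖p‖ ^ 2 := by
    refine ((j32 jxx).add (quad_bigO (A := fun p => 12 * ε + 20 * c50 * p.1 + 12 * c41 * p.2) (B := fun p => 6 * α + 6 * c32 * p.2)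
      (C := fun p => 3 / 4 * ε * α ^ 2 + 2 * c23 * p.2) (by fun_prop) (by fun_prop) (by fun_prop))).congr_left fun p => ?_
    simp [fxx, Pxx]; ring
  refine ⟨jxx, oxy, oyy, ?_⟩
  have h4 : ∀ {g h : ℝ × ℝ → ℝ}, (g =O[nhds 0] fun p => ‖p‖ ^ 2) → (h =O[nhds 0] fun p => ‖p‖ ^ 2) →
      (fun p => g p * h p) =o[nhds 0] fun p => ‖p‖ ^ 3 := fun hg hh =>
    ((hg.mul hh).congr_right fun p => by rw [← pow_add]).trans_isLittleO (pow_littleO 3)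
  refine (((h4 oxy oxy).sub (h4 oxx oyy)).sub (jxx.const_mul_left 2)).congr_left fun p => ?_
  simp only [bdeDiscr, fxx]
  ring

theorem jet_val {g P : ℝ × ℝ → ℝ} {k : ℕ} (h : HasJetAt0 g P k) : g 0 = P 0 := by
  have : ∀ c : ℝ, 0 < c → ‖g 0 - P 0‖ ≤ c := fun c hc => by
    have h1 := (h.def hc).self_of_nhds
    refine h1.trans ?_
    rcases k with _ | k <;> simp [hc.le]
  have h2 : ‖g 0 - P 0‖ ≤ 0 := le_of_forall_gt_imp_ge_of_dense fun c hc => this c hc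
  exact sub_eq_zero.1 (norm_le_zero_iff.1 h2)

/-- linear-quadratic jet of `δ_x` -/
def Qx (ε α c50 c41 c32 : ℝ) (p : ℝ × ℝ) : ℝ :=
  -12 * (4 * ε * p.1 + α * p.2) - 12 * (10 * c50 * p.1 ^ 2 + 4 * c41 * (p.1 * p.2) + c32 * p.2 ^ 2)

theorem discr_facts {ε α c50 c41 c32 c23 : ℝ} (hε : ε = 1 ∨ ε = -1) {δ : ℝ × ℝ → ℝ} (hδ : ContDiff ℝ (⊤ : ℕ∞) δ)
    (h : HasJetAt0 δ (fun p => -2 * Pxx ε α c50 c41 c32 c23 p) 3) :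
    δ 0 = 0 ∧ pdx δ 0 = 0 ∧ pdy δ 0 = 0 ∧
    HasJetAt0 δ (fun p => -(3 * ε / 2) * (4 * p.1 + ε * α * p.2) ^ 2) 2 ∧
    HasJetAt0 (pdx δ) (Qx ε α c50 c41 c32) 2 ∧
    pdx (pdx δ) 0 = -48 * ε ∧ pdy (pdx δ) 0 = -12 * α := by
  have hε2 : ε ^ 2 = 1 := by rcases hε with rfl | rfl <;> norm_num
  have hP : ContDiff ℝ (⊤ : ℕ∞) (fun p => -2 * Pxx ε α c50 c41 c32 c23 p) := by unfold Pxx; fun_prop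
  obtain ⟨jx, jy⟩ := jet_pd hδ hP h
  have ex : pdx (fun p => -2 * Pxx ε α c50 c41 c32 c23 p) = Qx ε α c50 c41 c32 := by
    funext p
    simp only [pdx, Pxx, Qx]
    have h (n : ℕ) : HasDerivAt (fun s : ℝ => s ^ n) (n * p.1 ^ (n-1)) p.1 := hasDerivAt_pow n _
    refine HasDerivAt.deriv (HasDerivAt.congr_deriv
      (HasDerivAt.const_mul _ (((((((h 2).const_mul _).add (((hasDerivAt_id _).mul_const _).const_mul _)).add
        (hasDerivAt_const _ _)).add ((h 3).const_mul _)).add (((h 2).const_mul _).mul_const _)).add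
        (((hasDerivAt_id _).const_mul _).mul_const _) |>.add (hasDerivAt_const _ _))) ?_)
    norm_num
    ring
  have ey : pdy (fun p => -2 * Pxx ε α c50 c41 c32 c23 p) 0 = 0 := by
    simp only [pdy, Pxx]
    have h (n : ℕ) : HasDerivAt (fun s : ℝ => s ^ n) (n * (0:ℝ) ^ (n-1)) 0 := hasDerivAt_pow n _
    refine HasDerivAt.deriv (HasDerivAt.congr_deriv
      (HasDerivAt.const_mul _ (((((((hasDerivAt_const _ _).add (((hasDerivAt_id _).const_mul _).const_mul _)).add
        ((h 2).const_mul _)).add (hasDerivAt_const _ _)).add ((hasDerivAt_id _).const_mul _)).add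
        ((h 2).const_mul _)) |>.add ((h 3).const_mul _))) ?_)
    norm_num
  rw [ex] at jx
  have hδx : ContDiff ℝ (⊤ : ℕ∞) (pdx δ) := pdx_cd hδ (by norm_cast)
  have hQ : ContDiff ℝ (⊤ : ℕ∞) (Qx ε α c50 c41 c32) := by unfold Qx; fun_prop
  obtain ⟨jxx, jxy⟩ := jet_pd hδx hQ jx
  refine ⟨?_, ?_, ?_, ?_, jx, ?_, ?_⟩
  · rw [jet_val h]; simp [Pxx]
  · rw [jet_val jx]; simp [Qx]
  · rw [jet_val jy]; exact ey
  · refine ((h.trans (pow_littleO 2)).add (quad_littleO (A := fun p => -2 * (20 * c50 * p.1 + 12 * c41 * p.2))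
      (B := fun p => -2 * (6 * c32 * p.2)) (C := fun p => -2 * (2 * c23 * p.2)) (by fun_prop) (by fun_prop) (by fun_prop)
      (by simp) (by simp) (by simp))).congr_left fun p => ?_
    simp only [Pxx]
    linear_combination -(12 * α * p.1 * p.2 + 3/2 * ε * α^2 * p.2^2) * hε2
  · rw [jet_val jxx]
    simp only [pdx, Qx]
    have h (n : ℕ) : HasDerivAt (fun s : ℝ => s ^ n) (n * (0:ℝ) ^ (n-1)) 0 := hasDerivAt_pow n _
    refine HasDerivAt.deriv (HasDerivAt.congr_deriv (HasDerivAt.sub (HasDerivAt.const_mul _ (((hasDerivAt_id _).const_mul _).add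
      (hasDerivAt_const _ _))) (HasDerivAt.const_mul _ ((((h 2).const_mul _).add (((hasDerivAt_id _).mul_const _).const_mul _)).add
        (hasDerivAt_const _ _)))) ?_)
    norm_num
    ring
  · rw [jet_val jxy]
    simp only [pdy, Qx]
    have h (n : ℕ) : HasDerivAt (fun s : ℝ => s ^ n) (n * (0:ℝ) ^ (n-1)) 0 := hasDerivAt_pow n _
    refine HasDerivAt.deriv (HasDerivAt.congr_deriv (HasDerivAt.sub (HasDerivAt.const_mul _ ((hasDerivAt_const _ _).add
      ((hasDerivAt_id _).const_mul _))) (HasDerivAt.const_mul _ (((hasDerivAt_const _ _).add (((hasDerivAt_id _).const_mul _).const_mul _)).add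
        ((h 2).const_mul _)))) ?_)
    norm_num

theorem ift {Ψ : ℝ × ℝ → ℝ × ℝ} {n : ℕ} (hn : n ≠ 0) (h : ContDiffAt ℝ n Ψ 0) (h0 : Ψ 0 = 0) {a b d : ℝ}
    (ha : a ≠ 0) (hd : d ≠ 0) (hv : ∀ v : ℝ × ℝ, fderiv ℝ Ψ 0 v = (a * v.1 + b * v.2, d * v.2)) :
    ∃ (Φ : ℝ × ℝ → ℝ × ℝ) (U V : Set (ℝ × ℝ)), IsOpen U ∧ IsOpen V ∧ (0 : ℝ × ℝ) ∈ U ∧ (0 : ℝ × ℝ) ∈ V ∧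
      (∀ x ∈ U, ContDiffAt ℝ n Ψ x) ∧ (∀ y ∈ V, ContDiffAt ℝ n Φ y) ∧ MapsTo Ψ U V ∧ MapsTo Φ V U ∧
      (∀ x ∈ U, Φ (Ψ x) = x) ∧ (∀ y ∈ V, Ψ (Φ y) = y) ∧ Φ 0 = 0 := by
  have hn' : (n : WithTop ℕ∞) ≠ 0 := by exact_mod_cast hn
  let L : (ℝ × ℝ) ≃L[ℝ] (ℝ × ℝ) := ContinuousLinearEquiv.equivOfInverse (fderiv ℝ Ψ 0)
    (((a⁻¹ • (ContinuousLinearMap.fst ℝ ℝ ℝ - (b * d⁻¹) • ContinuousLinearMap.snd ℝ ℝ ℝ))).prod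
      (d⁻¹ • ContinuousLinearMap.snd ℝ ℝ ℝ))
    (fun v => by rw [hv]; ext <;> simp <;> field_simp <;> ring)
    (fun v => by rw [hv]; ext <;> simp <;> field_simp <;> ring)
  have hL : HasFDerivAt Ψ (L : (ℝ × ℝ) →L[ℝ] (ℝ × ℝ)) 0 := (h.differentiableAt hn').hasFDerivAt
  let e := h.toOpenPartialHomeomorph Ψ hL hn'
  have he : ∀ x, e x = Ψ x := fun x => rfl
  have hs : (0 : ℝ × ℝ) ∈ e.source := h.mem_toOpenPartialHomeomorph_source hL hn'
  have hΦ : ContDiffAt ℝ n e.symm 0 := by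
    have := h.to_localInverse hL hn'
    rw [h0] at this
    exact this
  have h1 := h.eventually (by simp)
  have h2 := hΦ.eventually (by simp)
  obtain ⟨U1, hU1, oU1, mU1⟩ := eventually_nhds_iff.1 h1
  obtain ⟨V1, hV1, oV1, mV1⟩ := eventually_nhds_iff.1 h2
  have e0 : e.symm 0 = 0 := by
    have := e.left_inv hs
    rwa [he, h0] at this
  have ht : (0 : ℝ × ℝ) ∈ e.target := by have := e.map_source hs; rwa [he, h0] at this
  refine ⟨e.symm, U1 ∩ (e.source ∩ e ⁻¹' V1), V1 ∩ (e.target ∩ e.symm ⁻¹' U1), oU1.inter (e.isOpen_inter_preimage oV1),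
    oV1.inter (e.isOpen_inter_preimage_symm oU1), ⟨mU1, hs, ?_⟩, ⟨mV1, ht, ?_⟩, fun x hx => hU1 x hx.1,
    fun y hy => hV1 y hy.1, ?_, ?_, fun x hx => e.left_inv hx.2.1, fun y hy => e.right_inv hy.2.1, e0⟩
  · rw [mem_preimage, he, h0]; exact mV1
  · rw [mem_preimage, e0]; exact mU1
  · rintro x ⟨hx, hx1, hx2⟩
    exact ⟨hx2, e.map_source hx1, by rw [mem_preimage, ← he, e.left_inv hx1]; exact hx⟩
  · rintro y ⟨hy, hy1, hy2⟩
    exact ⟨hy2, e.map_target hy1, by rw [mem_preimage, e.right_inv hy1]; exact hy⟩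

theorem exists_global {g : ℝ → ℝ} {n : ℕ} (h : ContDiffAt ℝ n g 0) :
    ∃ G : ℝ → ℝ, ContDiff ℝ n G ∧ G =ᶠ[nhds 0] g := by
  obtain ⟨R, hR, hg⟩ := Metric.eventually_nhds_iff_ball.1 (h.eventually (by simp))
  let b : ContDiffBump (0 : ℝ) := ⟨R / 4, R / 2, by positivity, by linarith⟩
  refine ⟨fun x => b x * g x, contDiff_iff_contDiffAt.2 fun x => ?_, ?_⟩
  · by_cases hx : x ∈ Metric.ball (0:ℝ) R
    · exact b.contDiff.contDiffAt.mul (hg x hx)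
    · have : (fun x => b x * g x) =ᶠ[nhds x] fun _ => 0 := by
        have hx' : x ∈ (Metric.closedBall (0:ℝ) (R / 2))ᶜ := fun h => hx (Metric.closedBall_subset_ball (by linarith) h)
        filter_upwards [Metric.isClosed_closedBall.isOpen_compl.mem_nhds hx'] with y hy
        have : b y = 0 := b.zero_of_le_dist (by
          have : ¬ dist y 0 ≤ R / 2 := hy
          exact (not_le.1 this).le)
        rw [this, zero_mul]
      exact contDiffAt_const.congr_of_eventuallyEq this
  · filter_upwards [b.eventuallyEq_one] with x hx
    rw [hx]; simp

theorem hadamard_one {k : ℝ → ℝ} {n : ℕ} (h : ContDiff ℝ (n + 1 : ℕ) k) (h0 : k 0 = 0) :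
    ∃ H : ℝ → ℝ, ContDiff ℝ n H ∧ ∀ y, k y = y * H y := by
  obtain ⟨H, hH, e⟩ := hadamard1 (g := fun p : ℝ × ℝ => k p.1) (h.comp contDiff_fst)
  refine ⟨fun y => H (y, 0), hH.comp (contDiff_id.prodMk contDiff_const), fun y => ?_⟩
  have := e (y, 0)
  simpa [h0] using this

theorem divide_pow : ∀ (j n : ℕ) {m : ℝ → ℝ}, ContDiff ℝ (n + j : ℕ) m →
    (m =o[nhdsWithin 0 {0}ᶜ] fun y => y ^ j) → ∃ M : ℝ → ℝ, ContDiff ℝ n M ∧ M 0 = 0 ∧ ∀ y, m y = y ^ j * M y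
  | 0, n, m, h, ho => by
    refine ⟨m, h, ?_, fun y => by simp⟩
    have h1 : Tendsto m (nhdsWithin 0 {0}ᶜ) (nhds 0) := by
      simpa using ho
    exact tendsto_nhds_unique ((h.continuous.tendsto 0).mono_left nhdsWithin_le_nhds) h1
  | j + 1, n, m, h, ho => by
    have h1 : Tendsto m (nhdsWithin 0 {0}ᶜ) (nhds 0) := by
      refine ho.isBigO.trans_tendsto ?_
      have : Tendsto (fun y : ℝ => y ^ (j+1)) (nhds 0) (nhds 0) := by
        have := (continuous_pow (M := ℝ) (j+1)).tendsto 0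
        simpa using this
      exact this.mono_left nhdsWithin_le_nhds
    have h0 : m 0 = 0 := tendsto_nhds_unique ((h.continuous.tendsto 0).mono_left nhdsWithin_le_nhds) h1
    obtain ⟨H, hH, e⟩ := hadamard_one (n := n + j) h h0
    obtain ⟨M, hM, hM0, e'⟩ := divide_pow j n (m := H) hH (by
      refine ((isBigO_refl (fun t : ℝ => t⁻¹) (nhdsWithin 0 {0}ᶜ)).mul_isLittleO ho).congr' ?_ ?_
      · filter_upwards [self_mem_nhdsWithin] with t ht
        have ht : t ≠ 0 := ht
        rw [e]; field_simp
      · filter_upwards [self_mem_nhdsWithin] with t ht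
        have ht : t ≠ 0 := ht
        field_simp
        ring)
    exact ⟨M, hM, hM0, fun y => by rw [e, e']; ring⟩

/-- the critical curve of `δ(·, y)` -/
theorem exists_xi {δ : ℝ × ℝ → ℝ} (hδ : ContDiff ℝ (⊤ : ℕ∞) δ) (h0 : pdx δ 0 = 0) (h1 : pdx (pdx δ) 0 ≠ 0) (n : ℕ)
    (hn : n ≠ 0) : ∃ ξ : ℝ → ℝ, ContDiff ℝ n ξ ∧ ξ 0 = 0 ∧ ∀ᶠ y in nhds 0, pdx δ (ξ y, y) = 0 := by
  have hδx : ContDiff ℝ (⊤ : ℕ∞) (pdx δ) := pdx_cd hδ (by norm_cast)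
  have hΘ : ContDiff ℝ n (fun p : ℝ × ℝ => (pdx δ p, p.2)) :=
    (hδx.of_le (by exact_mod_cast le_top)).prodMk contDiff_snd
  obtain ⟨Φ, U, V, oU, oV, mU, mV, -, hΦ, -, -, -, hr, hΦ0⟩ := ift (Ψ := fun p : ℝ × ℝ => (pdx δ p, p.2)) hn hΘ.contDiffAt
    (by ext <;> simp [h0]) (a := pdx (pdx δ) 0) (b := pdy (pdx δ) 0) (d := 1) h1 one_ne_zero (fun v => by
      have hd : DifferentiableAt ℝ (pdx δ) 0 := hδx.differentiable (by norm_cast) 0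
      have h2 := hd.hasFDerivAt.prodMk (hasFDerivAt_snd (𝕜 := ℝ) (p := (0 : ℝ × ℝ)))
      rw [h2.fderiv]
      ext
      · simp only [ContinuousLinearMap.prod_apply, fderiv_eq_pd hd]; ring
      · simp)
  have hc : ContDiffAt ℝ n (fun y : ℝ => (Φ (0, y)).1) 0 :=
    contDiffAt_fst.comp (0:ℝ) ((hΦ 0 mV).comp (0:ℝ) (contDiffAt_const.prodMk contDiffAt_id))
  obtain ⟨ξ, hξ, e⟩ := exists_global hc
  refine ⟨ξ, hξ, ?_, ?_⟩
  · rw [e.self_of_nhds]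
    have : ((0:ℝ), (0:ℝ)) = 0 := rfl
    simp [this, hΦ0]
  · have hcont : Tendsto (fun y : ℝ => ((0:ℝ), y)) (nhds 0) (nhds 0) := by
      have : Continuous (fun y : ℝ => ((0:ℝ), y)) := by fun_prop
      exact this.tendsto 0
    filter_upwards [e, hcont (oV.mem_nhds mV)] with y hy hyV
    have := hr _ hyV
    rw [Prod.mk.injEq] at this
    have h3 : (ξ y, y) = Φ (0, y) := by
      ext
      · exact hy
      · exact this.2.symm
    rw [h3]; exact this.1

theorem exists_EK {ε α c50 c41 c32 c23 : ℝ} (hε : ε = 1 ∨ ε = -1) {δ : ℝ × ℝ → ℝ} (hδ : ContDiff ℝ (⊤ : ℕ∞) δ)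
    (h : HasJetAt0 δ (fun p => -2 * Pxx ε α c50 c41 c32 c23 p) 3) :
    ∃ (ξ : ℝ → ℝ) (E : ℝ × ℝ → ℝ) (K : ℝ → ℝ), ContDiff ℝ 6 ξ ∧ ξ 0 = 0 ∧ ContDiff ℝ 4 E ∧ E 0 = -24 * ε ∧
      ContDiff ℝ 3 K ∧ K 0 = -(-5 * ε * c50 * α ^ 3 + 12 * c41 * α ^ 2 - 24 * ε * c32 * α + 32 * c23) / 8 ∧
      ∀ᶠ p in nhds (0 : ℝ × ℝ), δ p = p.2 ^ 3 * K p.2 + (p.1 - ξ p.2) ^ 2 * E p := by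
  have hε2 : ε ^ 2 = 1 := by rcases hε with rfl | rfl <;> norm_num
  obtain ⟨hδ0, hx, -, j2, jx, hxx, hxy⟩ := discr_facts hε hδ h
  obtain ⟨ξ, hξ, ξ0, hc⟩ := exists_xi hδ hx (by rw [hxx]; rcases hε with rfl | rfl <;> norm_num) 6 (by norm_num)
  -- asymptotics
  have ty : Tendsto (fun y => (ξ y, y)) (nhds 0) (nhds (0 : ℝ × ℝ)) := by
    have : Continuous (fun y => (ξ y, y)) := hξ.continuous.prodMk continuous_id
    have := this.tendsto 0
    rwa [ξ0] at this
  have oξ : ξ =O[nhds 0] fun y => y := by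
    have := ((hξ.differentiable (by norm_num)) 0).hasFDerivAt.isBigO_sub
    simpa [ξ0] using this
  have oN : (fun y => ‖(ξ y, y)‖) =O[nhds 0] fun y => y := (oξ.prod_left (isBigO_refl _ _)).norm_left
  have o1 : (fun y => Qx ε α c50 c41 c32 (ξ y, y)) =o[nhds 0] fun y => y ^ 2 := by
    have := (jx.comp_tendsto ty).trans_isBigO (oN.pow 2)
    refine this.neg_left.congr' ?_ EventuallyEq.rfl
    filter_upwards [hc] with y hy
    simp [hy]
  have o2 : (fun y => 4 * ε * ξ y + α * y) =O[nhds 0] fun y => y ^ 2 := by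
    have q : (fun y => 10 * c50 * ξ y ^ 2 + 4 * c41 * (ξ y * y) + c32 * y ^ 2) =O[nhds 0] fun y => y ^ 2 :=
      (((oξ.pow 2).const_mul_left _).add (((oξ.mul (isBigO_refl (fun y : ℝ => y) _)).congr_right fun y => (sq y).symm).const_mul_left _)).add
        ((isBigO_refl _ _).const_mul_left _)
    refine ((o1.isBigO.const_mul_left (-1/12)).sub q).congr_left fun y => ?_
    simp only [Qx]; ring
  have o3 : (fun y => 4 * ε * ξ y + α * y) =o[nhds 0] fun y => y := by
    refine o2.trans_isLittleO ?_
    have := (isLittleO_pow_id (𝕜 := ℝ) (n := 2) (by norm_num))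
    exact this
  set κ := -(-5 * ε * c50 * α ^ 3 + 12 * c41 * α ^ 2 - 24 * ε * c32 * α + 32 * c23) / 8 with hκ
  have o4 : (fun y => δ (ξ y, y) - κ * y ^ 3) =o[nhds 0] fun y => y ^ 3 := by
    have a1 := (h.comp_tendsto ty).trans_isBigO (oN.pow 3)
    have a2 : (fun y => (4 * ε * ξ y + α * y) * (4 * ε * ξ y + α * y)) =o[nhds 0] fun y => y ^ 3 :=
      (o3.mul_isBigO o2).congr_right fun y => by ring
    have ol : (fun y => -ε * α / 4 * y) =O[nhds 0] fun y => y := (isBigO_refl _ _).const_mul_left _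
    have or := isBigO_refl (fun y : ℝ => y) (nhds 0)
    have a3 : (fun y => -40 * c50 * (ξ y * ξ y + ξ y * (-ε * α / 4 * y) + (-ε * α / 4 * y) * (-ε * α / 4 * y))
        - 24 * c41 * (y * (ξ y + (-ε * α / 4 * y))) - 12 * c32 * (y * y)) =O[nhds 0] fun y => y * y :=
      (((((oξ.mul oξ).add (oξ.mul ol)).add (ol.mul ol)).const_mul_left _).sub
        ((or.mul (oξ.add ol)).const_mul_left _)).sub ((or.mul or).const_mul_left _)
    have a4 := (o3.mul_isBigO a3).congr_right (g₂ := fun y => y ^ 3) fun y => by ring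
    refine ((a1.add (a2.const_mul_left (-(3 / 2) * ε))).add (a4.const_mul_left (ε / 4))).congr_left fun y => ?_
    simp only [Function.comp, Pxx, hκ]
    obtain rfl | rfl := hε <;> ring
  have hξ2 : ContDiff ℝ 6 (fun y => (ξ y, y)) := (show ContDiff ℝ 6 ξ from hξ).prodMk contDiff_id
  have hδ6 : ContDiff ℝ 6 δ := contDiff_infty.1 hδ 6
  have hk : ContDiff ℝ ((3 + 3 : ℕ) : WithTop ℕ∞) (fun y => δ (ξ y, y) - κ * y ^ 3) := by
    have : ContDiff ℝ 6 (fun y => δ (ξ y, y) - κ * y ^ 3) := (hδ6.comp hξ2).sub (by fun_prop)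
    exact_mod_cast this
  obtain ⟨M, hM, hM0, eM⟩ := divide_pow 3 3 hk (o4.mono nhdsWithin_le_nhds)
  have hG : ContDiff ℝ ((5 + 1 : ℕ) : WithTop ℕ∞) (fun p : ℝ × ℝ => δ (p.1 + ξ p.2, p.2)) := by
    have h1 : ContDiff ℝ 6 (fun p : ℝ × ℝ => ξ p.2) := (show ContDiff ℝ 6 ξ from hξ).comp contDiff_snd
    have : ContDiff ℝ 6 (fun p : ℝ × ℝ => δ (p.1 + ξ p.2, p.2)) :=
      hδ6.comp ((contDiff_fst.add h1).prodMk contDiff_snd)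
    exact_mod_cast this
  obtain ⟨H, hH, eH⟩ := hadamard1 hG
  obtain ⟨E, hE, eE⟩ := hadamard1 (n := 4) hH
  simp only [zero_add] at eH
  have hH0 : ∀ y, H (0, y) = pdx δ (ξ y, y) := fun y => by
    have hd : DifferentiableAt ℝ (fun s => H (s, y)) 0 := by
      have : ContDiff ℝ (5 : ℕ) (fun s => H (s, y)) := hH.comp (contDiff_id.prodMk contDiff_const)
      exact this.differentiable (by norm_num) 0
    have h1 : HasDerivAt (fun s => δ (ξ y, y) + s * H (s, y)) (H (0, y)) 0 := by
      refine (((hasDerivAt_id (0:ℝ)).mul hd.hasDerivAt).const_add (δ (ξ y, y))).congr_deriv ?_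
      simp
    have h2 : (fun s => δ (ξ y, y) + s * H (s, y)) = fun s => δ (s + ξ y, y) := by
      funext s; exact (eH (s, y)).symm
    rw [h2] at h1
    rw [← h1.deriv, deriv_comp_add_const (f := fun s => δ (s, y))]
    simp [pdx]
  have hE0 : E 0 = -24 * ε := by
    have t1 : Tendsto (fun s : ℝ => (s, (0:ℝ))) (nhds 0) (nhds (0 : ℝ × ℝ)) := by
      have : Continuous (fun s : ℝ => (s, (0:ℝ))) := by fun_prop
      exact this.tendsto 0
    have b1 := j2.comp_tendsto t1
    have b2 : (fun s : ℝ => ‖(s, (0:ℝ))‖ ^ 2) =O[nhds 0] fun s => s ^ 2 := by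
      refine IsBigO.pow (IsBigO.norm_left ((isBigO_refl _ _).prod_left (isBigO_zero _ _))) 2
    have b3 := (b1.trans_isBigO b2).mono (nhdsWithin_le_nhds (s := {0}ᶜ))
    have b4 := (isBigO_refl (fun s : ℝ => (s ^ 2)⁻¹) (nhdsWithin 0 {0}ᶜ)).mul_isLittleO b3
    have b5 : (fun s : ℝ => E (s, 0) + 24 * ε) =o[nhdsWithin 0 {0}ᶜ] fun _ => (1 : ℝ) := by
      refine b4.congr' ?_ ?_
      · filter_upwards [self_mem_nhdsWithin] with s hs
        have hs : s ≠ 0 := hs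
        have e1 := eH (s, 0)
        have e2 := eE (s, 0)
        have e3 := hH0 0
        simp only [ξ0, add_zero] at e1 e2 e3
        rw [show pdx δ (0, 0) = 0 from hx] at e3
        rw [e3, zero_add] at e2
        rw [show δ (0, 0) = 0 from hδ0, e2] at e1
        simp only [Function.comp]
        rw [e1]; field_simp; ring
      · filter_upwards [self_mem_nhdsWithin] with s hs
        have hs : s ≠ 0 := hs
        field_simp
    rw [isLittleO_one_iff] at b5
    have b6 : Tendsto (fun s : ℝ => E (s, 0) + 24 * ε) (nhdsWithin 0 {0}ᶜ) (nhds (E 0 + 24 * ε)) :=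
      (((hE.continuous.tendsto 0).comp t1).add_const _).mono_left nhdsWithin_le_nhds
    linarith [tendsto_nhds_unique b5 b6]
  refine ⟨ξ, fun p => E (p.1 - ξ p.2, p.2), fun y => κ + M y, hξ, ξ0, ?_, by
      show E (0 - ξ 0, 0) = _
      rw [ξ0, sub_zero]; exact hE0,
    contDiff_const.add hM, by simp [hM0], ?_⟩
  · have h1 : ContDiff ℝ 4 (fun p : ℝ × ℝ => ξ p.2) := ((show ContDiff ℝ 6 ξ from hξ).of_le (by norm_num)).comp contDiff_snd
    exact (show ContDiff ℝ 4 E from hE).comp ((contDiff_fst.sub h1).prodMk contDiff_snd)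
  · have t2 : Tendsto (fun p : ℝ × ℝ => p.2) (nhds 0) (nhds 0) := continuous_snd.tendsto 0
    filter_upwards [t2.eventually hc] with p hp
    have e1 := eH (p.1 - ξ p.2, p.2)
    have e2 := eE (p.1 - ξ p.2, p.2)
    have e3 := eM p.2
    simp only [sub_add_cancel, hH0, hp, zero_add] at e1 e2
    rw [e2] at e1
    show δ (p.1, p.2) = _
    rw [e1]
    linear_combination e3

/-- clamp to `[-r, r]` -/
def clampR (r t : ℝ) : ℝ := max (-r) (min t r)

theorem clampR_abs {r : ℝ} (hr : 0 ≤ r) (t : ℝ) : |clampR r t| ≤ r := by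
  rw [abs_le]; unfold clampR
  exact ⟨le_max_left _ _, max_le (by linarith) (min_le_right _ _)⟩
theorem clampR_lip (r s t : ℝ) : |clampR r s - clampR r t| ≤ |s - t| := by
  unfold clampR
  refine (abs_max_sub_max_le_max _ _ _ _).trans (max_le (by simp) ?_)
  exact (abs_min_sub_min_le_max _ _ _ _).trans (by simp)
theorem clampR_id {r t : ℝ} (h : |t| < r) : clampR r t = t := by
  rw [abs_lt] at h
  unfold clampR
  rw [min_eq_left h.2.le, max_eq_right h.1.le]

theorem exists_dat {μ0 n0 : ℝ × ℝ → ℝ} (hμ : ContDiffAt ℝ 1 μ0 0) (hn : ContDiffAt ℝ 1 n0 0) (h0 : μ0 0 = 0)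
    (hn0 : 0 < n0 0) {V : Set (ℝ × ℝ)} (hV : V ∈ nhds (0 : ℝ × ℝ)) :
    ∃ D : Dat, D.box ⊆ V ∧ ∀ p ∈ D.box, D.μ p = μ0 p ∧ D.n p = n0 p := by
  obtain ⟨K1, t1, ht1, l1⟩ := hμ.exists_lipschitzOnWith
  obtain ⟨K2, t2, ht2, l2⟩ := hn.exists_lipschitzOnWith
  have hμl : ∀ᶠ p in nhds 0, |μ0 p| < 1 / 20 := by
    have := hμ.continuousAt.abs
    refine this.eventually_lt_const ?_
    show |μ0 0| < 1 / 20
    rw [h0]; norm_num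
  have hnl : ∀ᶠ p in nhds 0, n0 p < 2 * n0 0 := hn.continuousAt.eventually_lt_const (by linarith)
  have hnl2 : ∀ᶠ p in nhds 0, 0 < n0 p := hn.continuousAt.eventually_const_lt hn0
  obtain ⟨R, hR, hb⟩ := Metric.eventually_nhds_iff_ball.1
    (((((eventually_mem_set.2 ht1).and (eventually_mem_set.2 ht2)).and (hμl.and hnl)).and hnl2).and (eventually_mem_set.2 hV))
  let r := min (R / 2) (min 1 (1 / (80 * n0 0)))
  have hr : 0 < r := by positivity
  have hrR : r < R := (min_le_left _ _).trans_lt (by linarith)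
  let C : ℝ × ℝ → ℝ × ℝ := fun p => (clampR r p.1, clampR r p.2)
  have hC : ∀ p, C p ∈ Metric.ball (0 : ℝ × ℝ) R := fun p => by
    rw [mem_ball_zero_iff]
    exact (max_le (clampR_abs hr.le _) (clampR_abs hr.le _)).trans_lt hrR
  have hCd : ∀ p q, dist (C p) (C q) ≤ |p.1 - q.1| + |p.2 - q.2| := fun p q => by
    rw [Prod.dist_eq]
    refine max_le ?_ ?_
    · exact (clampR_lip _ _ _).trans (by linarith [abs_nonneg (p.2 - q.2)])
    · exact (clampR_lip _ _ _).trans (by linarith [abs_nonneg (p.1 - q.1)])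
  have hlip : ∀ {g : ℝ × ℝ → ℝ} {K : NNReal} {t}, LipschitzOnWith K g t → (∀ p, C p ∈ t) → (K : ℝ) ≤ K1 + K2 →
      ∀ p q, |g (C p) - g (C q)| ≤ (K1 + K2) * (|p.1 - q.1| + |p.2 - q.2|) := fun hl ht hK p q => by
    have := hl.dist_le_mul _ (ht p) _ (ht q)
    rw [Real.dist_eq] at this
    exact this.trans (mul_le_mul hK (hCd p q) dist_nonneg (by positivity))
  have hC0 : C 0 = 0 := by
    ext <;> exact clampR_id (by simpa using hr)
  have hCi : ∀ p : ℝ × ℝ, |p.1| < r ∧ |p.2| < r → C p = p := fun p hp => by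
    ext
    · exact clampR_id hp.1
    · exact clampR_id hp.2
  refine ⟨⟨fun p => μ0 (C p), fun p => n0 (C p), r, K1 + K2, 2 * n0 0, hr, (min_le_right _ _).trans (min_le_left _ _), by positivity,
    hlip l1 (fun p => (hb _ (hC p)).1.1.1.1) (by simp), hlip l2 (fun p => (hb _ (hC p)).1.1.1.2) (by simp), ?_,
    fun p => (hb _ (hC p)).1.1.2.1.le, fun p => (hb _ (hC p)).1.2, fun p => (hb _ (hC p)).1.1.2.2.le, ?_⟩, ?_, ?_⟩
  · show μ0 (C 0) = 0
    rw [hC0, h0]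
  · have : r ≤ 1 / (80 * n0 0) := (min_le_right _ _).trans (min_le_right _ _)
    calc 2 * n0 0 * r ≤ 2 * n0 0 * (1 / (80 * n0 0)) := by gcongr
      _ = 1 / 40 := by field_simp; norm_num
  · intro p hp
    have := (hb _ (hC p)).2
    rwa [hCi p hp] at this
  · intro p hp
    exact ⟨congrArg μ0 (hCi p hp), congrArg n0 (hCi p hp)⟩

theorem exists_psi {ε κ : ℝ} (hε : ε = 1 ∨ ε = -1) (hκ : κ ≠ 0) {δ : ℝ × ℝ → ℝ} {ξ : ℝ → ℝ} {E : ℝ × ℝ → ℝ} {K : ℝ → ℝ}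
    (hξ : ContDiff ℝ 6 ξ) (ξ0 : ξ 0 = 0) (hE : ContDiff ℝ 4 E) (hE0 : E 0 = -24 * ε) (hK : ContDiff ℝ 3 K) (hK0 : K 0 = κ)
    (hδ : ∀ᶠ p in nhds (0 : ℝ × ℝ), δ p = p.2 ^ 3 * K p.2 + (p.1 - ξ p.2) ^ 2 * E p) :
    ∃ (Ψ : ℝ × ℝ → ℝ × ℝ) (a b d : ℝ), ContDiffAt ℝ 3 Ψ 0 ∧ Ψ 0 = 0 ∧ a ≠ 0 ∧ d ≠ 0 ∧
      (∀ v : ℝ × ℝ, fderiv ℝ Ψ 0 v = (a * v.1 + b * v.2, d * v.2)) ∧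
      ∀ᶠ p in nhds (0 : ℝ × ℝ), δ p = ε * ((Ψ p).2 ^ 3 - (Ψ p).1 ^ 2) := by
  have hε2 : ε ^ 2 = 1 := by rcases hε with rfl | rfl <;> norm_num
  obtain ⟨s, hs2, hs⟩ : ∃ s : ℝ, s ^ 2 = 1 ∧ 0 < s * ε * κ := by
    have : ε * κ ≠ 0 := mul_ne_zero (by rintro rfl; norm_num at hε2) hκ
    rcases lt_or_gt_of_ne this with h | h
    · exact ⟨-1, by norm_num, by linarith⟩
    · exact ⟨1, by norm_num, by linarith⟩
  let S : ℝ × ℝ → ℝ := fun p => Real.sqrt (-ε * E p)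
  let g : ℝ × ℝ → ℝ := fun p => s * (s * ε * K p.2) ^ (1 / 3 : ℝ)
  have e0 : -ε * E 0 = 24 := by rw [hE0]; linear_combination 24 * hε2
  have hS : ContDiffAt ℝ 3 S 0 := by
    refine ContDiffAt.sqrt ?_ (by rw [e0]; norm_num)
    exact contDiffAt_const.mul (hE.contDiffAt.of_le (by norm_num))
  have hg : ContDiffAt ℝ 3 g 0 := by
    refine contDiffAt_const.mul (ContDiffAt.rpow_const_of_ne ?_ ?_)
    · exact contDiffAt_const.mul (hK.comp contDiff_snd).contDiffAt
    · show s * ε * K 0 ≠ 0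
      rw [hK0]; exact hs.ne'
  have hS0 : S 0 ≠ 0 := by
    show Real.sqrt (-ε * E 0) ≠ 0
    rw [e0]; positivity
  have hg0 : g 0 ≠ 0 := by
    show s * (s * ε * K 0) ^ (1 / 3 : ℝ) ≠ 0
    rw [hK0]
    exact mul_ne_zero (by rintro rfl; norm_num at hs2) (Real.rpow_pos_of_pos hs _).ne'
  have hu : ContDiff ℝ 3 (fun p : ℝ × ℝ => p.1 - ξ p.2) :=
    contDiff_fst.sub ((hξ.of_le (by norm_num)).comp contDiff_snd)
  have hdu : HasFDerivAt (fun p : ℝ × ℝ => p.1 - ξ p.2)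
      (ContinuousLinearMap.fst ℝ ℝ ℝ - (deriv ξ 0) • ContinuousLinearMap.snd ℝ ℝ ℝ) 0 := by
    refine hasFDerivAt_fst.sub ?_
    exact ((hξ.differentiable (by norm_num)) 0).hasDerivAt.comp_hasFDerivAt (0 : ℝ × ℝ) hasFDerivAt_snd
  refine ⟨fun p => ((p.1 - ξ p.2) * S p, p.2 * g p), S 0, -(S 0 * deriv ξ 0), g 0,
    (hu.contDiffAt.mul hS).prodMk (contDiffAt_snd.mul hg), by ext <;> simp [ξ0], hS0, hg0, fun v => ?_, ?_⟩
  · have h1 := (hdu.mul (hS.differentiableAt (by norm_num)).hasFDerivAt).prodMk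
      ((hasFDerivAt_snd (𝕜 := ℝ) (p := (0 : ℝ × ℝ))).mul (hg.differentiableAt (by norm_num)).hasFDerivAt)
    have h2 := h1.fderiv
    have h3 := congrArg (fun L => L v) h2
    refine h3.trans ?_
    ext
    · simp [ξ0]; ring
    · simp
  · have t1 : ∀ᶠ p in nhds (0 : ℝ × ℝ), 0 < -ε * E p := by
      have : Continuous fun p => -ε * E p := continuous_const.mul hE.continuous
      exact (this.tendsto 0).eventually_const_lt (by rw [e0]; norm_num)
    have t2 : ∀ᶠ p in nhds (0 : ℝ × ℝ), 0 < s * ε * K p.2 := by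
      have : Continuous fun p : ℝ × ℝ => s * ε * K p.2 := continuous_const.mul (hK.continuous.comp continuous_snd)
      exact (this.tendsto 0).eventually_const_lt (by
        show 0 < s * ε * K 0
        rw [hK0]; exact hs)
    filter_upwards [hδ, t1, t2] with p h1 h2 h3
    have q1 : S p ^ 2 = -ε * E p := Real.sq_sqrt h2.le
    have q2 : g p ^ 3 = ε * K p.2 := by
      show (s * (s * ε * K p.2) ^ (1 / 3 : ℝ)) ^ 3 = _
      rw [mul_pow, ← Real.rpow_natCast ((s * ε * K p.2) ^ (1 / 3 : ℝ)) 3, ← Real.rpow_mul h3.le]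
      norm_num
      linear_combination (s ^ 2 + 1) * ε * K p.2 * hs2
    rw [h1]
    simp only [mul_pow, q1, q2]
    linear_combination -(p.2 ^ 3 * K p.2 + (p.1 - ξ p.2) ^ 2 * E p) * hε2

theorem bde_alg {a b c A1 A2 B1 B2 at' V1 V2 δ : ℝ} (hat : at' = a * B2 ^ 2 + 2 * b * B1 * B2 + c * B1 ^ 2) (h : at' ≠ 0)
    (hδ : b ^ 2 - a * c = δ) :
    (a * (V1 * A2 + V2 * B2) ^ 2 + 2 * b * (V1 * A1 + V2 * B1) * (V1 * A2 + V2 * B2) + c * (V1 * A1 + V2 * B1) ^ 2 = 0) ↔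
    (V2 - (-(a * A2 * B2 + b * (A1 * B2 + A2 * B1) + c * A1 * B1) / at') * V1) ^ 2 =
      |(A1 * B2 - A2 * B1) / at'| ^ 2 * δ * V1 ^ 2 := by
  rw [sq_abs]
  have key : (V2 - (-(a * A2 * B2 + b * (A1 * B2 + A2 * B1) + c * A1 * B1) / at') * V1) ^ 2 -
      ((A1 * B2 - A2 * B1) / at') ^ 2 * δ * V1 ^ 2 =
      (a * (V1 * A2 + V2 * B2) ^ 2 + 2 * b * (V1 * A1 + V2 * B1) * (V1 * A2 + V2 * B2) + c * (V1 * A1 + V2 * B1) ^ 2) / at' := by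
    rw [← hδ]
    field_simp
    rw [hat]; ring
  rw [← sub_eq_zero (a := (V2 - _) ^ 2), key, div_eq_zero_iff]
  simp [h]

theorem final_equiv {ε : ℝ} (hε : ε = 1 ∨ ε = -1) {a b c : ℝ × ℝ → ℝ} (ha : ContDiff ℝ 1 a) (hb : ContDiff ℝ 1 b)
    (hc : ContDiff ℝ 1 c) (ha0 : a 0 ≠ 0) (hb0 : b 0 = 0) (hc0 : c 0 = 0)
    {Ψ : ℝ × ℝ → ℝ × ℝ} {p q d : ℝ} (hΨ : ContDiffAt ℝ 3 Ψ 0) (Ψ0 : Ψ 0 = 0) (hp : p ≠ 0) (hd : d ≠ 0)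
    (hv : ∀ v : ℝ × ℝ, fderiv ℝ Ψ 0 v = (p * v.1 + q * v.2, d * v.2))
    (hδ : ∀ᶠ P in nhds (0 : ℝ × ℝ), b P ^ 2 - a P * c P = ε * ((Ψ P).2 ^ 3 - (Ψ P).1 ^ 2)) :
    TopEquivAt0 (BDE a b c) (BDE (fun _ => 1) (fun _ => 0) (fun p => ε * p.1 ^ 2 + p.2 ^ 3)) := by
  obtain ⟨Φ, U, V, oU, oV, mU, mV, cΨ, cΦ, mp, mq, li, ri, Φ0⟩ := ift (n := 3) (by norm_num) hΨ Ψ0 hp hd hv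
  have hD : ContDiffAt ℝ 2 (fderiv ℝ Φ) 0 := (cΦ 0 mV).fderiv_right (by norm_num)
  have hD1 : ContDiffAt ℝ 1 (fderiv ℝ Φ) 0 := hD.of_le (by norm_num)
  have hΦ1 : ContDiffAt ℝ 1 Φ 0 := (cΦ 0 mV).of_le (by norm_num)
  let A1 : ℝ × ℝ → ℝ := fun P => (fderiv ℝ Φ P (1, 0)).1
  let A2 : ℝ × ℝ → ℝ := fun P => (fderiv ℝ Φ P (1, 0)).2
  let B1 : ℝ × ℝ → ℝ := fun P => (fderiv ℝ Φ P (0, 1)).1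
  let B2 : ℝ × ℝ → ℝ := fun P => (fderiv ℝ Φ P (0, 1)).2
  have cA1 : ContDiffAt ℝ 1 A1 0 := contDiffAt_fst.comp (0 : ℝ × ℝ) (hD1.clm_apply contDiffAt_const)
  have cA2 : ContDiffAt ℝ 1 A2 0 := contDiffAt_snd.comp (0 : ℝ × ℝ) (hD1.clm_apply contDiffAt_const)
  have cB1 : ContDiffAt ℝ 1 B1 0 := contDiffAt_fst.comp (0 : ℝ × ℝ) (hD1.clm_apply contDiffAt_const)
  have cB2 : ContDiffAt ℝ 1 B2 0 := contDiffAt_snd.comp (0 : ℝ × ℝ) (hD1.clm_apply contDiffAt_const)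
  have ca : ContDiffAt ℝ 1 (fun P => a (Φ P)) 0 := ha.contDiffAt.comp (0 : ℝ × ℝ) hΦ1
  have cb : ContDiffAt ℝ 1 (fun P => b (Φ P)) 0 := hb.contDiffAt.comp (0 : ℝ × ℝ) hΦ1
  have cc : ContDiffAt ℝ 1 (fun P => c (Φ P)) 0 := hc.contDiffAt.comp (0 : ℝ × ℝ) hΦ1
  -- derivative at 0
  have hinv : ∀ v, fderiv ℝ Ψ 0 (fderiv ℝ Φ 0 v) = v := fun v => by
    have h1 : HasFDerivAt (fun y => Ψ (Φ y)) ((fderiv ℝ Ψ 0).comp (fderiv ℝ Φ 0)) 0 := by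
      have hd1 : HasFDerivAt Ψ (fderiv ℝ Ψ 0) (Φ 0) := by
        rw [Φ0]; exact (hΨ.differentiableAt (by norm_num)).hasFDerivAt
      exact hd1.comp 0 (hΦ1.differentiableAt (by norm_num)).hasFDerivAt
    have h2 : (fun y => Ψ (Φ y)) =ᶠ[nhds 0] fun y => y := by
      filter_upwards [oV.mem_nhds mV] with y hy using ri y hy
    have h3 : HasFDerivAt (fun y => Ψ (Φ y)) (ContinuousLinearMap.id ℝ (ℝ × ℝ)) 0 :=
      (hasFDerivAt_id _).congr_of_eventuallyEq h2
    exact congrArg (fun L => L v) (h1.unique h3)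
  have i1 := hinv (1, 0)
  have i2 := hinv (0, 1)
  rw [hv, Prod.mk.injEq] at i1 i2
  have eA2 : A2 0 = 0 := by simpa [hd] using i1.2
  have eA1 : p * A1 0 = 1 := by have := i1.1; rw [show (fderiv ℝ Φ 0 (1, 0)).2 = 0 from eA2] at this; simpa using this
  have eB2 : d * B2 0 = 1 := i2.2
  have nA1 : A1 0 ≠ 0 := by rintro h; rw [h] at eA1; norm_num at eA1
  have nB2 : B2 0 ≠ 0 := by rintro h; rw [h] at eB2; norm_num at eB2
  let aa : ℝ × ℝ → ℝ := fun P => a (Φ P) * B2 P ^ 2 + 2 * b (Φ P) * B1 P * B2 P + c (Φ P) * B1 P ^ 2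
  let bb : ℝ × ℝ → ℝ := fun P => a (Φ P) * A2 P * B2 P + b (Φ P) * (A1 P * B2 P + A2 P * B1 P) + c (Φ P) * A1 P * B1 P
  let dd : ℝ × ℝ → ℝ := fun P => A1 P * B2 P - A2 P * B1 P
  have caa : ContDiffAt ℝ 1 aa 0 :=
    ((ca.mul (cB2.pow 2)).add (((contDiffAt_const.mul cb).mul cB1).mul cB2)).add (cc.mul (cB1.pow 2))
  have cbb : ContDiffAt ℝ 1 bb 0 :=
    (((ca.mul cA2).mul cB2).add (cb.mul ((cA1.mul cB2).add (cA2.mul cB1)))).add ((cc.mul cA1).mul cB1)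
  have cdd : ContDiffAt ℝ 1 dd 0 := (cA1.mul cB2).sub (cA2.mul cB1)
  have aa0 : aa 0 ≠ 0 := by
    have : aa 0 = a 0 * B2 0 ^ 2 := by simp only [aa, Φ0, hb0, hc0]; ring
    rw [this]; exact mul_ne_zero ha0 (pow_ne_zero _ nB2)
  have bb0 : bb 0 = 0 := by simp only [bb, Φ0, hb0, hc0, eA2]; ring
  have dd0 : dd 0 ≠ 0 := by
    have : dd 0 = A1 0 * B2 0 := by simp only [dd, eA2]; ring
    rw [this]; exact mul_ne_zero nA1 nB2
  have q0 : dd 0 / aa 0 ≠ 0 := div_ne_zero dd0 aa0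
  have hW : ∀ᶠ P in nhds (0 : ℝ × ℝ), P ∈ V ∧ aa P ≠ 0 ∧
      b (Φ P) ^ 2 - a (Φ P) * c (Φ P) = ε * ((Ψ (Φ P)).2 ^ 3 - (Ψ (Φ P)).1 ^ 2) := by
    have tΦ : Tendsto Φ (nhds 0) (nhds 0) := by have := hΦ1.continuousAt.tendsto; rwa [Φ0] at this
    exact (eventually_mem_set.2 (oV.mem_nhds mV)).and ((caa.continuousAt.eventually_ne aa0).and (tΦ.eventually hδ))
  have cn : ContDiffAt ℝ 1 (fun P => |dd P / aa P|) 0 :=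
    ContDiffAt.comp (g := fun t : ℝ => |t|) (0 : ℝ × ℝ) (contDiffAt_abs q0) (cdd.div caa aa0)
  obtain ⟨D, hDW, hDe⟩ := exists_dat (μ0 := fun P => -bb P / aa P) (n0 := fun P => |dd P / aa P|)
    (cbb.neg.div caa aa0) cn (by simp [bb0]) (abs_pos.2 q0) hW
  have hrep : D.Rep ε (fun P v => BDE a b c (Φ P) (fderiv ℝ Φ P v)) := by
    intro P hP v
    obtain ⟨e1, e2⟩ := hDe P hP
    obtain ⟨hPV, hne, hdel⟩ := hDW hP
    rw [ri P hPV] at hdel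
    rw [e1, e2]
    have hlin : fderiv ℝ Φ P v = (v.1 * A1 P + v.2 * B1 P, v.1 * A2 P + v.2 * B2 P) := by
      have : v = v.1 • ((1:ℝ), (0:ℝ)) + v.2 • ((0:ℝ), (1:ℝ)) := by ext <;> simp
      conv_lhs => rw [this, map_add, map_smul, map_smul]
      rfl
    simp only [BDE]
    rw [hlin]
    exact bde_alg rfl hne hdel
  refine TopEquivAt0.trans (TopEquivAt0.symm ?_) (D.topEquiv_of_rep hε hrep)
  exact topEquiv_of_diffeo (h := Φ) (k := Ψ) oV oU mV (fun y hy => ((cΦ y hy).of_le (by norm_num)).contDiffWithinAt)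
    (fun y hy => ((cΨ y hy).of_le (by norm_num)).contDiffWithinAt) mq mp li ri Φ0 (fun P hP v => Iff.rfl)

theorem stmt9 (ε α c50 c41 c32 c23 c14 c05 : ℝ) (hε : ε = 1 ∨ ε = -1)
    (hC : -5 * ε * c50 * α ^ 3 + 12 * c41 * α ^ 2 - 24 * ε * c32 * α + 32 * c23 ≠ 0)
    (f : ℝ × ℝ → ℝ) (hf : ContDiff ℝ (⊤ : ℕ∞) f)
    (hjet : HasJetAt0 f
      (fun p => p.2 ^ 2 + ε * p.1 ^ 4 + α * p.1 ^ 3 * p.2 +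
        ε * (3 / 8) * α ^ 2 * p.1 ^ 2 * p.2 ^ 2 +
        c50 * p.1 ^ 5 + c41 * p.1 ^ 4 * p.2 + c32 * p.1 ^ 3 * p.2 ^ 2 +
        c23 * p.1 ^ 2 * p.2 ^ 3 + c14 * p.1 * p.2 ^ 4 + c05 * p.2 ^ 5) 5) :
    bdeDiscr f 0 = 0 ∧
    (pdx (bdeDiscr f) 0, pdy (bdeDiscr f) 0) = (0, 0) ∧
    HasJetAt0 (bdeDiscr f) (fun p => -(3 * ε / 2) * (4 * p.1 + ε * α * p.2) ^ 2) 2 ∧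
    ∃ η : ℝ, (η = 1 ∨ η = -1) ∧
      TopEquivAt0 (asymBDE f)
        (BDE (fun _ => 1) (fun _ => 0) (fun p => η * p.1 ^ 2 + p.2 ^ 3)) := by
  obtain ⟨jxx, oxy, oyy, jd⟩ := jets ε α c50 c41 c32 c23 c14 c05 f hf hjet
  have hfx : ContDiff ℝ (⊤ : ℕ∞) (pdx f) := pdx_cd hf (by norm_cast)
  have hfy : ContDiff ℝ (⊤ : ℕ∞) (pdy f) := pdy_cd hf (by norm_cast)
  have hxx : ContDiff ℝ (⊤ : ℕ∞) (fxx f) := pdx_cd hfx (by norm_cast)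
  have hxy : ContDiff ℝ (⊤ : ℕ∞) (fxy f) := pdy_cd hfx (by norm_cast)
  have hyy : ContDiff ℝ (⊤ : ℕ∞) (fyy f) := pdy_cd hfy (by norm_cast)
  have hδ : ContDiff ℝ (⊤ : ℕ∞) (bdeDiscr f) := (hxy.pow 2).sub (hxx.mul hyy)
  obtain ⟨d0, dx, dy, j2, -, -, -⟩ := discr_facts hε hδ jd
  refine ⟨d0, by rw [dx, dy], j2, ε, hε, ?_⟩
  obtain ⟨ξ, E, K, hξ, ξ0, hE, hE0, hK, hK0, hδe⟩ := exists_EK hε hδ jd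
  obtain ⟨Ψ, p, q, d, hΨ, Ψ0, hp, hd, hv, hΨδ⟩ := exists_psi hε (div_ne_zero (neg_ne_zero.2 hC) (by norm_num : (8:ℝ) ≠ 0))
    hξ ξ0 hE hE0 hK hK0 hδe
  have v0 : ∀ {g : ℝ × ℝ → ℝ}, (g =O[nhds 0] fun p => ‖p‖ ^ 2) → g 0 = 0 := fun h => by
    obtain ⟨C, hC⟩ := h.bound
    have := hC.self_of_nhds
    simpa using this
  have y0 : fyy f 0 = 2 := by have := v0 oyy; linarith
  refine final_equiv hε (contDiff_infty.1 hyy 1) (contDiff_infty.1 hxy 1) (contDiff_infty.1 hxx 1) (by rw [y0]; norm_num)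
    (v0 oxy) ?_ hΨ Ψ0 hp hd hv (hΨδ.mono fun P hP => by rw [← hP, bdeDiscr]; ring)
  rw [jet_val jxx]; simp [Pxx]
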